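/- arXiv:1901.02657 — 10 statements merged into one kernel-verified Lean document; each statement's English description precedes it below -/
import Mathlib

section
/- Let k ≥ 2 be an integer and b > 0. There exists c > 0, depending only on k and b, such that for every nonempty finite set Z and every subset S of {0, 1, …, k}^Z with N_S ≥ k^{b|Z|}, there is a subset J of Z with |J| ≥ c|Z| such that the restriction S|_J contains all of {1, …, k}^J. -/
/-- Elements of `{0, 1, …, k}` are encoded as `Fin (k+1)`, with `0` corresponding to
`(0 : Fin (k+1))` and `{1, …, k}` corresponding to the successors `(i).succ` of
`i : Fin k`.  For `S ⊆ {0,1,…,k}^Z`, `coveringNumber S` is the minimal number of sets of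
the form `∏_{z ∈ Z} ({0,1,…,k} \ {i_z})` with all `i_z ∈ {1,…,k}` needed to cover `S`. -/
noncomputable def coveringNumber {Z : Type} [Fintype Z] {k : ℕ}
    (S : Set (Z → Fin (k + 1))) : ℕ :=
  sInf {n | ∃ T : Finset (Z → Fin k), T.card = n ∧
    S ⊆ ⋃ i ∈ T, {f : Z → Fin (k + 1) | ∀ z, f z ≠ (i z).succ}}

open Finset Function

section Covering

variable {Z : Type} {k : ℕ}

/-- The covering number of `S` when only the coordinates in `A` are taken into account. -/
noncomputable def coveringNumberOn (A : Finset Z) (S : Set (Z → Fin (k + 1))) : ℕ :=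
  sInf {n | ∃ T : Finset (Z → Fin k), T.card = n ∧
    ∀ f ∈ S, ∃ i ∈ T, ∀ z ∈ A, f z ≠ (i z).succ}

/-- `S` contains all of `{1, …, k}^J` after restriction to `J`. -/
def IsIndependenceSet (S : Set (Z → Fin (k + 1))) (J : Finset Z) : Prop :=
  ∀ g : Z → Fin k, ∃ f ∈ S, ∀ z ∈ J, f z = (g z).succ

open Classical in
/-- The independence sets of `S` contained in `A`. -/
noncomputable def independenceSets (A : Finset Z) (S : Set (Z → Fin (k + 1))) :
    Finset (Finset Z) :=
  A.powerset.filter (IsIndependenceSet S)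

theorem mem_independenceSets {A J : Finset Z} {S : Set (Z → Fin (k + 1))} :
    J ∈ independenceSets A S ↔ J ⊆ A ∧ IsIndependenceSet S J := by
  classical
  simp [independenceSets]

theorem independenceSets_mono {A B : Finset Z} {S T : Set (Z → Fin (k + 1))} (hA : A ⊆ B)
    (hS : S ⊆ T) : independenceSets A S ⊆ independenceSets B T := by
  intro J hJ
  rw [mem_independenceSets] at hJ ⊢
  refine ⟨hJ.1.trans hA, fun g => ?_⟩
  obtain ⟨f, hf, h⟩ := hJ.2 g
  exact ⟨f, hS hf, h⟩

theorem exists_fin_succ_ne (hk : 2 ≤ k) (a : Fin (k + 1)) : ∃ i : Fin k, a ≠ i.succ := by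
  by_cases h : a = (⟨0, by omega⟩ : Fin k).succ
  · refine ⟨⟨1, by omega⟩, ?_⟩
    rw [h]
    simp [Fin.ext_iff]
  · exact ⟨_, h⟩

theorem coveringNumberOn_spec [Fintype Z] (hk : 2 ≤ k) (A : Finset Z) (S : Set (Z → Fin (k + 1))) :
    ∃ T : Finset (Z → Fin k), T.card = coveringNumberOn A S ∧
      ∀ f ∈ S, ∃ i ∈ T, ∀ z ∈ A, f z ≠ (i z).succ := by
  classical
  refine Nat.sInf_mem (s := {n | ∃ T : Finset (Z → Fin k), T.card = n ∧
    ∀ f ∈ S, ∃ i ∈ T, ∀ z ∈ A, f z ≠ (i z).succ}) ⟨_, univ, rfl, fun f _ => ?_⟩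
  choose i hi using fun z => exists_fin_succ_ne hk (f z)
  exact ⟨i, mem_univ _, fun z _ => hi z⟩

theorem coveringNumberOn_le {A : Finset Z} {S : Set (Z → Fin (k + 1))} (T : Finset (Z → Fin k))
    (hT : ∀ f ∈ S, ∃ i ∈ T, ∀ z ∈ A, f z ≠ (i z).succ) : coveringNumberOn A S ≤ T.card :=
  Nat.sInf_le ⟨T, rfl, hT⟩

theorem coveringNumber_eq_coveringNumberOn_univ [Fintype Z] (S : Set (Z → Fin (k + 1))) :
    coveringNumber S = coveringNumberOn univ S := by
  simp only [coveringNumber, coveringNumberOn, Set.subset_def, Set.mem_iUnion, Set.mem_ofPred_eq,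
    mem_univ, true_imp_iff, exists_prop]

theorem coveringNumberOn_empty_le_one (hk : 2 ≤ k) (S : Set (Z → Fin (k + 1))) :
    coveringNumberOn ∅ S ≤ 1 :=
  coveringNumberOn_le {fun _ => ⟨0, by omega⟩} (by simp)

theorem coveringNumberOn_insert_le [Fintype Z] [DecidableEq Z] (hk : 2 ≤ k) (A : Finset Z) (z : Z)
    (S : Set (Z → Fin (k + 1))) (i : Fin k) :
    coveringNumberOn (insert z A) S ≤
      coveringNumberOn A {f ∈ S | f z ≠ i.succ} + coveringNumberOn A {f ∈ S | f z = i.succ} := by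
  obtain ⟨T, hT, hTc⟩ := coveringNumberOn_spec hk A {f ∈ S | f z ≠ i.succ}
  obtain ⟨U, hU, hUc⟩ := coveringNumberOn_spec hk A {f ∈ S | f z = i.succ}
  obtain ⟨j, hj⟩ := exists_fin_succ_ne hk i.succ
  have key : ∀ (f : Z → Fin (k + 1)) (g : Z → Fin k) (l : Fin k), f z ≠ l.succ →
      (∀ w ∈ A, f w ≠ (g w).succ) → ∀ w ∈ insert z A, f w ≠ (update g z l w).succ := by
    intro f g l hl hg w hw
    rcases eq_or_ne w z with rfl | hwz
    · simpa using hl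
    · rw [update_of_ne hwz]
      exact hg w (mem_of_mem_insert_of_ne hw hwz)
  rw [← hT, ← hU]
  refine (coveringNumberOn_le (T.image (update · z i) ∪ U.image (update · z j)) ?_).trans
    ((card_union_le _ _).trans (add_le_add card_image_le card_image_le))
  intro f hf
  by_cases h : f z = i.succ
  · obtain ⟨g, hg, hfg⟩ := hUc f ⟨hf, h⟩
    exact ⟨_, mem_union_right _ (mem_image_of_mem _ hg), key f g j (h ▸ hj) hfg⟩
  · obtain ⟨g, hg, hfg⟩ := hTc f ⟨hf, h⟩
    exact ⟨_, mem_union_left _ (mem_image_of_mem _ hg), key f g i h hfg⟩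

theorem sum_card_le_card_biUnion_add {α : Type*} [DecidableEq α] (F : Fin k → Finset α)
    (I : Finset α) (hI : ∀ a, (∀ i, a ∈ F i) → a ∈ I) :
    ∑ i, (F i).card ≤ (k - 1) * (univ.biUnion F).card + I.card := by
  have h : ∀ i, (F i).card = ∑ a ∈ univ.biUnion F, if a ∈ F i then 1 else 0 := by
    intro i
    rw [sum_boole, Nat.cast_id]
    congr 1
    ext a
    simp only [mem_filter, mem_biUnion, mem_univ, true_and]
    exact ⟨fun ha => ⟨⟨i, ha⟩, ha⟩, And.right⟩
  simp_rw [h]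
  rw [sum_comm]
  calc _ ≤ ∑ a ∈ univ.biUnion F, ((k - 1) + if a ∈ I then 1 else 0) := by
        refine sum_le_sum fun a _ => ?_
        rw [sum_boole, Nat.cast_id]
        by_cases ha : ∀ i, a ∈ F i
        · rw [if_pos (hI a ha)]
          refine (card_le_univ _).trans ?_
          rw [Fintype.card_fin]
          omega
        · push Not at ha
          obtain ⟨i, hi⟩ := ha
          have : (univ.filter fun i => a ∈ F i).card < (univ : Finset (Fin k)).card :=
            card_lt_card (filter_ssubset.2 ⟨i, mem_univ _, hi⟩)
          rw [card_univ, Fintype.card_fin] at this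
          omega
    _ ≤ _ := by
        rw [sum_add_distrib, sum_const, smul_eq_mul, mul_comm, sum_boole, Nat.cast_id]
        gcongr
        intro a ha
        exact (mem_filter.1 ha).2

/-- A Pajor-type inequality: some fibre over a new coordinate has few independence sets. -/
theorem exists_mul_card_independenceSets_le [DecidableEq Z] (hk : 2 ≤ k) {A : Finset Z} {z : Z}
    (hz : z ∉ A) (S : Set (Z → Fin (k + 1))) :
    ∃ i : Fin k, k * (independenceSets A {f ∈ S | f z = i.succ}).card ≤
      (k - 1) * (independenceSets (insert z A) S).card := by
  set F : Fin k → Finset (Finset Z) := fun i => independenceSets A {f ∈ S | f z = i.succ} with hF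
  have : Nonempty (Fin k) := ⟨⟨0, by omega⟩⟩
  obtain ⟨i, -, hi⟩ := exists_min_image univ (fun i => (F i).card) univ_nonempty
  refine ⟨i, ?_⟩
  set I := (univ.biUnion F).filter fun J => ∀ i, J ∈ F i with hI
  have hFA : ∀ i, ∀ J ∈ F i, z ∉ J := fun i J hJ hzJ => hz ((mem_independenceSets.1 hJ).1 hzJ)
  have hIz : ∀ J ∈ I, z ∉ J := fun J hJ => hFA i J ((mem_filter.1 hJ).2 i)
  have hcard : (univ.biUnion F).card + I.card ≤ (independenceSets (insert z A) S).card := by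
    have hinj : Set.InjOn (insert z) (I : Set (Finset Z)) := by
      intro J hJ K hK hJK
      rw [← erase_insert (hIz J hJ), hJK, erase_insert (hIz K hK)]
    rw [← card_image_of_injOn hinj, ← card_union_of_disjoint]
    · refine card_le_card (union_subset ?_ ?_)
      · exact biUnion_subset.2 fun i _ => independenceSets_mono (subset_insert _ _) fun f hf => hf.1
      · intro K hK
        obtain ⟨J, hJ, rfl⟩ := mem_image.1 hK
        have hJF := (mem_filter.1 hJ).2
        refine mem_independenceSets.2
          ⟨insert_subset_insert _ (mem_independenceSets.1 (hJF i)).1, fun g => ?_⟩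
        obtain ⟨f, ⟨hfS, hfz⟩, hf⟩ := (mem_independenceSets.1 (hJF (g z))).2 g
        refine ⟨f, hfS, fun w hw => ?_⟩
        rcases mem_insert.1 hw with rfl | hw
        exacts [hfz, hf w hw]
    · refine disjoint_left.2 fun K hK hK' => ?_
      obtain ⟨j, -, hj⟩ := mem_biUnion.1 hK
      obtain ⟨J, -, rfl⟩ := mem_image.1 hK'
      exact hFA j _ hj (mem_insert_self _ _)
  have hsum := sum_card_le_card_biUnion_add F I fun J hJ =>
    mem_filter.2 ⟨mem_biUnion.2 ⟨i, mem_univ _, hJ i⟩, hJ⟩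
  have hmin : k * (F i).card ≤ ∑ j, (F j).card := by
    simpa using card_nsmul_le_sum univ (fun j => (F j).card) _ fun j hj => hi j hj
  calc k * (F i).card ≤ (k - 1) * (univ.biUnion F).card + I.card := hmin.trans hsum
    _ ≤ (k - 1) * (univ.biUnion F).card + (k - 1) * I.card := by
        gcongr
        exact Nat.le_mul_of_pos_left _ (by omega)
    _ = (k - 1) * ((univ.biUnion F).card + I.card) := by ring
    _ ≤ _ := by gcongr

theorem coveringNumberOn_mul_pow_le [Fintype Z] (hk : 2 ≤ k) (p : ℕ) (A : Finset Z)
    (S : Set (Z → Fin (k + 1))) :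
    (coveringNumberOn A S : ℝ) * (1 - (((k : ℝ) - 1) / k) ^ p) ^ A.card ≤
      ((independenceSets A S).card : ℝ) ^ p := by
  classical
  have hk2 : (2 : ℝ) ≤ k := by exact_mod_cast hk
  set ρ : ℝ := ((k : ℝ) - 1) / k with hρ
  have hρ0 : 0 < ρ := div_pos (by linarith) (by linarith)
  have hρ1 : ρ ≤ 1 := (div_le_one (by linarith)).2 (by linarith)
  have hδ0 : 0 < ρ ^ p := pow_pos hρ0 p
  have hδ1 : ρ ^ p ≤ 1 := pow_le_one₀ hρ0.le hρ1
  set δ := ρ ^ p with hδ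
  induction A using Finset.induction_on generalizing S with
  | empty =>
    rcases S.eq_empty_or_nonempty with rfl | ⟨f, hf⟩
    · have : coveringNumberOn (∅ : Finset Z) (∅ : Set (Z → Fin (k + 1))) = 0 :=
        Nat.le_zero.1 (coveringNumberOn_le ∅ (by simp))
      simp only [this, Nat.cast_zero, zero_mul]
      positivity
    · have h1 : (1 : ℝ) ≤ (independenceSets ∅ S).card := by
        exact_mod_cast card_pos.2 ⟨∅, mem_independenceSets.2 ⟨subset_rfl, fun g => ⟨f, hf, by simp⟩⟩⟩
      have h2 : (coveringNumberOn ∅ S : ℝ) ≤ 1 := by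
        exact_mod_cast coveringNumberOn_empty_le_one hk S
      simpa using h2.trans (one_le_pow₀ h1)
  | insert z A hz ih =>
    have hpow : 0 ≤ (1 - δ) ^ A.card := pow_nonneg (by linarith) _
    rw [card_insert_of_notMem hz, pow_succ]
    by_cases h : ∃ i : Fin k, (coveringNumberOn A {f ∈ S | f z = i.succ} : ℝ) ≤
        δ * coveringNumberOn (insert z A) S
    · obtain ⟨i, hi⟩ := h
      have hsub : (coveringNumberOn (insert z A) S : ℝ) ≤
          coveringNumberOn A {f ∈ S | f z ≠ i.succ} +
            coveringNumberOn A {f ∈ S | f z = i.succ} := by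
        exact_mod_cast coveringNumberOn_insert_le hk A z S i
      calc (coveringNumberOn (insert z A) S : ℝ) * ((1 - δ) ^ A.card * (1 - δ))
          = ((1 - δ) * coveringNumberOn (insert z A) S) * (1 - δ) ^ A.card := by ring
        _ ≤ coveringNumberOn A {f ∈ S | f z ≠ i.succ} * (1 - δ) ^ A.card := by
            gcongr
            linarith
        _ ≤ ((independenceSets A {f ∈ S | f z ≠ i.succ}).card : ℝ) ^ p := ih _
        _ ≤ _ := by
            gcongr
            exact independenceSets_mono (subset_insert _ _) fun f hf => hf.1
    · push Not at h
      obtain ⟨i, hi⟩ := exists_mul_card_independenceSets_le hk hz S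
      have hcard : ((independenceSets A {f ∈ S | f z = i.succ}).card : ℝ) ≤
          ρ * (independenceSets (insert z A) S).card := by
        rw [hρ, div_mul_eq_mul_div, le_div_iff₀ (by linarith)]
        have : ((k - 1 : ℕ) : ℝ) = k - 1 := by
          rw [Nat.cast_sub (by omega), Nat.cast_one]
        rw [← this, mul_comm]
        exact_mod_cast hi
      refine le_of_mul_le_mul_left ?_ hδ0
      calc δ * ((coveringNumberOn (insert z A) S : ℝ) * ((1 - δ) ^ A.card * (1 - δ)))
          = δ * coveringNumberOn (insert z A) S * (1 - δ) ^ A.card * (1 - δ) := by ring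
        _ ≤ δ * coveringNumberOn (insert z A) S * (1 - δ) ^ A.card :=
            mul_le_of_le_one_right (by positivity) (by linarith)
        _ ≤ coveringNumberOn A {f ∈ S | f z = i.succ} * (1 - δ) ^ A.card := by
            gcongr
            exact (h i).le
        _ ≤ ((independenceSets A {f ∈ S | f z = i.succ}).card : ℝ) ^ p := ih _
        _ ≤ (ρ * (independenceSets (insert z A) S).card) ^ p := by gcongr
        _ = _ := mul_pow _ _ _

end Covering

/-- A family of at least `β ^ n` subsets of an `n`-element set has a member of size linear
in `n`. -/
theorem exists_linear_card_of_pow_le_card {β : ℝ} (hβ : 1 < β) :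
    ∃ c : ℝ, 0 < c ∧ ∀ (Z : Type) [Fintype Z] (F : Finset (Finset Z)),
      β ^ Fintype.card Z ≤ (F.card : ℝ) → ∃ J ∈ F, c * Fintype.card Z ≤ (J.card : ℝ) := by
  set γ := √β with hγ
  have hγ1 : 1 < γ := Real.lt_sqrt_of_sq_lt (by linarith)
  have hγβ : γ * γ = β := Real.mul_self_sqrt (by linarith)
  set x := min (γ - 1) (1 / 2) with hx
  have hx0 : 0 < x := lt_min (by linarith) (by norm_num)
  have hx1 : x < 1 := (min_le_right _ _).trans_lt (by norm_num)
  have hxγ : x + 1 ≤ γ := by linarith [min_le_left (γ - 1) (1 / 2)]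
  have hlog : Real.log x < 0 := Real.log_neg hx0 hx1
  set c := Real.log γ / -Real.log x with hc
  have hxc : x ^ c = γ⁻¹ := by
    rw [Real.rpow_def_of_pos hx0, ← Real.exp_log (inv_pos.2 (by linarith : 0 < γ)), Real.log_inv]
    congr 1
    rw [hc, div_neg, mul_neg, mul_div_cancel₀ _ hlog.ne]
  refine ⟨c, div_pos (Real.log_pos hγ1) (by linarith), fun Z _ F hF => ?_⟩
  by_contra! hsmall
  set n := Fintype.card Z with hn
  have hxn : x ^ (c * n) = (γ ^ n)⁻¹ := by
    rw [Real.rpow_mul hx0.le, hxc, Real.rpow_natCast, inv_pow]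
  have hFne : F.Nonempty := by
    rw [← card_pos]
    have : (0 : ℝ) < F.card := (by positivity : 0 < β ^ n).trans_le hF
    exact_mod_cast this
  have h1 : (F.card : ℝ) * (γ ^ n)⁻¹ < ∑ J ∈ F, x ^ J.card := by
    rw [← nsmul_eq_mul, ← sum_const]
    refine sum_lt_sum_of_nonempty hFne fun J hJ => ?_
    rw [← hxn, ← Real.rpow_natCast]
    exact Real.rpow_lt_rpow_of_exponent_gt hx0 hx1 (hsmall J hJ)
  have h2 : ∑ J ∈ F, x ^ J.card ≤ γ ^ n := by
    calc ∑ J ∈ F, x ^ J.card ≤ ∑ J : Finset Z, x ^ J.card :=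
          sum_le_sum_of_subset_of_nonneg (subset_univ _) fun _ _ _ => by positivity
      _ = (x + 1) ^ n := by
          simpa using Fintype.sum_pow_mul_eq_add_pow Z x 1
      _ ≤ γ ^ n := by gcongr
  have h3 : (F.card : ℝ) < β ^ n := by
    have hγn : 0 < γ ^ n := by positivity
    rw [← div_eq_mul_inv, div_lt_iff₀ hγn] at h1
    calc (F.card : ℝ) < (∑ J ∈ F, x ^ J.card) * γ ^ n := h1
      _ ≤ γ ^ n * γ ^ n := by gcongr
      _ = β ^ n := by rw [← mul_pow, hγβ]
  linarith

/-- Let `k ≥ 2` and `b > 0`. There is a `c > 0`, depending only on `k` and `b`, such that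
for every nonempty finite set `Z` and every `S ⊆ {0,1,…,k}^Z` with `N_S ≥ k^{b|Z|}`,
there is `J ⊆ Z` with `|J| ≥ c|Z|` such that `S|_J ⊇ {1,…,k}^J`. -/
theorem exists_large_independence_subset
    (k : ℕ) (hk : 2 ≤ k) (b : ℝ) (hb : 0 < b) :
    ∃ c : ℝ, 0 < c ∧
      ∀ (Z : Type) [Fintype Z], Nonempty Z →
        ∀ S : Set (Z → Fin (k + 1)),
          (k : ℝ) ^ (b * (Fintype.card Z : ℝ)) ≤ (coveringNumber S : ℝ) →
          ∃ J : Finset Z, c * (Fintype.card Z : ℝ) ≤ (J.card : ℝ) ∧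
            ∀ g : Z → Fin k, ∃ f ∈ S, ∀ z ∈ J, f z = (g z).succ := by
  have hk2 : (2 : ℝ) ≤ k := by exact_mod_cast hk
  have hk0 : (0 : ℝ) < k := by linarith
  set θ : ℝ := (k : ℝ) ^ (b / 2) with hθ
  have hθ1 : 1 < θ := Real.one_lt_rpow (by linarith) (by linarith)
  have hρ1 : ((k : ℝ) - 1) / k < 1 := (div_lt_one hk0).2 (by linarith)
  have hρ0 : 0 ≤ ((k : ℝ) - 1) / k := div_nonneg (by linarith) hk0.le
  have hθi : 0 < 1 - θ⁻¹ := by linarith [inv_lt_one_of_one_lt₀ hθ1]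
  obtain ⟨p, hp⟩ := exists_pow_lt_of_lt_one hθi hρ1
  have hp0 : p ≠ 0 := by
    rintro rfl
    have : 0 < θ⁻¹ := by positivity
    simp only [pow_zero] at hp
    linarith
  set β : ℝ := θ ^ ((p : ℝ)⁻¹) with hβ
  have hβ1 : 1 < β := Real.one_lt_rpow hθ1 (by positivity)
  have hβp : β ^ p = θ := Real.rpow_inv_natCast_pow (by linarith) hp0
  obtain ⟨c, hc0, hc⟩ := exists_linear_card_of_pow_le_card hβ1
  refine ⟨c, hc0, fun Z _ _ S hS => ?_⟩
  have hcard : β ^ Fintype.card Z ≤ ((independenceSets univ S).card : ℝ) := by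
    refine le_of_pow_le_pow_left₀ hp0 (by positivity) ?_
    have hkey := coveringNumberOn_mul_pow_le hk p univ S
    rw [← coveringNumber_eq_coveringNumberOn_univ, card_univ] at hkey
    refine le_trans ?_ hkey
    have hS' : (θ * θ) ^ Fintype.card Z ≤ (coveringNumber S : ℝ) := by
      rwa [hθ, ← Real.rpow_add hk0, add_halves, ← Real.rpow_natCast, ← Real.rpow_mul hk0.le]
    calc (β ^ Fintype.card Z) ^ p = (θ * θ) ^ Fintype.card Z * (θ⁻¹) ^ Fintype.card Z := by
          rw [pow_right_comm, hβp, ← mul_pow, mul_inv_cancel_right₀ (by positivity)]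
      _ ≤ _ := by
          gcongr
          linarith
  obtain ⟨J, hJ, hJc⟩ := hc Z _ hcard
  exact ⟨J, hJc, (mem_independenceSets.1 hJ).2⟩
end

section
/- Let k ≥ 1 be an integer. There exists c > 0, depending only on k, such that for any k-tuple A of subsets of a set X on which a group Γ acts, any simple splitting {A₁, A₂} of the family {A}, and any finite independence set J ⊆ Γ for A, there is a subset I of J with |I| ≥ c|J| such that I is an independence set for at least one of A₁ and A₂. -/
/-- `J ⊆ Γ` is an independence set for a tuple `A = (A_i)_{i : ι}` of subsets of `X` if
for every nonempty finite `F ⊆ J` and every map `ω : F → ι`, the intersection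
`⋂_{s ∈ F} s⁻¹ A_{ω(s)}` is nonempty. -/
def IsIndepSet {Γ : Type*} [Group Γ] {X : Type*} [MulAction Γ X] {ι : Type*}
    (A : ι → Set X) (J : Set Γ) : Prop :=
  ∀ F : Finset Γ, (F : Set Γ) ⊆ J → F.Nonempty → ∀ ω : Γ → ι,
    (⋂ s ∈ F, (fun x : X => s • x) ⁻¹' A (ω s)).Nonempty

/-- `S` shatters the set `W` of coordinates if every word agrees on `W` with a word of `S`. -/
def WordShatters {ι : Type*} {n : ℕ} (S : Finset (Fin n → ι)) (W : Finset (Fin n)) : Prop :=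
  ∀ f : Fin n → ι, ∃ g ∈ S, ∀ i ∈ W, g i = f i

/-- One-coordinate step of the Sauer–Shelah bound: the words of `S` are counted by their tails,
the tails all of whose extensions lie in `S` being counted once more. -/
theorem card_le_card_tail_add_card_full {ι : Type*} [Fintype ι] [DecidableEq ι] {n : ℕ}
    (S : Finset (Fin (n + 1) → ι)) :
    (S.card : ℝ) ≤ ((Fintype.card ι : ℝ) - 1) * (S.image Fin.tail).card +
      ((S.image Fin.tail).filter fun y => ∀ a, (Fin.cons a y : Fin (n + 1) → ι) ∈ S).card := by
  have key : ∀ y ∈ S.image Fin.tail, ((S.filter fun x => Fin.tail x = y).card : ℝ) ≤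
      ((Fintype.card ι : ℝ) - 1) +
        if ∀ a, (Fin.cons a y : Fin (n + 1) → ι) ∈ S then 1 else 0 := by
    intro y _
    have hinj : Set.InjOn (fun x : Fin (n + 1) → ι => x 0) (S.filter fun x => Fin.tail x = y) := by
      intro x hx x' hx' h
      simp only [Finset.coe_filter, Set.mem_ofPred_eq] at hx hx'
      rw [← Fin.cons_self_tail x, ← Fin.cons_self_tail x', hx.2, hx'.2]
      exact congrArg (fun a => (Fin.cons a y : Fin (n + 1) → ι)) h
    rw [← Finset.card_image_of_injOn hinj]
    split_ifs with h
    · rw [sub_add_cancel]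
      exact_mod_cast Finset.card_le_univ _
    · push Not at h
      obtain ⟨a, ha⟩ := h
      have hlt : ((S.filter fun x => Fin.tail x = y).image fun x => x 0).card <
          Fintype.card ι := by
        refine Finset.card_lt_univ_of_notMem (x := a) fun hmem => ha ?_
        obtain ⟨x, hx, rfl⟩ := Finset.mem_image.1 hmem
        obtain ⟨hxS, rfl⟩ := Finset.mem_filter.1 hx
        rwa [Fin.cons_self_tail]
      have : (((S.filter fun x => Fin.tail x = y).image fun x => x 0).card : ℝ) + 1 ≤
          Fintype.card ι := by exact_mod_cast hlt
      linarith
  rw [Finset.card_eq_sum_card_image Fin.tail S]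
  push_cast
  refine (Finset.sum_le_sum key).trans_eq ?_
  rw [Finset.sum_add_distrib, Finset.sum_const, nsmul_eq_mul, Finset.sum_boole, mul_comm]

/-- A Sauer–Shelah bound for words over a finite alphabet. -/
theorem card_le_of_forall_wordShatters {ι : Type*} [Fintype ι] [Nonempty ι] [DecidableEq ι]
    {n : ℕ} (S : Finset (Fin n → ι)) (d : ℕ) (h : ∀ W, WordShatters S W → W.card ≤ d) :
    (S.card : ℝ) ≤ 4 ^ d * ((Fintype.card ι : ℝ) - 3 / 4) ^ n := by
  have hk : (1 : ℝ) ≤ Fintype.card ι := by exact_mod_cast Fintype.card_pos (α := ι)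
  induction n generalizing d with
  | zero =>
    have h1 : (S.card : ℝ) ≤ 1 := by exact_mod_cast Finset.card_le_one_of_subsingleton S
    have h4 : (1 : ℝ) ≤ 4 ^ d := one_le_pow₀ (by norm_num)
    simpa using h1.trans h4
  | succ n ih =>
    have hstep := card_le_card_tail_add_card_full S
    set P := S.image Fin.tail with hP
    set Q := P.filter fun y => ∀ a, (Fin.cons a y : Fin (n + 1) → ι) ∈ S with hQ
    have hPd : (P.card : ℝ) ≤ 4 ^ d * ((Fintype.card ι : ℝ) - 3 / 4) ^ n := by
      refine ih P d fun W hW => ?_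
      rw [← Finset.card_map (Fin.succEmb n)]
      refine h _ fun f => ?_
      obtain ⟨y, hy, hyW⟩ := hW (Fin.tail f)
      obtain ⟨g, hg, rfl⟩ := Finset.mem_image.1 hy
      refine ⟨g, hg, fun i hi => ?_⟩
      obtain ⟨i, hiW, rfl⟩ := Finset.mem_map.1 hi
      exact hyW i hiW
    have hQW : ∀ W, WordShatters Q W → W.card + 1 ≤ d := by
      intro W hW
      have h0 : (0 : Fin (n + 1)) ∉ W.map (Fin.succEmb n) := by simp [Fin.succ_ne_zero]
      rw [← Finset.card_map (Fin.succEmb n), ← Finset.card_cons h0]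
      refine h _ fun f => ?_
      obtain ⟨y, hy, hyW⟩ := hW (Fin.tail f)
      refine ⟨Fin.cons (f 0) y, (Finset.mem_filter.1 hy).2 _, fun i hi => ?_⟩
      rcases Finset.mem_cons.1 hi with rfl | hi
      · rfl
      · obtain ⟨i, hiW, rfl⟩ := Finset.mem_map.1 hi
        exact hyW i hiW
    have hQd : (Q.card : ℝ) ≤ 4 ^ d / 4 * ((Fintype.card ι : ℝ) - 3 / 4) ^ n := by
      rcases Q.eq_empty_or_nonempty with hQe | ⟨y, hy⟩
      · rw [hQe, Finset.card_empty, Nat.cast_zero]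
        have : (0 : ℝ) ≤ (Fintype.card ι : ℝ) - 3 / 4 := by linarith
        positivity
      · obtain ⟨e, rfl⟩ : ∃ e, d = e + 1 :=
          ⟨d - 1, by have := hQW ∅ fun f => ⟨y, hy, by simp⟩; omega⟩
        rw [pow_succ, mul_div_cancel_right₀ _ (by norm_num : (4 : ℝ) ≠ 0)]
        exact ih Q e fun W hW => by have := hQW W hW; omega
    calc (S.card : ℝ) ≤ _ := hstep
      _ ≤ ((Fintype.card ι : ℝ) - 1) * (4 ^ d * ((Fintype.card ι : ℝ) - 3 / 4) ^ n) +
          4 ^ d / 4 * ((Fintype.card ι : ℝ) - 3 / 4) ^ n :=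
        add_le_add (mul_le_mul_of_nonneg_left hPd (by linarith)) hQd
      _ = _ := by ring

/-- If the occurrences of the letter `j` in each word are coloured with two colours, then some
colouring of the coordinates is compatible with many words. -/
theorem exists_coloring_compatible {ι : Type*} [Fintype ι] [DecidableEq ι] {n : ℕ} (j : ι)
    (C : (Fin n → ι) → Fin n → Bool) :
    ∃ σ : Fin n → Bool, ((Fintype.card ι : ℝ) - 1 / 2) ^ n ≤
      ((Finset.univ.filter fun g : Fin n → ι => ∀ i, g i = j → C g i = σ i).card : ℝ) := by
  have hcount : ∀ g : Fin n → ι,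
      ((Finset.univ.filter fun σ : Fin n → Bool => ∀ i, g i = j → C g i = σ i).card : ℝ) =
        ∏ i, if g i = j then (1 : ℝ) else 2 := by
    intro g
    have : (Finset.univ.filter fun σ : Fin n → Bool => ∀ i, g i = j → C g i = σ i) =
        Fintype.piFinset fun i => if g i = j then {C g i} else Finset.univ := by
      ext σ
      simp only [Finset.mem_filter, Finset.mem_univ, true_and, Fintype.mem_piFinset]
      refine forall_congr' fun i => ?_
      split_ifs with h
      · simp only [h, true_imp_iff, Finset.mem_singleton]
        exact eq_comm
      · simp [h]
    rw [this, Fintype.card_piFinset]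
    push_cast
    refine Finset.prod_congr rfl fun i _ => ?_
    split_ifs <;> simp
  have hletter : ∑ a : ι, (if a = j then (1 : ℝ) else 2) = 2 * Fintype.card ι - 1 := by
    have : ∀ a : ι, (if a = j then (1 : ℝ) else 2) = 2 - if a = j then 1 else 0 := by
      intro a
      split_ifs <;> norm_num
    simp only [this, Finset.sum_sub_distrib, Finset.sum_ite_eq', Finset.mem_univ, if_true,
      Finset.sum_const, Finset.card_univ, nsmul_eq_mul]
    ring
  have htotal : ∑ σ : Fin n → Bool,
      ((Finset.univ.filter fun g : Fin n → ι => ∀ i, g i = j → C g i = σ i).card : ℝ) =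
        (2 * Fintype.card ι - 1) ^ n := by
    simp only [← Finset.sum_boole]
    rw [Finset.sum_comm]
    simp only [Finset.sum_boole, hcount]
    have := Finset.prod_univ_sum (fun _ : Fin n => (Finset.univ : Finset ι))
      (fun _ a => if a = j then (1 : ℝ) else 2)
    rw [Fintype.piFinset_univ] at this
    rw [← this, hletter, Finset.prod_const, Finset.card_univ, Fintype.card_fin]
  obtain ⟨σ, -, hσ⟩ := Finset.exists_le_of_sum_le (s := (Finset.univ : Finset (Fin n → Bool)))
    (f := fun _ => ((Fintype.card ι : ℝ) - 1 / 2) ^ n) Finset.univ_nonempty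
    (htotal.symm.le.trans' <| by
      rw [Finset.sum_const, Finset.card_univ, Fintype.card_fun, Fintype.card_bool,
        Fintype.card_fin, nsmul_eq_mul]
      push_cast
      rw [← mul_pow]
      exact le_of_eq (by ring))
  exact ⟨σ, hσ⟩

/-- A set of words of cardinality at least `(|ι| - 1/2) ^ n` shatters a set of coordinates of
positive proportion. -/
theorem exists_wordShatters_of_le_card {ι : Type*} [Fintype ι] [Nonempty ι] [DecidableEq ι]
    {n : ℕ} (S : Finset (Fin n → ι)) (hS : ((Fintype.card ι : ℝ) - 1 / 2) ^ n ≤ S.card) :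
    ∃ W, WordShatters S W ∧
      Real.log (((Fintype.card ι : ℝ) - 1 / 2) / ((Fintype.card ι : ℝ) - 3 / 4)) / Real.log 4 * n ≤
        W.card := by
  classical
  have hk : (1 : ℝ) ≤ Fintype.card ι := by exact_mod_cast Fintype.card_pos (α := ι)
  have h2 : (0 : ℝ) < (Fintype.card ι : ℝ) - 1 / 2 := by linarith
  have h3 : (0 : ℝ) < (Fintype.card ι : ℝ) - 3 / 4 := by linarith
  have hne : S.Nonempty := by
    rw [← Finset.card_pos]
    exact_mod_cast (pow_pos h2 n).trans_le hS
  obtain ⟨g, hg⟩ := hne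
  obtain ⟨W, hW, hmax⟩ := Finset.exists_max_image (Finset.univ.filter (WordShatters S))
    Finset.card ⟨∅, Finset.mem_filter.2 ⟨Finset.mem_univ _, fun f => ⟨g, hg, by simp⟩⟩⟩
  refine ⟨W, (Finset.mem_filter.1 hW).2, ?_⟩
  have hle := hS.trans <| card_le_of_forall_wordShatters S W.card fun W' hW' =>
    hmax W' (Finset.mem_filter.2 ⟨Finset.mem_univ _, hW'⟩)
  rw [← div_le_iff₀ (pow_pos h3 n), ← div_pow] at hle
  have hlog := Real.log_le_log (pow_pos (div_pos h2 h3) n) hle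
  rw [Real.log_pow, Real.log_pow] at hlog
  rw [div_mul_eq_mul_div, div_le_iff₀ (Real.log_pos (by norm_num))]
  linarith

/-- Let `k ≥ 1`. There is `c > 0`, depending only on `k`, such that for any group `Γ`
acting on a set `X`, any `k`-tuple `A` of subsets of `X`, any simple splitting of `{A}`
obtained from a decomposition `A j = B₁ ∪ B₂` of the `j`-th entry, and any finite
independence set `J ⊆ Γ` for `A`, there is `I ⊆ J` with `|I| ≥ c|J|` which is an
independence set for at least one of the two tuples of the splitting. -/
theorem simple_splitting_keeps_independence
    (k : ℕ) (hk : 1 ≤ k) :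
    ∃ c : ℝ, 0 < c ∧
      ∀ (Γ X : Type) [Group Γ] [MulAction Γ X],
        ∀ (A : Fin k → Set X) (j : Fin k) (B₁ B₂ : Set X), A j = B₁ ∪ B₂ →
          ∀ J : Finset Γ, IsIndepSet A (J : Set Γ) →
            ∃ I : Finset Γ, I ⊆ J ∧ c * (J.card : ℝ) ≤ (I.card : ℝ) ∧
              (IsIndepSet (Function.update A j B₁) (I : Set Γ) ∨
                IsIndepSet (Function.update A j B₂) (I : Set Γ)) := by
  classical
  have : NeZero k := ⟨by omega⟩
  have hk' : (1 : ℝ) ≤ k := by exact_mod_cast hk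
  have h3 : (0 : ℝ) < (k : ℝ) - 3 / 4 := by linarith
  have hc : 0 < Real.log (((k : ℝ) - 1 / 2) / ((k : ℝ) - 3 / 4)) / Real.log 4 :=
    div_pos (Real.log_pos (by rw [one_lt_div h3]; linarith)) (Real.log_pos (by norm_num))
  set c := Real.log (((k : ℝ) - 1 / 2) / ((k : ℝ) - 3 / 4)) / Real.log 4 with hcdef
  refine ⟨c / 2, by positivity, ?_⟩
  intro Γ X _ _ A j B₁ B₂ hA J hJ
  rcases J.eq_empty_or_nonempty with rfl | hJne
  · refine ⟨∅, subset_rfl, by simp, Or.inl fun F hF hFne => ?_⟩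
    obtain ⟨s, hs⟩ := hFne
    exact absurd (hF hs) (by simp)
  let e : Fin J.card ≃ J := J.equivFin.symm
  have hx : ∀ g : Fin J.card → Fin k, ∃ x : X, ∀ i, (e i : Γ) • x ∈ A (g i) := by
    intro g
    obtain ⟨x, hx⟩ := hJ J subset_rfl hJne
      fun s => if hs : s ∈ J then g (e.symm ⟨s, hs⟩) else j
    refine ⟨x, fun i => ?_⟩
    simpa using Set.mem_iInter₂.1 hx (e i) (e i).2
  choose x hx using hx
  obtain ⟨σ, hσ⟩ := exists_coloring_compatible j fun g i => decide ((e i : Γ) • x g ∈ B₁)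
  obtain ⟨W, hW, hWcard⟩ := exists_wordShatters_of_le_card _ hσ
  rw [Fintype.card_fin, ← hcdef] at hWcard
  have hind : ∀ (b : Bool) (B : Set X),
      (∀ y ∈ A j, decide (y ∈ B₁) = b → y ∈ B) →
      IsIndepSet (Function.update A j B)
        (((W.filter fun i => σ i = b).map (e.toEmbedding.trans (.subtype _)) : Finset Γ) :
          Set Γ) := by
    intro b B hB F hF _ ω
    obtain ⟨g, hg, hgW⟩ := hW fun i => ω (e i)
    refine ⟨x g, Set.mem_iInter₂.2 fun s hs => ?_⟩
    obtain ⟨i, hi, rfl⟩ := Finset.mem_map.1 (Finset.mem_coe.1 (hF hs))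
    obtain ⟨hiW, hib⟩ := Finset.mem_filter.1 hi
    have hgi : g i = ω (e i) := hgW i hiW
    have hxi := hx g i
    change (e i : Γ) • x g ∈ Function.update A j B (ω (e i))
    rw [← hgi]
    by_cases hj : g i = j
    · rw [hj] at hxi ⊢
      rw [Function.update_self]
      exact hB _ hxi (((Finset.mem_filter.1 hg).2 i hj).trans hib)
    · rwa [Function.update_of_ne hj]
  have hsub : ∀ b : Bool,
      (W.filter fun i => σ i = b).map (e.toEmbedding.trans (.subtype _)) ⊆ J := by
    intro b s hs
    obtain ⟨i, -, rfl⟩ := Finset.mem_map.1 hs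
    exact (e i).2
  have hsum : ((W.filter fun i => σ i = true).card : ℝ) +
      (W.filter fun i => σ i = false).card = W.card := by
    have := Finset.card_filter_add_card_filter_not (s := W) fun i => σ i = true
    simp only [Bool.not_eq_true] at this
    exact_mod_cast this
  rcases le_total ((W.filter fun i => σ i = false).card : ℝ)
    ((W.filter fun i => σ i = true).card) with h | h
  · refine ⟨_, hsub true, ?_, Or.inl (hind true B₁ fun y _ hy => of_decide_eq_true hy)⟩
    rw [Finset.card_map]
    linarith
  · refine ⟨_, hsub false, ?_, Or.inr (hind false B₂ fun y hyA hy => ?_)⟩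
    · rw [Finset.card_map]
      linarith
    · rw [hA] at hyA
      exact hyA.resolve_left (of_decide_eq_false hy)
end

section
/- Let Γ be a countably infinite discrete group acting on a compact metrizable space X by homeomorphisms, let 𝒜 be a finite family of tuples of subsets of X with positive independence density, and let K be a nonempty finite subset of Γ. Then there is a finite family 𝒜' of tuples of subsets of X with positive independence density such that each element of 𝒜' is of the form A^E for some A ∈ 𝒜 and some K-separated nonempty finite subset E of Γ \ K with |E| = 2. -/
/-- A finite family `(A i)_{i : ι}` of tuples of subsets of `X` (the tuple `A i` being
indexed by `κ i`) has positive independence density if there is some `q > 0` such that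
for every nonempty finite `F ⊆ Γ` there are `J ⊆ F` with `|J| ≥ q|F|` and some `i` such
that `J` is an independence set for `A i`. -/
def HasPosIndepDensity (Γ : Type*) [Group Γ] {X : Type*} [MulAction Γ X]
    {ι : Type*} {κ : ι → Type*} (A : ∀ i, κ i → Set X) : Prop :=
  ∃ q : ℝ, 0 < q ∧ ∀ F : Finset Γ, F.Nonempty →
    ∃ J : Finset Γ, J ⊆ F ∧ q * (F.card : ℝ) ≤ (J.card : ℝ) ∧
      ∃ i, IsIndepSet (A i) (J : Set Γ)

open scoped Pointwise in
/-- An infinite group contains arbitrarily large finite `K`-separated subsets of the complement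
of a finite set `K`. -/
theorem exists_finset_separated {Γ : Type*} [Group Γ] [Infinite Γ] (K : Finset Γ) (n : ℕ) :
    ∃ D : Finset Γ, D.card = n ∧ (∀ s ∈ D, s ∉ K) ∧
      ∀ s ∈ D, ∀ t ∈ D, s ≠ t → ∀ u ∈ K, ∀ v ∈ K, u * s ≠ v * t := by
  classical
  induction n with
  | zero => exact ⟨∅, by simp⟩
  | succ n ih =>
    obtain ⟨D, hcard, hDK, hsep⟩ := ih
    obtain ⟨t, ht⟩ := Infinite.exists_notMem_finset (D ∪ K ∪ K⁻¹ * K * D)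
    simp only [Finset.mem_union, not_or] at ht
    obtain ⟨⟨htD, htK⟩, htKD⟩ := ht
    have key : ∀ s ∈ D, ∀ u ∈ K, ∀ v ∈ K, u * s ≠ v * t := by
      intro s hs u hu v hv he
      refine htKD ?_
      have : t = v⁻¹ * u * s := by rw [mul_assoc, he, inv_mul_cancel_left]
      rw [this]
      exact Finset.mul_mem_mul (Finset.mul_mem_mul (Finset.inv_mem_inv hv) hu) hs
    refine ⟨insert t D, by rw [Finset.card_insert_of_notMem htD, hcard], ?_, ?_⟩
    · intro s hs
      rcases Finset.mem_insert.1 hs with rfl | hs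
      exacts [htK, hDK s hs]
    · simp only [Finset.mem_insert]
      rintro a (rfl | ha) b (rfl | hb) hab u hu v hv
      · exact absurd rfl hab
      · exact (key b hb v hv u hu).symm
      · exact key a ha u hu v hv
      · exact hsep a ha b hb hab u hu v hv

/-- A third of any finite subset `G` of a group consists of elements no two of which differ by
left multiplication by `g ≠ 1`. -/
theorem exists_subset_forall_mul_notMem {Γ : Type*} [Group Γ] (G : Finset Γ) {g : Γ}
    (hg : g ≠ 1) : ∃ M ⊆ G, G.card ≤ 3 * M.card ∧ ∀ s ∈ M, g * s ∉ M := by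
  classical
  obtain ⟨M, hM, hmax⟩ := Finset.exists_max_image
    (G.powerset.filter fun M => ∀ s ∈ M, g * s ∉ M) Finset.card ⟨∅, by simp⟩
  simp only [Finset.mem_filter, Finset.mem_powerset] at hM hmax
  refine ⟨M, hM.1, ?_, hM.2⟩
  have hsub : G ⊆ M ∪ M.image (g * ·) ∪ M.image (g⁻¹ * ·) := by
    intro x hx
    by_contra hxM
    simp only [Finset.mem_union, Finset.mem_image, not_or, not_exists, not_and] at hxM
    obtain ⟨⟨h1, h2⟩, h3⟩ := hxM
    have := hmax (insert x M) ⟨Finset.insert_subset hx hM.1, ?_⟩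
    · rw [Finset.card_insert_of_notMem h1] at this
      omega
    · intro s hs hgs
      rcases Finset.mem_insert.1 hs with rfl | hs <;>
        rcases Finset.mem_insert.1 hgs with hgs | hgs
      · exact hg (by simpa using hgs)
      · exact h3 _ hgs (by simp)
      · exact h2 s hs hgs
      · exact hM.2 s hs hgs
  calc G.card ≤ _ := Finset.card_le_card hsub
    _ ≤ (M ∪ M.image (g * ·)).card + (M.image (g⁻¹ * ·)).card := Finset.card_union_le _ _
    _ ≤ M.card + (M.image (g * ·)).card + (M.image (g⁻¹ * ·)).card := by
        gcongr; exact Finset.card_union_le _ _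
    _ ≤ M.card + M.card + M.card :=
        add_le_add (add_le_add le_rfl Finset.card_image_le) Finset.card_image_le
    _ = 3 * M.card := by ring

/-- If multiplication is injective on `E × M` and maps it into an independence set for `A`, then
`M` is an independence set for `A^E`. -/
theorem IsIndepSet.iInter_smul_preimage {Γ : Type*} [Group Γ] {X : Type*} [MulAction Γ X]
    {κ : Type*} {A : κ → Set X} {J M : Set Γ} (hJ : IsIndepSet A J) (E : Finset Γ)
    (hE : E.Nonempty) (hEM : ∀ t ∈ E, ∀ s ∈ M, t * s ∈ J)
    (hinj : ∀ t ∈ E, ∀ s ∈ M, ∀ t' ∈ E, ∀ s' ∈ M, t * s = t' * s' → t = t' ∧ s = s') :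
    IsIndepSet (fun ω : {s // s ∈ E} → κ =>
      ⋂ s : {s // s ∈ E}, (fun x : X => (s : Γ) • x) ⁻¹' A (ω s)) M := by
  classical
  intro F hF hFne ω
  obtain ⟨t₀, ht₀⟩ := hE
  let ω' : Γ → κ := fun u =>
    if h : ∃ p : {s // s ∈ E} × Γ, p.2 ∈ M ∧ (p.1 : Γ) * p.2 = u
    then ω h.choose.2 h.choose.1 else ω 1 ⟨t₀, ht₀⟩
  have hω' : ∀ (t : {s // s ∈ E}), ∀ s ∈ M, ω' (t * s) = ω s t := by
    intro t s hs
    have h : ∃ p : {s // s ∈ E} × Γ, p.2 ∈ M ∧ (p.1 : Γ) * p.2 = t * s := ⟨(t, s), hs, rfl⟩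
    have hc := h.choose_spec
    have he := hinj _ h.choose.1.2 _ hc.1 _ t.2 _ hs hc.2
    simp only [ω', dif_pos h]
    rw [he.2, Subtype.ext he.1]
  obtain ⟨x, hx⟩ := hJ ((E ×ˢ F).image fun p => p.1 * p.2)
    (by
      intro u hu
      simp only [Finset.coe_image, Set.mem_image, Finset.mem_coe, Finset.mem_product] at hu
      obtain ⟨p, hp, rfl⟩ := hu
      exact hEM _ hp.1 _ (hF hp.2))
    ((Finset.Nonempty.product ⟨t₀, ht₀⟩ hFne).image _) ω'
  refine ⟨x, ?_⟩
  simp only [Set.mem_iInter, Set.mem_preimage] at hx ⊢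
  intro s hs t
  have := hx (t * s) (Finset.mem_image.2 ⟨(t, s), Finset.mem_product.2 ⟨t.2, hs⟩, rfl⟩)
  rwa [hω' t s (hF hs), mul_smul] at this

/-- Let `P` be a family of subsets containing a proportion `q` of every finite set. If the finite
set `D` has `2 ^ m` elements, with `m` large in terms of `q`, then for every finite `F` some
member `J` of `P` captures at least `2 |F|` of the pairs in `D × F` under multiplication. -/
theorem exists_two_mul_card_le_card_filter_mul_mem {Γ : Type*} [Group Γ] [DecidableEq Γ]
    {P : Finset Γ → Prop} {q : ℝ} (hq : 0 < q)
    (hP : ∀ F : Finset Γ, F.Nonempty → ∃ J ⊆ F, q * F.card ≤ J.card ∧ P J)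
    {m : ℕ} (hm : 4 * (m + 1 : ℝ) ≤ q * 2 ^ m) {D : Finset Γ} (hD : D.card = 2 ^ m)
    {F : Finset Γ} (hF : F.Nonempty) :
    ∃ J, P J ∧ 2 * F.card ≤ ((D ×ˢ F).filter fun p => p.1 * p.2 ∈ J).card := by
  let w : Γ → ℕ := fun t => ((D ×ˢ F).filter fun p => p.1 * p.2 = t).card
  have hw_le : ∀ t, w t ≤ 2 ^ m := by
    intro t
    rw [← hD]
    refine Finset.card_le_card_of_injOn Prod.fst ?_ ?_
    · intro p hp
      exact (Finset.mem_product.1 (Finset.mem_filter.1 hp).1).1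
    · intro p hp p' hp' h
      have h1 := (Finset.mem_filter.1 hp).2
      have h2 := (Finset.mem_filter.1 hp').2
      refine Prod.ext h ?_
      rw [← h2, h] at h1
      exact mul_left_cancel h1
  have hw_pos : ∀ p ∈ D ×ˢ F, w (p.1 * p.2) ≠ 0 := fun p hp =>
    Finset.card_ne_zero_of_mem (a := p) (by simpa using hp)
  have hDne : D.Nonempty := Finset.card_pos.1 (by rw [hD]; positivity)
  let level : Γ × Γ → ℕ := fun p => Nat.log 2 (w (p.1 * p.2))
  -- Some dyadic level of the multiplicity function `w` carries many pairs.
  obtain ⟨j, -, hj⟩ : ∃ j ∈ Finset.range (m + 1), ((D ×ˢ F).card : ℝ) / (m + 1) ≤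
      ((D ×ˢ F).filter fun p => level p = j).card := by
    refine Finset.exists_le_card_fiber_of_nsmul_le_card_of_maps_to (fun p hp => ?_)
      (by simp) ?_
    · rw [Finset.mem_range, Nat.lt_succ_iff]
      calc level p ≤ Nat.log 2 (2 ^ m) := Nat.log_mono_right (hw_le _)
        _ = m := Nat.log_pow one_lt_two m
    · rw [Finset.card_range, nsmul_eq_mul]
      push_cast
      rw [mul_div_cancel₀ _ (by positivity)]
  set Q := (D ×ˢ F).filter fun p => level p = j
  set L := Q.image fun p => p.1 * p.2
  have hlevel : ∀ t ∈ L, 2 ^ j ≤ w t ∧ w t ≤ 2 ^ (j + 1) := by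
    intro t ht
    obtain ⟨p, hp, rfl⟩ := Finset.mem_image.1 ht
    obtain ⟨hp, hpj⟩ := Finset.mem_filter.1 hp
    rw [← hpj]
    exact ⟨Nat.pow_log_le_self 2 (hw_pos p hp), (Nat.lt_pow_succ_log_self one_lt_two _).le⟩
  have hQL : Q.card ≤ 2 ^ (j + 1) * L.card := by
    refine Finset.card_le_mul_card_image Q _ fun t ht => le_trans ?_ (hlevel t ht).2
    exact Finset.card_le_card (Finset.filter_subset_filter _ (Finset.filter_subset _ _))
  have hPcard : ((D ×ˢ F).card : ℝ) = 2 ^ m * F.card := by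
    rw [Finset.card_product, hD]; push_cast; rfl
  have hQpos : (0 : ℝ) < Q.card := by
    refine lt_of_lt_of_le ?_ hj
    have : (0 : ℝ) < (D ×ˢ F).card := by exact_mod_cast (hDne.product hF).card_pos
    positivity
  have hLne : L.Nonempty := (Finset.card_pos.1 (by exact_mod_cast hQpos)).image _
  obtain ⟨J, hJL, hJcard, hJ⟩ := hP L hLne
  refine ⟨J, hJ, ?_⟩
  set R := (D ×ˢ F).filter fun p => p.1 * p.2 ∈ J
  have hRJ : 2 ^ j * J.card ≤ R.card := by
    refine Finset.mul_card_image_le_card_of_maps_to (f := fun p : Γ × Γ => p.1 * p.2)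
      (fun p hp => (Finset.mem_filter.1 hp).2) _ fun t ht => (hlevel t (hJL ht)).1.trans ?_
    refine Finset.card_le_card fun p hp => ?_
    obtain ⟨hpDF, hpt⟩ := Finset.mem_filter.1 hp
    exact Finset.mem_filter.2 ⟨Finset.mem_filter.2 ⟨hpDF, hpt ▸ ht⟩, hpt⟩
  have hQL' : (Q.card : ℝ) ≤ 2 ^ (j + 1) * L.card := by exact_mod_cast hQL
  have hRJ' : (2 : ℝ) ^ j * J.card ≤ R.card := by exact_mod_cast hRJ
  rw [hPcard, div_le_iff₀ (by positivity)] at hj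
  have h1 : q * Q.card ≤ 2 * R.card := by
    calc q * Q.card ≤ q * (2 ^ (j + 1) * L.card) := by gcongr
      _ = 2 * (2 ^ j * (q * L.card)) := by ring
      _ ≤ 2 * (2 ^ j * J.card) := by gcongr
      _ ≤ 2 * R.card := by gcongr
  have h2 : 4 * (m + 1 : ℝ) * F.card ≤ (2 * R.card) * (m + 1) := by
    calc 4 * (m + 1 : ℝ) * F.card ≤ q * 2 ^ m * F.card := by gcongr
      _ = q * (2 ^ m * F.card) := by ring
      _ ≤ q * (Q.card * (m + 1)) := by gcongr
      _ = (q * Q.card) * (m + 1) := by ring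
      _ ≤ (2 * R.card) * (m + 1) := by gcongr
  have h3 : (2 * F.card : ℝ) ≤ R.card := by
    have hm0 : (0 : ℝ) < m + 1 := by positivity
    nlinarith
  exact_mod_cast h3

/-- If a set of pairs `R ⊆ D × F` given by a relation has at least `2 |F|` elements, then two
distinct elements of `D` are simultaneously related to at least `|F| / |D|²` elements of `F`. -/
theorem exists_ne_card_le_card_filter_and {α β : Type*} (r : α → β → Prop)
    [∀ a b, Decidable (r a b)] {D : Finset α} {F : Finset β} (hF : F.Nonempty)
    (h : 2 * F.card ≤ ((D ×ˢ F).filter fun p => r p.1 p.2).card) :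
    ∃ a ∈ D, ∃ b ∈ D, a ≠ b ∧
      F.card ≤ D.card ^ 2 * (F.filter fun s => r a s ∧ r b s).card := by
  classical
  let n : β → ℕ := fun s => (D.filter fun a => r a s).card
  have hR : ((D ×ˢ F).filter fun p => r p.1 p.2).card = ∑ s ∈ F, n s := by
    simp only [n, Finset.card_filter]
    rw [Finset.sum_product_right]
  have hoff : ∑ p ∈ D.offDiag, (F.filter fun s => r p.1 s ∧ r p.2 s).card =
      ∑ s ∈ F, (n s * n s - n s) := by
    simp only [Finset.card_filter]
    rw [Finset.sum_comm]
    refine Finset.sum_congr rfl fun s _ => ?_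
    rw [← Finset.offDiag_card, ← Finset.card_filter]
    congr 1
    ext p
    simp only [Finset.mem_filter, Finset.mem_offDiag]
    tauto
  have hle : F.card ≤ ∑ p ∈ D.offDiag, (F.filter fun s => r p.1 s ∧ r p.2 s).card := by
    have h1 : ∑ s ∈ F, n s ≤ ∑ s ∈ F, (1 + (n s * n s - n s)) := by
      refine Finset.sum_le_sum fun s _ => ?_
      rcases Nat.lt_or_ge (n s) 2 with h2 | h2
      · omega
      · have : 2 * n s ≤ n s * n s := Nat.mul_le_mul_right _ h2
        omega
    rw [Finset.sum_add_distrib, Finset.sum_const, smul_eq_mul, mul_one] at h1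
    rw [hoff]
    omega
  by_contra! hcon
  have hne : D.offDiag.Nonempty := by
    by_contra hne
    rw [Finset.not_nonempty_iff_eq_empty.1 hne, Finset.sum_empty] at hle
    exact hF.card_pos.not_ge hle
  have hlt : ∑ p ∈ D.offDiag, D.card ^ 2 * (F.filter fun s => r p.1 s ∧ r p.2 s).card <
      ∑ p ∈ D.offDiag, F.card := by
    refine Finset.sum_lt_sum_of_nonempty hne fun p hp => ?_
    obtain ⟨h1, h2, h3⟩ := Finset.mem_offDiag.1 hp
    exact hcon _ h1 _ h2 h3
  rw [← Finset.mul_sum, Finset.sum_const, smul_eq_mul] at hlt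
  have hoc : D.offDiag.card ≤ D.card ^ 2 := by
    rw [Finset.offDiag_card, sq]
    exact Nat.sub_le _ _
  have := (Nat.mul_le_mul hoc hle).trans_lt' hlt
  exact lt_irrefl _ this

/-- Let a countably infinite group `Γ` act continuously on a compact metrizable space
`X`, let `(A i)_{i : ι}` be a finite family of tuples of subsets of `X` with positive
independence density, and let `K` be a nonempty finite subset of `Γ`. Then there is a
finite family `𝒜'` with positive independence density each of whose members is of the
form `A^E = (⋂_{s ∈ E} s⁻¹ A_{ω(s)})_{ω : E → [k]}` for some tuple `A` of the original
family and some `K`-separated two-element subset `E` of `Γ \ K`. -/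
theorem pos_indep_density_doubling
    {Γ : Type*} [Group Γ] [Countable Γ] [Infinite Γ]
    {X : Type*} [TopologicalSpace X] [CompactSpace X] [TopologicalSpace.MetrizableSpace X]
    [MulAction Γ X] [ContinuousConstSMul Γ X]
    {ι : Type} [Fintype ι] (k : ι → ℕ) (A : ∀ i, Fin (k i) → Set X)
    (h : HasPosIndepDensity Γ A)
    (K : Finset Γ) (hK : K.Nonempty) :
    ∃ (ι' : Type) (_ : Fintype ι') (g : ι' → ι) (E : ι' → Finset Γ),
      (∀ i', (E i').card = 2) ∧
      (∀ i', ∀ s ∈ E i', s ∉ K) ∧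
      (∀ i', ∀ s ∈ E i', ∀ t ∈ E i', s ≠ t → ∀ u ∈ K, ∀ v ∈ K, u * s ≠ v * t) ∧
      HasPosIndepDensity Γ
        (fun i' (ω : {s // s ∈ E i'} → Fin (k (g i'))) =>
          ⋂ s : {s // s ∈ E i'}, (fun x : X => (s : Γ) • x) ⁻¹' A (g i') (ω s)) := by
  classical
  obtain ⟨q, hq, hdens⟩ := h
  obtain ⟨m, hm⟩ : ∃ m : ℕ, 4 * (m + 1 : ℝ) ≤ q * 2 ^ m := by
    have h1 : Filter.Tendsto (fun n : ℕ => (n : ℝ) ^ 1 / 2 ^ n) Filter.atTop (nhds 0) :=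
      tendsto_pow_const_div_const_pow_of_one_lt 1 one_lt_two
    obtain ⟨m, hm, hm1⟩ := ((h1.eventually (gt_mem_nhds (show 0 < q / 8 by positivity))).and
      (Filter.eventually_ge_atTop 1)).exists
    refine ⟨m, ?_⟩
    rw [pow_one, div_lt_iff₀ (by positivity)] at hm
    have : (1 : ℝ) ≤ m := by exact_mod_cast hm1
    linarith
  obtain ⟨D, hDcard, hDK, hDsep⟩ := exists_finset_separated K (2 ^ m)
  let e : Fin D.card ≃ {s // s ∈ D} := D.equivFin.symm
  have he : ∀ {a b : Fin D.card}, a ≠ b → (e a : Γ) ≠ e b := fun hab h =>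
    hab (e.injective (Subtype.ext h))
  have hED : ∀ (a b : Fin D.card), ∀ s ∈ ({(e a : Γ), (e b : Γ)} : Finset Γ), s ∈ D := by
    intro a b s hs
    rcases Finset.mem_insert.1 hs with rfl | hs
    · exact (e a).2
    · rw [Finset.mem_singleton.1 hs]
      exact (e b).2
  refine ⟨ι × {p : Fin D.card × Fin D.card // p.1 ≠ p.2}, inferInstance, Prod.fst,
    fun i' => {(e i'.2.1.1 : Γ), (e i'.2.1.2 : Γ)}, fun i' => Finset.card_pair (he i'.2.2),
    fun i' s hs => hDK s (hED _ _ s hs),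
    fun i' s hs t ht => hDsep s (hED _ _ s hs) t (hED _ _ t ht), ?_⟩
  have hDpos : (0 : ℝ) < D.card := by rw [hDcard]; positivity
  refine ⟨1 / (3 * (D.card : ℝ) ^ 2), by positivity, fun F hF => ?_⟩
  obtain ⟨J, ⟨i, hJ⟩, hJF⟩ := exists_two_mul_card_le_card_filter_mul_mem hq
    (P := fun J => ∃ i, IsIndepSet (A i) (J : Set Γ)) hdens hm hDcard hF
  obtain ⟨a, ha, b, hb, hab, hcard⟩ :=
    exists_ne_card_le_card_filter_and (fun d s : Γ => d * s ∈ J) hF hJF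
  obtain ⟨M, hMG, hMcard, hM⟩ := exists_subset_forall_mul_notMem
    (F.filter fun s => a * s ∈ J ∧ b * s ∈ J) (g := b⁻¹ * a)
    (fun h => hab (inv_mul_eq_one.1 h).symm)
  have hMmem : ∀ s ∈ M, a * s ∈ J ∧ b * s ∈ J := fun s hs => (Finset.mem_filter.1 (hMG hs)).2
  have hM' : ∀ s ∈ M, ∀ s' ∈ M, a * s ≠ b * s' := by
    intro s hs s' hs' h
    refine hM s hs ?_
    rwa [mul_assoc, h, inv_mul_cancel_left]
  refine ⟨M, hMG.trans (Finset.filter_subset _ _), ?_,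
    (i, ⟨(e.symm ⟨a, ha⟩, e.symm ⟨b, hb⟩), by simpa using hab⟩), ?_⟩
  · have : F.card ≤ D.card ^ 2 * (3 * M.card) := hcard.trans (by gcongr)
    have : (F.card : ℝ) ≤ D.card ^ 2 * (3 * M.card) := by exact_mod_cast this
    rw [one_div, inv_mul_le_iff₀ (by positivity)]
    linarith
  · refine hJ.iInter_smul_preimage _ (Finset.insert_nonempty _ _) ?_ ?_
    · intro t ht s hs
      simp only [Equiv.apply_symm_apply, Finset.mem_insert, Finset.mem_singleton] at ht
      rcases ht with rfl | rfl
      exacts [(hMmem s hs).1, (hMmem s hs).2]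
    · intro t ht s hs t' ht' s' hs' h
      simp only [Equiv.apply_symm_apply, Finset.mem_insert, Finset.mem_singleton] at ht ht'
      rcases ht with rfl | rfl <;> rcases ht' with rfl | rfl
      · exact ⟨rfl, mul_left_cancel h⟩
      · exact absurd h (hM' s hs s' hs')
      · exact absurd h.symm (hM' s' hs' s hs)
      · exact ⟨rfl, mul_left_cancel h⟩
end

section
/- Let Γ be a countably infinite discrete group acting on a compact metrizable space X by homeomorphisms, let 𝒜 be a finite family of tuples of subsets of X with positive independence density, let K be a nonempty finite subset of Γ, and let n ∈ ℕ. Then there is a finite family 𝒜' of tuples of subsets of X with positive independence density such that each element of 𝒜' is of the form A^E for some A ∈ 𝒜 and some K-separated nonempty finite subset E of Γ \ K with |E| = 2^n. -/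
/-- If the product map `E × J' → J` is well defined and injective and `J` is an independence
set for `A`, then `J'` is an independence set for `A^E`. -/
lemma IsIndepSet.iterate {Γ X ι : Type*} [Group Γ] [MulAction Γ X] {A : ι → Set X}
    {J J' : Set Γ} (hJ : IsIndepSet A J) {E : Finset Γ} (hE : E.Nonempty)
    (hmem : ∀ s ∈ E, ∀ t ∈ J', s * t ∈ J)
    (hinj : ∀ s ∈ E, ∀ t ∈ J', ∀ s' ∈ E, ∀ t' ∈ J', s * t = s' * t' → s = s' ∧ t = t') :
    IsIndepSet (fun ω : {s // s ∈ E} → ι =>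
      ⋂ s : {s // s ∈ E}, (fun x : X => (s : Γ) • x) ⁻¹' A (ω s)) J' := by
  classical
  intro F hF hFne ω
  obtain ⟨s₀, hs₀⟩ := hE
  let φ : {s // s ∈ E} × {t // t ∈ F} → Γ := fun p => (p.1 : Γ) * p.2
  have hφ : Function.Injective φ := by
    rintro ⟨⟨s, hs⟩, t, ht⟩ ⟨⟨s', hs'⟩, t', ht'⟩ h
    obtain ⟨rfl, rfl⟩ := hinj s hs t (hF ht) s' hs' t' (hF ht') h
    rfl
  obtain ⟨x, hx⟩ := hJ (Finset.univ.image φ)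
    (by
      intro g hg
      obtain ⟨p, -, rfl⟩ := Finset.mem_image.1 (Finset.mem_coe.1 hg)
      exact hmem _ p.1.2 _ (hF p.2.2))
    (by
      obtain ⟨t, ht⟩ := hFne
      exact ⟨φ (⟨s₀, hs₀⟩, ⟨t, ht⟩), Finset.mem_image_of_mem _ (Finset.mem_univ _)⟩)
    (Function.extend φ (fun p => ω p.2 p.1) fun _ => ω 1 ⟨s₀, hs₀⟩)
  refine ⟨x, ?_⟩
  simp only [Set.mem_iInter, Set.mem_preimage] at hx ⊢
  intro t ht s
  have h := hx (φ (s, ⟨t, ht⟩)) (Finset.mem_image_of_mem _ (Finset.mem_univ _))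
  rw [hφ.extend_apply] at h
  simpa [φ, mul_smul] using h

/-- An infinite group contains an infinite `K`-separated sequence avoiding `K`. -/
lemma exists_separated_seq {Γ : Type*} [Group Γ] [Infinite Γ] (K : Finset Γ) :
    ∃ f : ℕ → Γ, (∀ i, f i ∉ K) ∧
      ∀ i j, i ≠ j → ∀ u ∈ K, ∀ v ∈ K, u * f i ≠ v * f j := by
  classical
  have : Std.Symm fun x y : Γ => ∀ u ∈ K, ∀ v ∈ K, u * x ≠ v * y :=
    ⟨fun x y h u hu v hv e => h v hv u hu e.symm⟩
  obtain ⟨f, hf, hr⟩ := exists_seq_of_forall_finset_exists' (fun x : Γ => x ∉ K)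
    (fun x y => ∀ u ∈ K, ∀ v ∈ K, u * x ≠ v * y) (by
      intro s _
      obtain ⟨y, hy⟩ := Infinite.exists_notMem_finset
        (K ∪ (K ×ˢ K ×ˢ s).image fun p => p.2.1⁻¹ * (p.1 * p.2.2))
      rw [Finset.mem_union, not_or] at hy
      refine ⟨y, hy.1, fun x hx u hu v hv e => hy.2 ?_⟩
      exact Finset.mem_image.2 ⟨(u, v, x), by simp [hu, hv, hx], by simp [e]⟩)
  exact ⟨f, hf, fun i j hij => hr hij⟩

/-- Every finite set `F` has an `L`-separated subset of proportion at least `1 / |L|²`. -/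
lemma exists_separated_subset {Γ : Type*} [Group Γ] {L : Finset Γ} (hL : L.Nonempty)
    (F : Finset Γ) :
    ∃ F₀ ⊆ F, (∀ s ∈ F₀, ∀ t ∈ F₀, ∀ a ∈ L, ∀ b ∈ L, a * s = b * t → s = t) ∧
      F.card ≤ L.card * L.card * F₀.card := by
  classical
  suffices H : ∃ F₀ ⊆ F, (∀ s ∈ F₀, ∀ t ∈ F₀, ∀ a ∈ L, ∀ b ∈ L, a * s = b * t → s = t) ∧
      ∀ s ∈ F, ∃ a ∈ L, ∃ b ∈ L, ∃ t ∈ F₀, a * s = b * t by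
    obtain ⟨F₀, hsub, hsep, hcov⟩ := H
    refine ⟨F₀, hsub, hsep, ?_⟩
    have hF : F ⊆ ((L ×ˢ L) ×ˢ F₀).image fun p => p.1.1⁻¹ * (p.1.2 * p.2) := by
      intro s hs
      obtain ⟨a, ha, b, hb, t, ht, e⟩ := hcov s hs
      exact Finset.mem_image.2 ⟨((a, b), t), by simp [ha, hb, ht], by simp [← e]⟩
    simpa using (Finset.card_le_card hF).trans Finset.card_image_le
  obtain ⟨l, hl⟩ := hL
  induction F using Finset.induction_on with
  | empty => exact ⟨∅, by simp⟩
  | insert r F _ ih =>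
    obtain ⟨F₀, hsub, hsep, hcov⟩ := ih
    by_cases hr : ∃ a ∈ L, ∃ b ∈ L, ∃ t ∈ F₀, a * r = b * t
    · refine ⟨F₀, hsub.trans (Finset.subset_insert _ _), hsep, fun s hs => ?_⟩
      obtain rfl | hs := Finset.mem_insert.1 hs
      exacts [hr, hcov s hs]
    · push Not at hr
      refine ⟨insert r F₀, Finset.insert_subset_insert _ hsub, ?_, ?_⟩
      · intro s hs t ht a ha b hb e
        obtain rfl | hs := Finset.mem_insert.1 hs <;> obtain rfl | ht := Finset.mem_insert.1 ht
        · rfl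
        · exact absurd e (hr a ha b hb t ht)
        · exact absurd e.symm (hr b hb a ha s ‹_›)
        · exact hsep s hs t ht a ha b hb e
      · intro s hs
        obtain rfl | hs := Finset.mem_insert.1 hs
        · exact ⟨l, hl, l, hl, s, Finset.mem_insert_self _ _, rfl⟩
        · obtain ⟨a, ha, b, hb, t, ht, e⟩ := hcov s hs
          exact ⟨a, ha, b, hb, t, Finset.mem_insert_of_mem ht, e⟩

/-- If `J` occupies a proportion at least `q` of the union of the translates `L t`, `t ∈ F`, and
`L` is large, then a positive proportion of the `t` share a common `E ⊆ L` of size `d`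
with `E t ⊆ J`. -/
lemma exists_common_pattern {Γ : Type*} [Group Γ] {L F J : Finset Γ} {q : ℝ} {d : ℕ}
    (hq : 0 < q) (hF : F.Nonempty) (hd : 2 * (d : ℝ) ≤ q * L.card) (hL : L.Nonempty)
    (hJ : ∀ g ∈ J, ∃ l ∈ L, ∃ t ∈ F, l * t = g)
    (hcard : q * (L.card * F.card) ≤ J.card) :
    ∃ E ∈ L.powersetCard d, ∃ F' ⊆ F, (∀ s ∈ E, ∀ t ∈ F', s * t ∈ J) ∧
      q / 2 * F.card ≤ (L.powersetCard d).card * F'.card := by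
  classical
  let S : Γ → Finset Γ := fun t => {l ∈ L | l * t ∈ J}
  let G : Finset Γ := {t ∈ F | d ≤ (S t).card}
  have hL0 : (0 : ℝ) < L.card := by exact_mod_cast hL.card_pos
  have hF0 : (0 : ℝ) < F.card := by exact_mod_cast hF.card_pos
  have hsum : J.card ≤ ∑ t ∈ F, (S t).card := by
    have hsub : J ⊆ F.biUnion fun t => (S t).image (· * t) := by
      intro g hg
      obtain ⟨l, hl, t, ht, rfl⟩ := hJ g hg
      exact Finset.mem_biUnion.2 ⟨t, ht, Finset.mem_image.2 ⟨l, by simp [S, hl, hg], rfl⟩⟩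
    exact (Finset.card_le_card hsub).trans
      (Finset.card_biUnion_le.trans (Finset.sum_le_sum fun _ _ => Finset.card_image_le))
  have hbound : ∑ t ∈ F, (S t).card ≤ L.card * G.card + d * F.card := by
    calc ∑ t ∈ F, (S t).card ≤ ∑ t ∈ F, ((if d ≤ (S t).card then L.card else 0) + d) := by
          refine Finset.sum_le_sum fun t _ => ?_
          have : (S t).card ≤ L.card := Finset.card_le_card (Finset.filter_subset _ _)
          split_ifs <;> omega
      _ = L.card * G.card + d * F.card := by
          rw [Finset.sum_add_distrib, ← Finset.sum_filter]
          simp [G, mul_comm]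
  have hG : q / 2 * F.card ≤ G.card := by
    have h1 : (J.card : ℝ) ≤ L.card * G.card + d * F.card := by exact_mod_cast hsum.trans hbound
    have h2 := mul_le_mul_of_nonneg_right hd hF0.le
    refine le_of_mul_le_mul_left ?_ hL0
    linarith
  have hex : ∀ t ∈ G, ∃ E ⊆ S t, E.card = d := fun t ht =>
    Finset.exists_subset_card_eq (Finset.mem_filter.1 ht).2
  choose! c hcS hcd using hex
  have hmaps : ∀ t ∈ G, c t ∈ L.powersetCard d := fun t ht =>
    Finset.mem_powersetCard.2 ⟨(hcS t ht).trans (Finset.filter_subset _ _), hcd t ht⟩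
  have hGpos : (0 : ℝ) < G.card := lt_of_lt_of_le (by positivity) hG
  obtain ⟨t₀, ht₀⟩ := Finset.card_pos.1 (by exact_mod_cast hGpos : 0 < G.card)
  have hN : (0 : ℝ) < (L.powersetCard d).card := by
    exact_mod_cast Finset.card_pos.2 ⟨_, hmaps t₀ ht₀⟩
  obtain ⟨E, hE, hb⟩ := Finset.exists_le_card_fiber_of_nsmul_le_card_of_maps_to
    (b := (G.card : ℝ) / (L.powersetCard d).card) hmaps ⟨_, hmaps t₀ ht₀⟩
    (by rw [nsmul_eq_mul, mul_div_cancel₀ _ hN.ne'])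
  refine ⟨E, hE, {t ∈ G | c t = E},
    (Finset.filter_subset _ _).trans (Finset.filter_subset _ _), ?_, ?_⟩
  · intro s hs t ht
    obtain ⟨htG, rfl⟩ := Finset.mem_filter.1 ht
    exact (Finset.mem_filter.1 (hcS t htG hs)).2
  · rw [div_le_iff₀ hN] at hb
    linarith

/-- Let a countably infinite group `Γ` act continuously on a compact metrizable space
`X`, let `(A i)_{i : ι}` be a finite family of tuples of subsets of `X` with positive
independence density, and let `K` be a nonempty finite subset of `Γ`. Then there is a
finite family `𝒜'` with positive independence density each of whose members is of the
form `A^E = (⋂_{s ∈ E} s⁻¹ A_{ω(s)})_{ω : E → [k]}` for some tuple `A` of the original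
family and some `K`-separated subset `E` of `Γ \ K` with `|E| = 2^n`. -/
theorem pos_indep_density_iterated_doubling
    {Γ : Type*} [Group Γ] [Countable Γ] [Infinite Γ]
    {X : Type*} [TopologicalSpace X] [CompactSpace X] [TopologicalSpace.MetrizableSpace X]
    [MulAction Γ X] [ContinuousConstSMul Γ X]
    {ι : Type} [Fintype ι] (k : ι → ℕ) (A : ∀ i, Fin (k i) → Set X)
    (h : HasPosIndepDensity Γ A)
    (K : Finset Γ) (hK : K.Nonempty) (n : ℕ) :
    ∃ (ι' : Type) (_ : Fintype ι') (g : ι' → ι) (E : ι' → Finset Γ),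
      (∀ i', (E i').card = 2 ^ n) ∧
      (∀ i', ∀ s ∈ E i', s ∉ K) ∧
      (∀ i', ∀ s ∈ E i', ∀ t ∈ E i', s ≠ t → ∀ u ∈ K, ∀ v ∈ K, u * s ≠ v * t) ∧
      HasPosIndepDensity Γ
        (fun i' (ω : {s // s ∈ E i'} → Fin (k (g i'))) =>
          ⋂ s : {s // s ∈ E i'}, (fun x : X => (s : Γ) • x) ⁻¹' A (g i') (ω s)) := by
  classical
  obtain ⟨q, hq, h⟩ := h
  obtain ⟨f, hfK, hsep⟩ := exists_separated_seq K
  have hf : Function.Injective f := by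
    intro i j hij
    by_contra hne
    obtain ⟨u, hu⟩ := hK
    exact hsep i j hne u hu u hu (by rw [hij])
  obtain ⟨m₀, hm₀⟩ := exists_nat_ge (2 * (2 ^ n : ℝ) / q)
  let m := m₀ + 2 ^ n
  have hm : 2 * (2 ^ n : ℝ) ≤ q * m := by
    rw [div_le_iff₀ hq] at hm₀
    have : (m₀ : ℝ) ≤ m := by simp [m]
    nlinarith
  have hmn : 2 ^ n ≤ m := Nat.le_add_left _ _
  have hmpos : 0 < m := lt_of_lt_of_le (by positivity) hmn
  have hfm : Function.Injective fun i : Fin m => f i := hf.comp Fin.val_injective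
  let L : Finset Γ := (Finset.range m).image f
  have hLcard : L.card = m := by simp [L, Finset.card_image_of_injective _ hf]
  have hL : L.Nonempty := Finset.card_pos.1 (by omega)
  have hN : 0 < (L.powersetCard (2 ^ n)).card := by
    rw [Finset.card_powersetCard, hLcard]
    exact Nat.choose_pos hmn
  refine ⟨ι × {S : Finset (Fin m) // S.card = 2 ^ n}, inferInstance, Prod.fst,
    fun p => p.2.1.image fun i : Fin m => f i, ?_, ?_, ?_,
    q / 2 / ((L.powersetCard (2 ^ n)).card * (m * m)), by positivity, ?_⟩
  · rintro ⟨i, S, hS⟩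
    exact (Finset.card_image_of_injective _ hfm).trans hS
  · intro p s hs
    obtain ⟨i, -, rfl⟩ := Finset.mem_image.1 hs
    exact hfK i
  · intro p s hs t ht hst
    obtain ⟨i, -, rfl⟩ := Finset.mem_image.1 hs
    obtain ⟨j, -, rfl⟩ := Finset.mem_image.1 ht
    exact hsep i j fun e => hst (by rw [e])
  intro F hF
  obtain ⟨F₀, hF₀F, hF₀, hcard⟩ := exists_separated_subset hL F
  have hF₀ne : F₀.Nonempty := by
    rw [Finset.nonempty_iff_ne_empty]
    rintro rfl
    have := hF.card_pos
    simp at hcard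
    simp [hcard] at this
  have hinj : ∀ a ∈ L, ∀ s ∈ F₀, ∀ b ∈ L, ∀ t ∈ F₀, a * s = b * t → a = b ∧ s = t := by
    intro a ha s hs b hb t ht e
    obtain rfl := hF₀ s hs t ht a ha b hb e
    exact ⟨mul_right_cancel e, rfl⟩
  let P : Finset Γ := (L ×ˢ F₀).image fun p => p.1 * p.2
  have hP : P.card = L.card * F₀.card := by
    rw [← Finset.card_product]
    refine Finset.card_image_of_injOn ?_
    rintro ⟨a, s⟩ has ⟨b, t⟩ hbt e
    have has' := Finset.mem_product.1 (Finset.mem_coe.1 has)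
    have hbt' := Finset.mem_product.1 (Finset.mem_coe.1 hbt)
    obtain ⟨h1, h2⟩ := hinj a has'.1 s has'.2 b hbt'.1 t hbt'.2 e
    exact Prod.ext h1 h2
  obtain ⟨J, hJP, hJcard, i, hJ⟩ := h P ((hL.product hF₀ne).image _)
  obtain ⟨E, hE, F', hF', hEF', hF'card⟩ := exists_common_pattern (d := 2 ^ n) (J := J) hq hF₀ne
    (by rw [hLcard]; exact_mod_cast hm) hL
    (by
      intro g hg
      obtain ⟨⟨l, t⟩, hlt, rfl⟩ := Finset.mem_image.1 (hJP hg)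
      obtain ⟨hl, ht⟩ := Finset.mem_product.1 hlt
      exact ⟨l, hl, t, ht, rfl⟩)
    (by rw [hP] at hJcard; exact_mod_cast hJcard)
  obtain ⟨hEL, hEcard⟩ := Finset.mem_powersetCard.1 hE
  let S : Finset (Fin m) := {i | f i ∈ E}
  have hSE : (S.image fun i : Fin m => f i) = E := by
    ext s
    simp only [S, Finset.mem_image, Finset.mem_filter, Finset.mem_univ, true_and]
    constructor
    · rintro ⟨i, hi, rfl⟩
      exact hi
    · intro hs
      obtain ⟨i, hi, rfl⟩ := Finset.mem_image.1 (hEL hs)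
      exact ⟨⟨i, Finset.mem_range.1 hi⟩, hs, rfl⟩
  have hS : S.card = 2 ^ n := by
    rw [← hEcard, ← hSE, Finset.card_image_of_injective _ hfm]
  refine ⟨F', hF'.trans hF₀F, ?_, (i, ⟨S, hS⟩), ?_⟩
  · rw [hLcard] at hcard
    have hc : (F.card : ℝ) ≤ m * m * F₀.card := by exact_mod_cast hcard
    have hNr : (0 : ℝ) < (L.powersetCard (2 ^ n)).card := by exact_mod_cast hN
    rw [div_mul_eq_mul_div, div_le_iff₀ (by positivity)]
    calc q / 2 * (F.card : ℝ) ≤ q / 2 * (m * m * F₀.card) := by gcongr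
      _ = m * m * (q / 2 * F₀.card) := by ring
      _ ≤ m * m * ((L.powersetCard (2 ^ n)).card * F'.card) := by gcongr
      _ = F'.card * ((L.powersetCard (2 ^ n)).card * (m * m)) := by ring
  · refine hJ.iterate (E := S.image fun i : Fin m => f i) ?_ ?_ ?_
    · rw [hSE]
      exact Finset.card_pos.1 (by rw [hEcard]; positivity)
    · rw [hSE]
      exact hEF'
    · rw [hSE]
      intro s hs t ht s' hs' t' ht'
      exact hinj s (hEL hs) t (hF' ht) s' (hEL hs') t' (hF' ht')
end

section
/- Let Γ be a countably infinite discrete group acting on a compact metrizable space X by homeomorphisms with compatible metric ρ, and let 𝒜 be a finite pairwise disjoint closed family of tuples of subsets of X, each tuple of length at least 2, with positive independence density. Then there exist a tuple A ∈ 𝒜 and a Cantor set Z (a nonempty compact perfect totally disconnected subset of X) contained in the union of the entries of A such that for every finite subset Y of Z and every map f : Y → Z one has liminf_{Γ∋s→∞} max_{y∈Y} ρ(sy, f(y)) = 0, where the liminf is taken along the filter of cofinite subsets of Γ. -/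
/-- `S` realises every `κ`-valued pattern on the coordinates in `W`. -/
def RealisesAll {β κ : Type*} (S : Finset (β → κ)) (W : Finset β) : Prop :=
  ∀ ω : β → κ, ∃ ω' ∈ S, ∀ s ∈ W, ω' s = ω s

open Classical in
/-- A Sauer–Shelah–Pajor inequality over the alphabet `κ`. -/
theorem card_le_sum_realisesAll {β κ : Type*} [Fintype κ] (k₀ : κ) (J : Finset β) :
    ∀ S : Finset (β → κ), (∀ ω ∈ S, ∀ s ∉ J, ω s = k₀) →
      S.card ≤ ∑ W ∈ J.powerset,
        if RealisesAll S W then (Fintype.card κ - 1) ^ (J.card - W.card) else 0 := by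
  induction J using Finset.induction_on with
  | empty =>
    intro S hS
    rcases S.eq_empty_or_nonempty with rfl | ⟨ω₀, h₀⟩
    · simp
    · have h1 : RealisesAll S ∅ := fun ω => ⟨ω₀, h₀, by simp⟩
      have h2 : S.card ≤ 1 := Finset.card_le_one.2 fun a ha b hb => by
        funext s
        rw [hS a ha s (by simp), hS b hb s (by simp)]
      rw [Finset.powerset_empty, Finset.sum_singleton, if_pos h1]
      simpa using h2
  | insert z J hz ih =>
    intro S hS
    let T : κ → Finset (β → κ) := fun j =>
      (S.filter fun ω => ω z = j).image fun ω => Function.update ω z k₀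
    have hTcard : ∀ j, (T j).card = (S.filter fun ω => ω z = j).card := by
      intro j
      refine Finset.card_image_of_injOn fun a ha b hb hab => ?_
      simp only [Finset.coe_filter, Set.mem_ofPred_eq] at ha hb
      funext s
      by_cases hs : s = z
      · rw [hs, ha.2, hb.2]
      · simpa [hs] using congrFun hab s
    have hScard : S.card = ∑ j, (T j).card := by
      simp_rw [hTcard]
      exact Finset.card_eq_sum_card_fiberwise fun _ _ => Finset.mem_coe.2 (Finset.mem_univ _)
    have hT : ∀ j, (T j).card ≤ ∑ W ∈ J.powerset,
        if RealisesAll (T j) W then (Fintype.card κ - 1) ^ (J.card - W.card) else 0 := by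
      intro j
      refine ih _ fun ω hω s hs => ?_
      obtain ⟨ω₁, h₁, rfl⟩ := Finset.mem_image.1 hω
      by_cases hsz : s = z
      · simp [hsz]
      · simpa [hsz] using hS ω₁ (Finset.mem_filter.1 h₁).1 s (by simp [hsz, hs])
    rw [hScard, Finset.sum_powerset_insert hz]
    refine (Finset.sum_le_sum fun j _ => hT j).trans ?_
    rw [Finset.sum_comm, ← Finset.sum_add_distrib]
    refine Finset.sum_le_sum fun W hW => ?_
    rw [Finset.mem_powerset] at hW
    have hzW : z ∉ W := fun h => hz (hW h)
    have hlift : ∀ j, RealisesAll (T j) W →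
        ∀ ω : β → κ, ∃ ω' ∈ S, ω' z = j ∧ ∀ s ∈ W, ω' s = ω s := by
      intro j hj ω
      obtain ⟨ω', h', hW'⟩ := hj ω
      obtain ⟨ω₁, h₁, rfl⟩ := Finset.mem_image.1 h'
      rw [Finset.mem_filter] at h₁
      refine ⟨ω₁, h₁.1, h₁.2, fun s hs => ?_⟩
      have hsz : s ≠ z := fun h => hzW (h ▸ hs)
      simpa [hsz] using hW' s hs
    have hone : ∀ j, RealisesAll (T j) W → RealisesAll S W := by
      intro j hj ω
      obtain ⟨ω', h1, -, h3⟩ := hlift j hj ω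
      exact ⟨ω', h1, h3⟩
    have hall : (∀ j, RealisesAll (T j) W) → RealisesAll S (insert z W) := by
      intro h ω
      obtain ⟨ω', h1, h2, h3⟩ := hlift (ω z) (h _) ω
      refine ⟨ω', h1, fun s hs => ?_⟩
      rcases Finset.mem_insert.1 hs with rfl | hs
      exacts [h2, h3 s hs]
    rw [← Finset.sum_filter, Finset.sum_const, smul_eq_mul, Finset.card_insert_of_notMem hz,
      Finset.card_insert_of_notMem hzW, Nat.add_sub_add_right]
    have hle := Finset.card_le_card hW
    have hκ : 0 < Fintype.card κ := Fintype.card_pos_iff.2 ⟨k₀⟩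
    by_cases hA : ∀ j, RealisesAll (T j) W
    · rw [if_pos (hone k₀ (hA k₀)), if_pos (hall hA), Finset.filter_true_of_mem fun j _ => hA j,
        Finset.card_univ, Nat.succ_sub hle, pow_succ]
      rw [← mul_add_one, Nat.sub_one_add_one hκ.ne', mul_comm]
    · by_cases hE : ∃ j, RealisesAll (T j) W
      · obtain ⟨j, hj⟩ := hE
        rw [if_pos (hone j hj), Nat.succ_sub hle, pow_succ, mul_comm]
        refine le_add_right (Nat.mul_le_mul_left _ (Nat.le_sub_one_of_lt ?_))
        push Not at hA
        obtain ⟨i, hi⟩ := hA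
        exact Finset.card_lt_univ_of_notMem (x := i) (by simp [hi])
      · push Not at hE
        simp [hE]

open Classical in
/-- A map `η` colouring the pairs `(ω, s)` can be made constant, on a proportion of the
coordinates, at the places where `ω` takes the value `j₀`. -/
theorem exists_mono_on_letter_fintype {κ E : Type*} [Fintype κ] [Fintype E] [Nonempty E]
    (j₀ : κ) :
    ∃ D : ℕ, 0 < D ∧ ∀ {β : Type*} [Fintype β] (η : (β → κ) → β → E),
      ∃ (W : Finset β) (e : E), Fintype.card β ≤ D * W.card ∧
        ∀ ω : β → κ, ∃ ω' : β → κ, (∀ s ∈ W, ω' s = ω s) ∧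
          ∀ s ∈ W, ω s = j₀ → η ω' s = e := by
  set r : ℕ := Fintype.card E with hr
  have hr0 : 0 < r := Fintype.card_pos
  have hrR : (0 : ℝ) < r := by exact_mod_cast hr0
  have hκ : 0 < Fintype.card κ := Fintype.card_pos_iff.2 ⟨j₀⟩
  set M : ℕ := Fintype.card κ - 1 with hM
  set t : ℝ := 1 / (2 * r) with ht
  have ht0 : 0 < t := by positivity
  have htr : 2 * t = 1 / r := by rw [ht]; field_simp
  have hM0 : (0 : ℝ) ≤ M := Nat.cast_nonneg M
  obtain ⟨ρ, hρ1, hρ2⟩ : ∃ ρ : ℝ, 1 < ρ ∧ ρ < (M + 2 * t) / (M + t) :=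
    exists_between (by rw [one_lt_div (by positivity)]; linarith)
  rw [lt_div_iff₀ (by positivity)] at hρ2
  obtain ⟨D, hD⟩ := pow_unbounded_of_one_lt t⁻¹ hρ1
  have hD1 : 1 ≤ t * ρ ^ D := by
    rw [inv_lt_iff_one_lt_mul₀ ht0] at hD
    linarith
  refine ⟨(D + 1) * r, by positivity, fun {β} _ η => ?_⟩
  set n := Fintype.card β with hn
  rcases Nat.eq_zero_or_pos n with hn0 | hnpos
  · exact ⟨∅, Classical.arbitrary E, by simp [hn0], fun ω => ⟨ω, by simp⟩⟩
  let S : (β → E) → Finset (β → κ) := fun c =>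
    Finset.univ.filter fun ω => ∀ s, ω s = j₀ → η ω s = c s
  have hsum : ∑ c, (S c).card = (r * M + 1) ^ n := by
    have h1 : ∀ ω : β → κ, (Finset.univ.filter fun c : β → E =>
        ∀ s, ω s = j₀ → η ω s = c s).card = ∏ s, if ω s = j₀ then 1 else r := by
      intro ω
      have : (Finset.univ.filter fun c : β → E => ∀ s, ω s = j₀ → η ω s = c s) =
          Fintype.piFinset fun s => if ω s = j₀ then {η ω s} else Finset.univ := by
        ext c
        simp only [Finset.mem_filter, Finset.mem_univ, true_and, Fintype.mem_piFinset]
        refine forall_congr' fun s => ?_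
        by_cases h : ω s = j₀ <;> simp [h, eq_comm]
      rw [this, Fintype.card_piFinset]
      refine Finset.prod_congr rfl fun s _ => ?_
      split_ifs <;> simp [hr]
    have h2 : ∑ c, (S c).card = ∑ ω : β → κ, (Finset.univ.filter fun c : β → E =>
        ∀ s, ω s = j₀ → η ω s = c s).card := by
      simp only [S, Finset.card_filter]
      exact Finset.sum_comm
    rw [h2]
    simp_rw [h1]
    have h3 : ∑ j : κ, (if j = j₀ then 1 else r) = r * M + 1 := by
      rw [← Finset.add_sum_erase _ _ (Finset.mem_univ j₀), if_pos rfl,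
        Finset.sum_congr rfl (g := fun _ => r) fun x hx => if_neg (Finset.ne_of_mem_erase hx)]
      simp [Finset.card_erase_of_mem, hM, mul_comm, add_comm]
    have h4 := Finset.sum_prod_piFinset (ι := β) (Finset.univ : Finset κ)
      (fun _ j => if j = j₀ then 1 else r)
    rw [Fintype.piFinset_univ] at h4
    rw [h4, Finset.prod_const, h3, Finset.card_univ]
  obtain ⟨c, hc⟩ : ∃ c, (r * M + 1) ^ n ≤ r ^ n * (S c).card := by
    by_contra! hcon
    have h1 : ∑ c : β → E, r ^ n * (S c).card < ∑ c : β → E, (r * M + 1) ^ n :=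
      Finset.sum_lt_sum_of_nonempty Finset.univ_nonempty fun c _ => hcon c
    rw [← Finset.mul_sum, hsum, Finset.sum_const, Finset.card_univ, Fintype.card_fun] at h1
    simp [hr, hn] at h1
  have hc' : ((M : ℝ) + 2 * t) ^ n ≤ (S c).card := by
    have h1 : ((r : ℝ) * M + 1) ^ n ≤ (r : ℝ) ^ n * (S c).card := by exact_mod_cast hc
    have h2 : (r : ℝ) * M + 1 = r * (M + 2 * t) := by rw [htr]; field_simp
    rw [h2, mul_pow] at h1
    exact le_of_mul_le_mul_left h1 (by positivity)
  obtain ⟨W, hW, hWn⟩ : ∃ W, RealisesAll (S c) W ∧ n ≤ (D + 1) * W.card := by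
    by_contra! hcon
    have h1 := card_le_sum_realisesAll j₀ Finset.univ (S c) (by simp)
    have h2 : ((S c).card : ℝ) ≤
        ∑ W ∈ (Finset.univ : Finset β).powerset, ρ ^ n * (t ^ W.card * M ^ (n - W.card)) := by
      refine (Nat.cast_le (α := ℝ).2 h1).trans ?_
      rw [Nat.cast_sum]
      refine Finset.sum_le_sum fun W _ => ?_
      split_ifs with hW
      · rw [Finset.card_univ]
        push_cast
        have h3 : 1 ≤ ρ ^ n * t ^ W.card := calc
          1 ≤ (t * ρ ^ D) ^ W.card := one_le_pow₀ hD1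
          _ = ρ ^ (D * W.card) * t ^ W.card := by rw [mul_pow, pow_mul, mul_comm]
          _ ≤ _ := by
            gcongr
            · exact hρ1.le
            · have := hcon W hW
              nlinarith
        rw [← mul_assoc]
        exact le_mul_of_one_le_left (by positivity) h3
      · push_cast
        positivity
    rw [← Finset.mul_sum] at h2
    have h5 := Finset.sum_pow_mul_eq_add_pow t (M : ℝ) (Finset.univ : Finset β)
    rw [Finset.card_univ, ← hn] at h5
    rw [h5, ← mul_pow] at h2
    have h4 : (ρ * (t + M)) ^ n < ((M : ℝ) + 2 * t) ^ n :=
      pow_lt_pow_left₀ (by linarith) (by positivity) hnpos.ne'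
    linarith
  obtain ⟨e, he⟩ : ∃ e, W.card ≤ r * (W.filter fun s => c s = e).card := by
    by_contra! hcon
    have h1 : ∑ e : E, r * (W.filter fun s => c s = e).card < ∑ e : E, W.card :=
      Finset.sum_lt_sum_of_nonempty Finset.univ_nonempty fun c _ => hcon c
    rw [← Finset.mul_sum, ← Finset.card_eq_sum_card_fiberwise (f := c) (t := Finset.univ)
      fun _ _ => Finset.mem_coe.2 (Finset.mem_univ _)] at h1
    simp [hr] at h1
  refine ⟨W.filter fun s => c s = e, e, ?_, fun ω => ?_⟩
  · calc n ≤ (D + 1) * W.card := hWn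
      _ ≤ (D + 1) * (r * (W.filter fun s => c s = e).card) := Nat.mul_le_mul_left _ he
      _ = _ := by ring
  · obtain ⟨ω', h1, h2⟩ := hW ω
    refine ⟨ω', fun s hs => h2 s (Finset.mem_filter.1 hs).1, fun s hs hj => ?_⟩
    rw [Finset.mem_filter] at hs
    rw [← hs.2]
    exact (Finset.mem_filter.1 h1).2 s ((h2 s hs.1).trans hj)

open Classical in
/-- The version of `exists_mono_on_letter_fintype` inside an arbitrary ambient set. -/
theorem exists_mono_on_letter {α κ E : Type*} [Fintype κ] [Fintype E] [Nonempty E]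
    (j₀ : κ) :
    ∃ D : ℕ, 0 < D ∧ ∀ (J : Finset α) (η : (α → κ) → α → E),
      ∃ W ⊆ J, ∃ e : E, J.card ≤ D * W.card ∧
        ∀ ω : α → κ, ∃ ω' : α → κ, (∀ s ∈ W, ω' s = ω s) ∧
          ∀ s ∈ W, ω s = j₀ → η ω' s = e := by
  obtain ⟨D, hD, h⟩ := exists_mono_on_letter_fintype (E := E) j₀
  refine ⟨D, hD, fun J η => ?_⟩
  let ext : (J → κ) → α → κ := fun ω a => if h : a ∈ J then ω ⟨a, h⟩ else j₀
  have hext : ∀ ω (s : J), ext ω s = ω s := fun ω s => by simp [ext]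
  obtain ⟨W, e, h1, h2⟩ := h fun (ω : J → κ) s => η (ext ω) s
  refine ⟨W.map (Function.Embedding.subtype _), ?_, e, by simpa using h1, fun ω => ?_⟩
  · intro s hs
    obtain ⟨s, -, rfl⟩ := Finset.mem_map.1 hs
    exact s.2
  · obtain ⟨ω', h3, h4⟩ := h2 fun s => ω s
    refine ⟨ext ω', fun s hs => ?_, fun s hs => ?_⟩ <;>
    obtain ⟨s, hsW, rfl⟩ := Finset.mem_map.1 hs
    · exact (hext ω' s).trans (h3 s hsW)
    · exact h4 s hsW

open Classical in
/-- A map `η` colouring the pairs `(ω, s)` can be made to depend only on the value `ω s`,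
on a proportion of the coordinates. -/
theorem exists_colour_of_letter {α κ E : Type*} [Fintype κ] [Fintype E] [Nonempty E] :
    ∃ D : ℕ, 0 < D ∧ ∀ (J : Finset α) (η : (α → κ) → α → E),
      ∃ W ⊆ J, ∃ c : κ → E, J.card ≤ D * W.card ∧
        ∀ ω : α → κ, ∃ ω' : α → κ, (∀ s ∈ W, ω' s = ω s) ∧
          ∀ s ∈ W, η ω' s = c (ω s) := by
  suffices H : ∀ P : Finset κ, ∃ D : ℕ, 0 < D ∧ ∀ (J : Finset α) (η : (α → κ) → α → E),
      ∃ W ⊆ J, ∃ c : κ → E, J.card ≤ D * W.card ∧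
        ∀ ω : α → κ, ∃ ω' : α → κ, (∀ s ∈ W, ω' s = ω s) ∧
          ∀ s ∈ W, ω s ∈ P → η ω' s = c (ω s) by
    simpa using H Finset.univ
  intro P
  induction P using Finset.induction_on with
  | empty =>
    exact ⟨1, one_pos, fun J η => ⟨J, subset_rfl, fun _ => Classical.arbitrary E, by simp,
      fun ω => ⟨ω, by simp⟩⟩⟩
  | insert j P hj ih =>
    obtain ⟨D₁, hD₁, h₁⟩ := ih
    obtain ⟨D₂, hD₂, h₂⟩ := exists_mono_on_letter (α := α) (E := E) j
    refine ⟨D₁ * D₂, by positivity, fun J η => ?_⟩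
    obtain ⟨W₁, hW₁, c, hc, H₁⟩ := h₁ J η
    choose Φ hΦ hΦc using H₁
    obtain ⟨W₂, hW₂, e, he, H₂⟩ := h₂ W₁ fun ω => η (Φ ω)
    refine ⟨W₂, hW₂.trans hW₁, Function.update c j e, ?_, fun ω => ?_⟩
    · rw [mul_assoc]
      exact hc.trans (Nat.mul_le_mul_left _ he)
    · obtain ⟨ω', h3, h4⟩ := H₂ ω
      refine ⟨Φ ω', fun s hs => (hΦ ω' s (hW₂ hs)).trans (h3 s hs), fun s hs hP => ?_⟩
      rcases Finset.mem_insert.1 hP with hP | hP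
      · rw [hP, Function.update_self]
        exact h4 s hs hP
      · have : ω s ≠ j := fun h => hj (h ▸ hP)
        rw [Function.update_of_ne this, ← h3 s hs]
        exact hΦc ω' s (hW₂ hs) (by rwa [h3 s hs])

/-- The quotients `f * f'⁻¹` of distinct elements of `F` avoid `L`. -/
def QuotientsAvoid {Γ : Type*} [Group Γ] (L F : Finset Γ) : Prop :=
  ∀ f ∈ F, ∀ f' ∈ F, f ≠ f' → f * f'⁻¹ ∉ L

/-- `J` is an independence set for the tuple of preimages of `B.2` under `B.1`. -/
def TranslatedIndep {Γ X κ : Type*} [Group Γ] [MulAction Γ X]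
    (B : Γ × (κ → Set X)) (J : Finset Γ) : Prop :=
  ∀ ω : Γ → κ, ∃ x : X, ∀ s ∈ J, (B.1 * s) • x ∈ B.2 (ω s)

/-- Positive independence density of a family of translated tuples, tested only on finite sets
whose quotients avoid some fixed finite set. -/
def SeparatedPosDensity {Γ X κ : Type*} [Group Γ] [MulAction Γ X]
    (𝓑 : Set (Γ × (κ → Set X))) : Prop :=
  ∃ q : ℝ, 0 < q ∧ ∃ L : Finset Γ, ∀ F : Finset Γ, F.Nonempty → QuotientsAvoid L F →
    ∃ J ⊆ F, q * (F.card : ℝ) ≤ J.card ∧ ∃ B ∈ 𝓑, TranslatedIndep B J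

open scoped Pointwise in
open Classical in
theorem exists_card_eq_quotientsAvoid {Γ : Type*} [Group Γ] [Infinite Γ] (L : Finset Γ) (N : ℕ) :
    ∃ K : Finset Γ, K.card = N ∧ QuotientsAvoid L K := by
  induction N with
  | zero => exact ⟨∅, rfl, by simp [QuotientsAvoid]⟩
  | succ N ih =>
    obtain ⟨K, hK, hL⟩ := ih
    obtain ⟨k, hk⟩ := Infinite.exists_notMem_finset (K ∪ (L * K ∪ L⁻¹ * K))
    simp only [Finset.mem_union, not_or] at hk
    obtain ⟨h1, h2, h3⟩ := hk
    refine ⟨insert k K, by rw [Finset.card_insert_of_notMem h1, hK], ?_⟩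
    intro f hf f' hf' hne hfL
    rcases Finset.mem_insert.1 hf with rfl | hfK <;> rcases Finset.mem_insert.1 hf' with rfl | hfK'
    · exact hne rfl
    · exact h2 (Finset.mem_mul.2 ⟨_, hfL, f', hfK', by group⟩)
    · exact h3 (Finset.mem_mul.2 ⟨_, Finset.inv_mem_inv hfL, f, hfK, by group⟩)
    · exact hL f hfK f' hfK' hne hfL

theorem SeparatedPosDensity.exists_nonempty {Γ X κ : Type*} [Group Γ] [MulAction Γ X]
    {𝓑 : Set (Γ × (κ → Set X))} (h : SeparatedPosDensity 𝓑) :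
    ∃ B ∈ 𝓑, ∀ j, (B.2 j).Nonempty := by
  obtain ⟨q, hq, L, H⟩ := h
  obtain ⟨J, -, hJ, B, hB, hind⟩ := H {1} (by simp) (by simp [QuotientsAvoid])
  have : J.Nonempty := by
    rw [← Finset.card_pos, ← Nat.cast_pos (α := ℝ)]
    exact lt_of_lt_of_le (by simpa using hq) hJ
  obtain ⟨s, hs⟩ := this
  exact ⟨B, hB, fun j => (hind fun _ => j).elim fun x hx => ⟨_, hx s hs⟩⟩

theorem SeparatedPosDensity.sep_nonempty {Γ X κ : Type*} [Group Γ] [MulAction Γ X]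
    {𝓑 : Set (Γ × (κ → Set X))} (h : SeparatedPosDensity 𝓑) :
    SeparatedPosDensity {B ∈ 𝓑 | ∀ j, (B.2 j).Nonempty} := by
  obtain ⟨q, hq, L, H⟩ := h
  refine ⟨q, hq, L, fun F hF hFL => ?_⟩
  obtain ⟨J, hJF, hJ, B, hB, hind⟩ := H F hF hFL
  have : J.Nonempty := by
    have := hF.card_pos
    rw [← Finset.card_pos, ← Nat.cast_pos (α := ℝ)]
    exact lt_of_lt_of_le (by positivity) hJ
  obtain ⟨s, hs⟩ := this
  exact ⟨J, hJF, hJ, B, ⟨hB, fun j => (hind fun _ => j).elim fun x hx => ⟨_, hx s hs⟩⟩, hind⟩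

theorem SeparatedPosDensity.exists_small_pieces {Γ X κ : Type*} [Group Γ] [MetricSpace X]
    [CompactSpace X] [MulAction Γ X] [Fintype κ] [Nonempty κ]
    {𝓑 : Set (Γ × (κ → Set X))} (hfin : 𝓑.Finite) (h : SeparatedPosDensity 𝓑)
    {ε : ℝ} (hε : 0 < ε) :
    ∃ 𝓑' : Set (Γ × (κ → Set X)), 𝓑'.Finite ∧ SeparatedPosDensity 𝓑' ∧
      ∀ B' ∈ 𝓑', ∃ B ∈ 𝓑, ∃ C : κ → Set X,
        (∀ j, IsClosed (C j) ∧ ∀ x ∈ C j, ∀ y ∈ C j, dist x y ≤ ε) ∧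
        B'.2 = fun j => B.2 j ∩ C j := by
  obtain ⟨B₀, -, h₀⟩ := h.exists_nonempty
  obtain ⟨x₀, -⟩ := h₀ (Classical.arbitrary κ)
  obtain ⟨t, -, htfin, ht⟩ :=
    finite_cover_balls_of_compact (isCompact_univ (X := X)) (half_pos hε)
  have ht' : ∀ x : X, ∃ c : t, x ∈ Metric.closedBall (c : X) (ε / 2) := by
    intro x
    obtain ⟨c, hc, hx⟩ := Set.mem_iUnion₂.1 (ht (Set.mem_univ x))
    exact ⟨⟨c, hc⟩, Metric.ball_subset_closedBall hx⟩
  choose col hcol using ht'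
  have : Fintype t := htfin.fintype
  have : Nonempty t := ⟨col x₀⟩
  refine ⟨Set.image2 (fun (B : Γ × (κ → Set X)) (c : κ → t) =>
    (B.1, fun j => B.2 j ∩ Metric.closedBall (c j : X) (ε / 2))) 𝓑 Set.univ,
    hfin.image2 _ Set.finite_univ, ?_, ?_⟩
  · obtain ⟨D, hD, hcomb⟩ := exists_colour_of_letter (α := Γ) (κ := κ) (E := t)
    obtain ⟨q, hq, L, H⟩ := h
    refine ⟨q / D, by positivity, L, fun F hF hFL => ?_⟩
    obtain ⟨J, hJF, hJ, B, hB, hind⟩ := H F hF hFL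
    choose x hx using hind
    obtain ⟨W, hWJ, c, hc, hW⟩ := hcomb J fun ω s => col ((B.1 * s) • x ω)
    refine ⟨W, hWJ.trans hJF, ?_, _, ⟨B, hB, c, Set.mem_univ _, rfl⟩, fun ω => ?_⟩
    · have hc' : (J.card : ℝ) ≤ D * W.card := by exact_mod_cast hc
      rw [div_mul_eq_mul_div, div_le_iff₀ (by positivity)]
      linarith
    · obtain ⟨ω', h1, h2⟩ := hW ω
      refine ⟨x ω', fun s hs => ⟨?_, ?_⟩⟩
      · rw [← h1 s hs]
        exact hx ω' s (hWJ hs)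
      · rw [← h2 s hs]
        exact hcol _
  · rintro _ ⟨B, hB, c, -, rfl⟩
    refine ⟨B, hB, fun j => Metric.closedBall (c j : X) (ε / 2),
      fun j => ⟨Metric.isClosed_closedBall, fun x hx y hy => ?_⟩, rfl⟩
    have := dist_triangle_right x y (c j : X)
    rw [Metric.mem_closedBall] at hx hy
    linarith

open Classical in
/-- Among the translates `k * s` with `k` in a large finite set `K`, a dense subset `J` of `K * F`
contains all those with `k` in the range of a fixed `u : R ↪ K`, for a proportion of `s ∈ F`. -/
theorem exists_embedding_dense {Γ R : Type*} [Group Γ] [Fintype R] {q : ℝ} (hq : 0 < q)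
    (K : Finset Γ) (hK : (Fintype.card R : ℝ) < q / 2 * K.card) :
    ∃ q' : ℝ, 0 < q' ∧ ∀ F J : Finset Γ, F.Nonempty →
      (∀ a ∈ J, ∃ k ∈ K, ∃ s ∈ F, k * s = a) → q * (K.card * F.card : ℝ) ≤ J.card →
      ∃ u : R ↪ K, q' * F.card ≤ (F.filter fun s => ∀ ρ, (u ρ : Γ) * s ∈ J).card := by
  set M : ℕ := Fintype.card (R ↪ K) with hM
  refine ⟨q / (4 * (M + 1)), by positivity, fun F J hF hJ hcard => ?_⟩
  by_contra! hcon
  have hF0 : (0 : ℝ) < F.card := by exact_mod_cast hF.card_pos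
  set n : Γ → ℕ := fun s => (K.filter fun k => k * s ∈ J).card with hn
  set G := F.filter fun s => Fintype.card R ≤ n s with hG
  have h1 : J.card ≤ ∑ s ∈ F, n s := by
    have : J ⊆ F.biUnion fun s => (K.filter fun k => k * s ∈ J).image (· * s) := by
      intro a ha
      obtain ⟨k, hk, s, hs, rfl⟩ := hJ a ha
      exact Finset.mem_biUnion.2 ⟨s, hs, Finset.mem_image.2
        ⟨k, Finset.mem_filter.2 ⟨hk, ha⟩, rfl⟩⟩
    exact (Finset.card_le_card this).trans (Finset.card_biUnion_le.trans
      (Finset.sum_le_sum fun s _ => Finset.card_image_le))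
  have h2 : ∑ s ∈ F, n s ≤ G.card * K.card + F.card * Fintype.card R := by
    rw [← Finset.sum_filter_add_sum_filter_not F fun s => Fintype.card R ≤ n s]
    refine add_le_add ?_ ?_
    · rw [← smul_eq_mul]
      exact Finset.sum_le_card_nsmul _ _ _ fun s _ => Finset.card_filter_le _ _
    · refine (Finset.sum_le_card_nsmul _ _ (Fintype.card R) fun s hs => ?_).trans ?_
      · exact (not_le.1 (Finset.mem_filter.1 hs).2).le
      · exact Nat.mul_le_mul_right _ (Finset.card_filter_le _ _)
  have h3 : (G.card : ℝ) ≤ M * (q / (4 * (M + 1)) * F.card) := by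
    have hsub : G ⊆ (Finset.univ : Finset (R ↪ K)).biUnion
        fun u => F.filter fun s => ∀ ρ, (u ρ : Γ) * s ∈ J := by
      intro s hs
      obtain ⟨hsF, hsn⟩ := Finset.mem_filter.1 hs
      obtain ⟨e⟩ : Nonempty (R ↪ (K.filter fun k => k * s ∈ J : Finset Γ)) :=
        Function.Embedding.nonempty_of_card_le (by simpa [hn] using hsn)
      refine Finset.mem_biUnion.2 ⟨⟨fun ρ => ⟨e ρ, (Finset.mem_filter.1 (e ρ).2).1⟩,
        fun a b hab => e.injective (Subtype.ext (congrArg (fun x : K => (x : Γ)) hab))⟩,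
        Finset.mem_univ _, Finset.mem_filter.2 ⟨hsF, fun ρ => (Finset.mem_filter.1 (e ρ).2).2⟩⟩
    have h4 := (Finset.card_le_card hsub).trans Finset.card_biUnion_le
    refine (Nat.cast_le (α := ℝ).2 h4).trans ?_
    rw [Nat.cast_sum]
    refine (Finset.sum_le_card_nsmul _ _ _ fun u _ => (hcon u).le).trans ?_
    simp [hM]
  have h4 : (J.card : ℝ) ≤ G.card * K.card + F.card * Fintype.card R := by
    exact_mod_cast h1.trans h2
  have h5 : M * (q / (4 * (M + 1)) * F.card) ≤ q / 4 * F.card := by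
    have : (M : ℝ) / (M + 1) ≤ 1 := (div_le_one (by positivity)).2 (by linarith)
    calc M * (q / (4 * (M + 1)) * F.card) = (M / (M + 1) : ℝ) * (q / 4 * F.card) := by
          field_simp
      _ ≤ _ := mul_le_of_le_one_left (by positivity) this
  have hK0 : (0 : ℝ) < K.card := by
    have : (0 : ℝ) ≤ Fintype.card R := Nat.cast_nonneg _
    exact pos_of_mul_pos_right (this.trans_lt hK) (by positivity)
  have h6 : (G.card : ℝ) * K.card ≤ q / 4 * F.card * K.card :=
    mul_le_mul_of_nonneg_right (h3.trans h5) hK0.le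
  have h7 : (F.card : ℝ) * Fintype.card R < F.card * (q / 2 * K.card) :=
    mul_lt_mul_of_pos_left hK hF0
  have h8 : 0 < q * K.card * F.card := by positivity
  nlinarith

open scoped Pointwise in
open Classical in
theorem SeparatedPosDensity.exists_expansion {Γ X κ κ' R : Type*} [Group Γ] [Infinite Γ]
    [MulAction Γ X] [Fintype R] (r₀ : R) (p : κ' → R → κ)
    {𝓑 : Set (Γ × (κ → Set X))} (hfin : 𝓑.Finite) (h : SeparatedPosDensity 𝓑)
    (T : Finset Γ) :
    ∃ 𝓑' : Set (Γ × (κ' → Set X)), 𝓑'.Finite ∧ SeparatedPosDensity 𝓑' ∧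
      ∀ B' ∈ 𝓑', ∃ B ∈ 𝓑, ∃ v : R → Γ, (∀ ρ, ρ ≠ r₀ → v ρ ∉ T) ∧ v r₀ = 1 ∧
        B'.2 = fun j => ⋂ ρ, (fun x => v ρ • x) ⁻¹' B.2 (p j ρ) := by
  obtain ⟨q, hq, L, H⟩ := h
  obtain ⟨N, hN⟩ := exists_nat_gt ((Fintype.card R : ℝ) / (q / 2))
  rw [div_lt_iff₀' (by positivity)] at hN
  set T' : Finset Γ := hfin.toFinset.biUnion fun B => T.image fun a => B.1⁻¹ * a * B.1 with hT'
  obtain ⟨K, hKN, hK⟩ := exists_card_eq_quotientsAvoid (L ∪ T') N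
  rw [← hKN] at hN
  obtain ⟨q', hq', hdense⟩ := exists_embedding_dense hq K hN
  let v : Γ → (R ↪ K) → R → Γ := fun g u ρ => g * u ρ * (u r₀ : Γ)⁻¹ * g⁻¹
  refine ⟨Set.image2 (fun (B : Γ × (κ → Set X)) (u : R ↪ K) =>
    (B.1 * u r₀, fun j => ⋂ ρ, (fun x => v B.1 u ρ • x) ⁻¹' B.2 (p j ρ))) 𝓑 Set.univ,
    hfin.image2 _ Set.finite_univ, ?_, ?_⟩
  · refine ⟨q', hq', K⁻¹ * (L ∪ {1}) * K, fun F hF hFL => ?_⟩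
    have hkey : ∀ k ∈ K, ∀ k' ∈ K, ∀ f ∈ F, ∀ f' ∈ F, f ≠ f' →
        k * f * (k' * f')⁻¹ ∉ L ∪ {1} := by
      intro k hk k' hk' f hf f' hf' hne hmem
      refine hFL f hf f' hf' hne (Finset.mem_mul.2 ⟨_, Finset.mem_mul.2
        ⟨_, Finset.inv_mem_inv hk, _, hmem, rfl⟩, k', hk', by group⟩)
    have hinj : ∀ k ∈ K, ∀ k' ∈ K, ∀ f ∈ F, ∀ f' ∈ F, k * f = k' * f' → k = k' ∧ f = f' := by
      intro k hk k' hk' f hf f' hf' heq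
      have : f = f' := by
        by_contra hne
        exact hkey k hk k' hk' f hf f' hf' hne (by simp [heq])
      subst this
      exact ⟨mul_right_cancel heq, rfl⟩
    have hcard : (K * F).card = K.card * F.card := by
      rw [Finset.card_mul_iff]
      rintro ⟨k, f⟩ ⟨hk, hf⟩ ⟨k', f'⟩ ⟨hk', hf'⟩ heq
      obtain ⟨rfl, rfl⟩ := hinj k hk k' hk' f hf f' hf' heq
      rfl
    have hKne : K.Nonempty := by
      rw [Finset.nonempty_iff_ne_empty]
      rintro rfl
      have : (0 : ℝ) ≤ Fintype.card R := Nat.cast_nonneg _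
      simp at hN
      linarith
    obtain ⟨J, hJ, hJcard, B, hB, hind⟩ := H (K * F) (hKne.mul hF) (by
      intro a ha b hb hab
      obtain ⟨k, hk, f, hf, rfl⟩ := Finset.mem_mul.1 ha
      obtain ⟨k', hk', f', hf', rfl⟩ := Finset.mem_mul.1 hb
      by_cases hff : f = f'
      · subst hff
        have hkk : k ≠ k' := fun h => hab (h ▸ rfl)
        intro hmem
        refine hK k hk k' hk' hkk (Finset.mem_union_left _ ?_)
        convert hmem using 1
        group
      · exact fun hmem => hkey k hk k' hk' f hf f' hf' hff (Finset.mem_union_left _ hmem))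
    rw [hcard] at hJcard
    push_cast at hJcard
    obtain ⟨u, hu⟩ := hdense F J hF (fun a ha => Finset.mem_mul.1 (hJ ha)) hJcard
    refine ⟨_, Finset.filter_subset _ _, hu, _, ⟨B, hB, u, Set.mem_univ _, rfl⟩, fun ω => ?_⟩
    obtain ⟨x, hx⟩ := hind fun a =>
      if ha : ∃ ρ s, s ∈ F ∧ (u ρ : Γ) * s = a then p (ω ha.choose_spec.choose) ha.choose
      else p (ω 1) r₀
    refine ⟨x, fun s hs => Set.mem_iInter.2 fun ρ => ?_⟩
    obtain ⟨hsF, hsJ⟩ := Finset.mem_filter.1 hs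
    have ha : ∃ ρ' s', s' ∈ F ∧ (u ρ' : Γ) * s' = u ρ * s := ⟨ρ, s, hsF, rfl⟩
    have h1 := hx _ (hsJ ρ)
    rw [dif_pos ha] at h1
    obtain ⟨h2, h3⟩ := ha.choose_spec.choose_spec
    obtain ⟨h4, h5⟩ := hinj _ (u _).2 _ (u ρ).2 _ h2 _ hsF h3
    rw [h5, u.injective (Subtype.ext h4)] at h1
    simp only [Set.mem_preimage, smul_smul]
    convert h1 using 2
    simp only [v]
    group
  · rintro _ ⟨B, hB, u, -, rfl⟩
    refine ⟨B, hB, v B.1 u, fun ρ hρ hmem => ?_, by simp [v], rfl⟩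
    have hne : (u ρ : Γ) ≠ u r₀ := fun h => hρ (u.injective (Subtype.ext h))
    refine hK _ (u ρ).2 _ (u r₀).2 hne (Finset.mem_union_right _ ?_)
    refine Finset.mem_biUnion.2 ⟨B, hfin.mem_toFinset.2 hB, Finset.mem_image.2
      ⟨_, hmem, ?_⟩⟩
    simp only [v]
    group

open CategoryTheory in
/-- König's lemma for a sequence of finite nonempty types. -/
theorem exists_branch_of_finite {F : ℕ → Type*} [∀ n, Finite (F n)] [∀ n, Nonempty (F n)]
    (f : ∀ n, F (n + 1) → F n) : ∃ x : ∀ n, F n, ∀ n, f n (x (n + 1)) = x n := by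
  let G := Functor.ofOpSequence (X := F) fun n => ↾(f n)
  have h1 : ∀ j, Finite (G.obj j) := fun j => inferInstanceAs (Finite (F j.unop))
  have h2 : ∀ j, Nonempty (G.obj j) := fun j => inferInstanceAs (Nonempty (F j.unop))
  obtain ⟨x, hx⟩ := nonempty_sections_of_finite_inverse_system G
  refine ⟨fun n => x ⟨n⟩, fun n => ?_⟩
  have := hx (homOfLE (Nat.le_add_right n 1)).op
  rw [Functor.ofOpSequence_map_homOfLE_succ] at this
  exact this

/-- A finite family of tuples of pairwise disjoint nonempty closed sets which has positive
density. -/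
structure IsGoodFamily {Γ X κ : Type*} [Group Γ] [MulAction Γ X] [TopologicalSpace X]
    (𝓑 : Set (Γ × (κ → Set X))) : Prop where
  finite : 𝓑.Finite
  dens : SeparatedPosDensity 𝓑
  closed : ∀ B ∈ 𝓑, ∀ j, IsClosed (B.2 j)
  nonempty : ∀ B ∈ 𝓑, ∀ j, (B.2 j).Nonempty
  disjoint : ∀ B ∈ 𝓑, ∀ j₁ j₂, j₁ ≠ j₂ → Disjoint (B.2 j₁) (B.2 j₂)

/-- The tuple `B'` consists of sets of diameter at most `ε` inside those of `B`, and every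
self-map of the indices of `B` is implemented on `B'` by a group element outside `T`. -/
structure IsRefinement {Γ X κ κ' : Type*} [Group Γ] [MulAction Γ X] [MetricSpace X]
    (ε : ℝ) (T : Finset Γ) (par : κ' → κ) (B : κ → Set X) (B' : κ' → Set X) : Prop where
  subset : ∀ j, B' j ⊆ B (par j)
  dist_le : ∀ j, ∀ x ∈ B' j, ∀ y ∈ B' j, dist x y ≤ ε
  move : ∀ φ : κ → κ, ∃ s : Γ, s ∉ T ∧ ∀ j, ∀ z ∈ B' j, s • z ∈ B (φ (par j))

open Classical in
theorem IsGoodFamily.exists_refinement {Γ X κ κ' : Type*} [Group Γ] [Infinite Γ]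
    [MetricSpace X] [CompactSpace X] [MulAction Γ X] [ContinuousConstSMul Γ X]
    [Fintype κ] [Nontrivial κ] (par : κ' → κ) (bit : κ' → Bool)
    (hinj : ∀ j₁ j₂, par j₁ = par j₂ → bit j₁ = bit j₂ → j₁ = j₂)
    {𝓑 : Set (Γ × (κ → Set X))} (h : IsGoodFamily 𝓑) {ε : ℝ} (hε : 0 < ε) (T : Finset Γ) :
    ∃ 𝓑' : Set (Γ × (κ' → Set X)), IsGoodFamily 𝓑' ∧
      ∀ B' ∈ 𝓑', ∃ B ∈ 𝓑, IsRefinement ε T par B.2 B'.2 := by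
  obtain ⟨a, b, hab⟩ := exists_pair_ne κ
  obtain ⟨𝓒, hCfin, hC, hCB⟩ := h.dens.exists_small_pieces h.finite hε
  let p : κ' → Option (Option (κ → κ)) → κ := fun j ρ => match ρ with
    | none => par j
    | some none => if bit j then a else b
    | some (some φ) => φ (par j)
  obtain ⟨𝓓, hDfin, hD, hDC⟩ := hC.exists_expansion none p hCfin T
  have hkey : ∀ B' ∈ 𝓓, ∃ B ∈ 𝓑, IsRefinement ε T par B.2 B'.2 ∧ (∀ j, IsClosed (B'.2 j)) ∧
      ∀ j₁ j₂, j₁ ≠ j₂ → Disjoint (B'.2 j₁) (B'.2 j₂) := by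
    intro B' hB'
    obtain ⟨B₁, hB₁, v, hvT, hv1, hB'v⟩ := hDC B' hB'
    obtain ⟨B, hB, C, hCC, hB₁C⟩ := hCB B₁ hB₁
    have hmem : ∀ j, ∀ z ∈ B'.2 j, ∀ ρ, v ρ • z ∈ B.2 (p j ρ) ∧ v ρ • z ∈ C (p j ρ) := by
      intro j z hz ρ
      rw [hB'v] at hz
      have := Set.mem_iInter.1 hz ρ
      rwa [hB₁C] at this
    have hsub : ∀ j, ∀ z ∈ B'.2 j, z ∈ B.2 (par j) ∧ z ∈ C (par j) := by
      intro j z hz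
      have := hmem j z hz none
      rwa [hv1, one_smul] at this
    refine ⟨B, hB, ⟨fun j z hz => (hsub j z hz).1, fun j x hx y hy => ?_, fun φ => ?_⟩,
      fun j => ?_, fun j₁ j₂ hj => ?_⟩
    · exact (hCC _).2 x (hsub j x hx).2 y (hsub j y hy).2
    · exact ⟨v (some (some φ)), hvT _ (by simp), fun j z hz => (hmem j z hz (some (some φ))).1⟩
    · rw [hB'v]
      refine isClosed_iInter fun ρ => IsClosed.preimage (continuous_const_smul _) ?_
      rw [hB₁C]
      exact (h.closed B hB _).inter (hCC _).1
    · rw [Set.disjoint_left]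
      intro z hz₁ hz₂
      by_cases hp : par j₁ = par j₂
      · have hbit : bit j₁ ≠ bit j₂ := fun hb => hj (hinj _ _ hp hb)
        have hp' : p j₁ (some none) ≠ p j₂ (some none) := by
          simp only [p]
          cases h₁ : bit j₁ <;> cases h₂ : bit j₂ <;> simp_all [hab.symm]
        exact Set.disjoint_left.1 (h.disjoint B hB _ _ hp')
          (hmem j₁ z hz₁ (some none)).1 (hmem j₂ z hz₂ (some none)).1
      · exact Set.disjoint_left.1 (h.disjoint B hB _ _ hp) (hsub j₁ z hz₁).1 (hsub j₂ z hz₂).1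
  refine ⟨{B ∈ 𝓓 | ∀ j, (B.2 j).Nonempty}, ⟨hDfin.subset (Set.sep_subset _ _), hD.sep_nonempty,
    fun B hB => ?_, fun B hB => hB.2, fun B hB => ?_⟩, fun B hB => ?_⟩
  · obtain ⟨-, -, -, hc, -⟩ := hkey B hB.1
    exact hc
  · obtain ⟨-, -, -, -, hd⟩ := hkey B hB.1
    exact hd
  · obtain ⟨B₁, h₁, h₂, -⟩ := hkey B hB.1
    exact ⟨B₁, h₁, h₂⟩

/-- An infinite sequence of successive refinements starting from a good family. -/
theorem IsGoodFamily.exists_scheme {Γ X : Type*} [Group Γ] [Countable Γ] [Infinite Γ]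
    [MetricSpace X] [CompactSpace X] [MulAction Γ X] [ContinuousConstSMul Γ X]
    {𝓑 : Set (Γ × ((Fin 1 → Bool) → Set X))} (h : IsGoodFamily 𝓑)
    (T : ℕ → Finset Γ) (ε : ℕ → ℝ) (hε : ∀ n, 0 < ε n) :
    ∃ B : ∀ n, (Fin (n + 1) → Bool) → Set X, (∃ C ∈ 𝓑, B 0 = C.2) ∧
      (∀ n j, IsClosed (B n j)) ∧ (∀ n j, (B n j).Nonempty) ∧
      (∀ n j₁ j₂, j₁ ≠ j₂ → Disjoint (B n j₁) (B n j₂)) ∧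
      ∀ n, IsRefinement (ε n) (T n) (fun j : Fin (n + 2) → Bool => fun i => j i.castSucc)
        (B n) (B (n + 1)) := by
  have hstep : ∀ n (𝓒 : {𝓒 : Set (Γ × ((Fin (n + 1) → Bool) → Set X)) // IsGoodFamily 𝓒}),
      ∃ 𝓓 : {𝓓 : Set (Γ × ((Fin (n + 1 + 1) → Bool) → Set X)) // IsGoodFamily 𝓓},
        ∀ B' ∈ 𝓓.1, ∃ B ∈ 𝓒.1, IsRefinement (ε n) (T n)
          (fun j : Fin (n + 2) → Bool => fun i => j i.castSucc) B.2 B'.2 := by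
    intro n 𝓒
    obtain ⟨𝓓, h₁, h₂⟩ := 𝓒.2.exists_refinement
      (fun j : Fin (n + 2) → Bool => fun i => j i.castSucc) (fun j => j (Fin.last _))
      (fun j₁ j₂ hp hb => funext fun i => Fin.lastCases hb (fun i => congrFun hp i) i) (hε n) (T n)
    exact ⟨⟨𝓓, h₁⟩, h₂⟩
  choose next hnext using hstep
  let fam : ∀ n, {𝓒 : Set (Γ × ((Fin (n + 1) → Bool) → Set X)) // IsGoodFamily 𝓒} :=
    fun n => Nat.rec ⟨𝓑, h⟩ next n
  have hpar : ∀ n (B' : (fam (n + 1)).1), ∃ B : (fam n).1, IsRefinement (ε n) (T n)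
      (fun j : Fin (n + 2) → Bool => fun i => j i.castSucc) B.1.2 B'.1.2 := by
    intro n B'
    obtain ⟨B, hB, hr⟩ := hnext n (fam n) B'.1 B'.2
    exact ⟨⟨B, hB⟩, hr⟩
  choose f hf using hpar
  have hfin : ∀ n, Finite (fam n).1 := fun n => (fam n).2.finite.to_subtype
  have hne : ∀ n, Nonempty (fam n).1 := fun n => by
    obtain ⟨B, hB, -⟩ := (fam n).2.dens.exists_nonempty
    exact ⟨⟨B, hB⟩⟩
  obtain ⟨x, hx⟩ := exists_branch_of_finite (F := fun n => (fam n).1) f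
  refine ⟨fun n => (x n).1.2, ⟨_, (x 0).2, rfl⟩, fun n => (fam n).2.closed _ (x n).2,
    fun n => (fam n).2.nonempty _ (x n).2, fun n => (fam n).2.disjoint _ (x n).2, fun n => ?_⟩
  have := hf n (x (n + 1))
  rwa [hx n] at this

/-- The liminf of a nonnegative function is zero if it takes arbitrarily small values
frequently. -/
theorem liminf_nnreal_eq_zero {α : Type*} {l : Filter α} {u : α → NNReal}
    (h : ∀ ε : ℝ, 0 < ε → ∃ᶠ a in l, (u a : ℝ) < ε) : Filter.liminf u l = 0 := by
  rw [Filter.liminf_eq]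
  refine le_antisymm (csSup_le' fun a ha => ?_) zero_le
  by_contra! hpos
  obtain ⟨b, hb, hab⟩ := ((h a (by exact_mod_cast hpos)).and_eventually ha).exists
  exact absurd hab (not_le.2 (by exact_mod_cast hb))

theorem exists_cantor_of_scheme {Γ X : Type*} [Group Γ]
    [MetricSpace X] [CompactSpace X] [MulAction Γ X]
    (T : ℕ → Finset Γ) (hT : ∀ F : Finset Γ, ∀ᶠ n in Filter.atTop, F ⊆ T n)
    (B : ∀ n, (Fin (n + 1) → Bool) → Set X) (hclosed : ∀ n j, IsClosed (B n j))
    (hne : ∀ n j, (B n j).Nonempty)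
    (hdisj : ∀ n j₁ j₂, j₁ ≠ j₂ → Disjoint (B n j₁) (B n j₂))
    (hB : ∀ n : ℕ, IsRefinement (1 / (n + 1 : ℝ)) (T n)
      (fun j : Fin (n + 2) → Bool => fun i => j i.castSucc) (B n) (B (n + 1))) :
    ∃ Z : Set X, Z ⊆ (⋃ j, B 0 j) ∧
      Z.Nonempty ∧ IsCompact Z ∧ Perfect Z ∧ IsTotallyDisconnected Z ∧
      ∀ Y : Finset X, (Y : Set X) ⊆ Z → ∀ f : X → X, (∀ y ∈ Y, f y ∈ Z) →
        Filter.liminf (fun s : Γ => Y.sup fun y => nndist (s • y) (f y))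
          Filter.cofinite = 0 := by
  have hpt : ∀ a : ℕ → Bool, (⋂ n, B n fun i => a i).Nonempty := fun a =>
    IsCompact.nonempty_iInter_of_sequence_nonempty_isCompact_isClosed _
      (fun n => (hB n).subset fun i => a i) (fun n => hne n _) (hclosed 0 _).isCompact
      fun n => hclosed n _
  choose g hg using hpt
  replace hg : ∀ a n, g a ∈ B n fun i => a i := fun a n => Set.mem_iInter.1 (hg a) n
  have hdist : ∀ (n : ℕ) (j : Fin (n + 1 + 1) → Bool), ∀ x ∈ B (n + 1) j, ∀ y ∈ B (n + 1) j,
      dist x y ≤ 1 / (n + 1 : ℝ) := fun n => (hB n).dist_le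
  have hclose : ∀ (n : ℕ) (a b : ℕ → Bool), (∀ i < n + 2, a i = b i) →
      dist (g a) (g b) ≤ 1 / (n + 1 : ℝ) := by
    intro n a b hab
    refine hdist n _ _ (hg a (n + 1)) _ ?_
    have : (fun i : Fin (n + 1 + 1) => a i) = fun i : Fin (n + 1 + 1) => b i :=
      funext fun i => hab i i.2
    rw [this]
    exact hg b (n + 1)
  have hginj : Function.Injective g := by
    intro a b hab
    funext n
    by_contra hne'
    refine Set.disjoint_left.1 (hdisj n (fun i => a i) (fun i => b i) fun h => hne' ?_)
      (hg a n) (hab ▸ hg b n)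
    simpa using congrFun h (Fin.last n)
  have hagree : ∀ (a : ℕ → Bool) (n : ℕ), ∀ᶠ b in nhds a, ∀ i < n, b i = a i := by
    intro a n
    refine (Filter.eventually_all_finite (Set.finite_Iio n)).2 fun i _ => ?_
    exact (continuous_apply i).continuousAt.preimage_mem_nhds
      (mem_nhds_discrete.2 (Set.mem_singleton (a i)))
  have hgcont : Continuous g := by
    rw [continuous_iff_continuousAt]
    intro a
    rw [ContinuousAt, Metric.tendsto_nhds]
    intro ε hε
    obtain ⟨n, hn⟩ := exists_nat_one_div_lt hε
    filter_upwards [hagree a (n + 2)] with b hb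
    exact (hclose n b a hb).trans_lt hn
  have hemb := hgcont.isClosedEmbedding hginj
  refine ⟨Set.range g, ?_, Set.range_nonempty g, isCompact_range hgcont, ⟨hemb.isClosed_range, ?_⟩,
    hemb.isEmbedding.isTotallyDisconnected_range.2 inferInstance, fun Y hY f hf => ?_⟩
  · rintro _ ⟨a, rfl⟩
    exact Set.mem_iUnion.2 ⟨_, hg a 0⟩
  · rw [preperfect_iff_nhds]
    rintro _ ⟨a, rfl⟩ U hU
    obtain ⟨ε, hε, hball⟩ := Metric.mem_nhds_iff.1 hU
    obtain ⟨n, hn⟩ := exists_nat_one_div_lt hε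
    refine ⟨g (Function.update a (n + 2) (!a (n + 2))), ⟨hball ?_, Set.mem_range_self _⟩, ?_⟩
    · refine (hclose n _ _ fun i hi => ?_).trans_lt hn
      rw [Function.update_of_ne hi.ne]
    · intro h
      simpa using congrFun (hginj h) (n + 2)
  · refine liminf_nnreal_eq_zero fun ε hε => ?_
    have hcode : ∀ y ∈ Y, ∃ a, g a = y := fun y hy => hY hy
    have hcode' : ∀ y ∈ Y, ∃ a, g a = f y := fun y hy => hf y hy
    choose! c hc using hcode
    choose! d hd using hcode'
    have hsep : ∀ᶠ n : ℕ in Filter.atTop, ∀ y ∈ Y, ∀ y' ∈ Y,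
        (∀ i < n + 1, c y i = c y' i) → y = y' := by
      rw [Filter.eventually_all_finset]
      intro y hy
      rw [Filter.eventually_all_finset]
      intro y' hy'
      by_cases hyy : y = y'
      · exact Filter.Eventually.of_forall fun _ _ => hyy
      · have : c y ≠ c y' := fun h => hyy (by rw [← hc y hy, ← hc y' hy', h])
        obtain ⟨m, hm⟩ := Function.ne_iff.1 this
        filter_upwards [Filter.eventually_ge_atTop m] with n hn h
        exact absurd (h m (by omega)) hm
    rw [Filter.frequently_cofinite_iff_infinite]
    intro hfin
    obtain ⟨m, hm⟩ := exists_nat_one_div_lt hε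
    obtain ⟨n, hTn, hsepn, hn⟩ := ((hT hfin.toFinset).and
      (hsep.and (Filter.eventually_ge_atTop (m + 1)))).exists
    obtain ⟨n, rfl⟩ : ∃ k, n = k + 1 := ⟨n - 1, by omega⟩
    classical
    let φ : (Fin (n + 1 + 1) → Bool) → Fin (n + 1 + 1) → Bool := fun j =>
      if h : ∃ y ∈ Y, (fun i : Fin (n + 1 + 1) => c y i) = j then fun i => d h.choose i else j
    have hφ : ∀ y ∈ Y, φ (fun i : Fin (n + 1 + 1) => c y i) = fun i : Fin (n + 1 + 1) => d y i := by
      intro y hy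
      have h : ∃ y' ∈ Y, (fun i : Fin (n + 1 + 1) => c y' i) =
          fun i : Fin (n + 1 + 1) => c y i := ⟨y, hy, rfl⟩
      have : h.choose = y := hsepn _ h.choose_spec.1 _ hy fun i hi =>
        congrFun h.choose_spec.2 ⟨i, hi⟩
      simp only [φ]
      rw [dif_pos h, this]
    obtain ⟨s, hs, hmove⟩ := (hB (n + 1)).move φ
    refine hs (hTn (hfin.mem_toFinset.2 ?_))
    change ((Y.sup fun y => nndist (s • y) (f y) : NNReal) : ℝ) < ε
    have hle : (Y.sup fun y => nndist (s • y) (f y)) ≤ Real.toNNReal (1 / (n + 1 : ℝ)) := by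
      refine Finset.sup_le fun y hy => ?_
      rw [← NNReal.coe_le_coe, coe_nndist, Real.coe_toNNReal _ (by positivity)]
      have h1 := hmove _ _ (hg (c y) (n + 1 + 1))
      simp only [Fin.val_castSucc] at h1
      rw [hφ y hy, hc y hy] at h1
      exact hdist n _ _ h1 _ (hd y hy ▸ hg (d y) (n + 1))
    refine lt_of_le_of_lt ?_ hm
    have h2 := NNReal.coe_le_coe.2 hle
    rw [Real.coe_toNNReal _ (by positivity)] at h2
    refine h2.trans (one_div_le_one_div_of_le (by positivity) ?_)
    have : (m : ℝ) ≤ n := by exact_mod_cast (by omega : m ≤ n)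
    linarith

/-- Let a countably infinite group `Γ` act by homeomorphisms on a compact metrizable
space `X` with compatible metric `ρ` (the `MetricSpace` structure), and let
`(A i)_{i : ι}` be a finite pairwise disjoint closed family of tuples of subsets of `X`,
each tuple of length at least 2, with positive independence density. Then there are a
tuple `A i` of the family and a Cantor set `Z` (a nonempty compact perfect totally
disconnected set) contained in the union of the entries of `A i` such that for every
finite `Y ⊆ Z` and every map `f : Y → Z` one has
`liminf_{Γ ∋ s → ∞} max_{y ∈ Y} ρ(sy, f(y)) = 0` along the cofinite filter on `Γ`. -/
theorem pos_indep_density_gives_chaotic_cantor_set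
    {Γ : Type*} [Group Γ] [Countable Γ] [Infinite Γ]
    {X : Type*} [MetricSpace X] [CompactSpace X]
    [MulAction Γ X] [ContinuousConstSMul Γ X]
    {ι : Type} [Fintype ι] (k : ι → ℕ) (hk : ∀ i, 2 ≤ k i)
    (A : ∀ i, Fin (k i) → Set X)
    (hdisj : ∀ i, ∀ j₁ j₂, j₁ ≠ j₂ → Disjoint (A i j₁) (A i j₂))
    (hclosed : ∀ i j, IsClosed (A i j))
    (h : HasPosIndepDensity Γ A) :
    ∃ (i : ι) (Z : Set X), Z ⊆ (⋃ j, A i j) ∧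
      Z.Nonempty ∧ IsCompact Z ∧ Perfect Z ∧ IsTotallyDisconnected Z ∧
      ∀ Y : Finset X, (Y : Set X) ⊆ Z → ∀ f : X → X, (∀ y ∈ Y, f y ∈ Z) →
        Filter.liminf (fun s : Γ => Y.sup fun y => nndist (s • y) (f y))
          Filter.cofinite = 0 := by
  classical
  let e : ∀ i, (Fin 1 → Bool) → Fin (k i) := fun i b =>
    if b 0 then ⟨0, by have := hk i; omega⟩ else ⟨1, by have := hk i; omega⟩
  have he : ∀ i b₁ b₂, b₁ ≠ b₂ → e i b₁ ≠ e i b₂ := by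
    intro i b₁ b₂ hb
    have h0 : b₁ 0 ≠ b₂ 0 := fun h0 => hb (funext fun j => by rw [Subsingleton.elim j 0, h0])
    simp only [e]
    cases h₁ : b₁ 0 <;> cases h₂ : b₂ 0 <;> simp_all
  let 𝓐 : Set (Γ × ((Fin 1 → Bool) → Set X)) := Set.range fun i => (1, fun b => A i (e i b))
  have hdens : SeparatedPosDensity 𝓐 := by
    obtain ⟨q, hq, H⟩ := h
    refine ⟨q, hq, ∅, fun F hF _ => ?_⟩
    obtain ⟨J, hJF, hJ, i, hind⟩ := H F hF
    refine ⟨J, hJF, hJ, _, ⟨i, rfl⟩, fun ω => ?_⟩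
    have hJne : J.Nonempty := by
      have := hF.card_pos
      rw [← Finset.card_pos, ← Nat.cast_pos (α := ℝ)]
      exact lt_of_lt_of_le (by positivity) hJ
    obtain ⟨x, hx⟩ := hind J subset_rfl hJne fun s => e i (ω s)
    refine ⟨x, fun s hs => ?_⟩
    rw [one_mul]
    exact Set.mem_iInter₂.1 hx s hs
  have hgood : IsGoodFamily {B ∈ 𝓐 | ∀ j, (B.2 j).Nonempty} := by
    refine ⟨(Set.finite_range _).subset (Set.sep_subset _ _), hdens.sep_nonempty, ?_,
      fun B hB => hB.2, ?_⟩
    · rintro _ ⟨⟨i, rfl⟩, -⟩ j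
      exact hclosed i _
    · rintro _ ⟨⟨i, rfl⟩, -⟩ j₁ j₂ hj
      exact hdisj i _ _ (he i _ _ hj)
  obtain ⟨ν, hν⟩ := exists_injective_nat Γ
  let T : ℕ → Finset Γ := fun n => ((Set.finite_Iio n).preimage hν.injOn).toFinset
  have hT : ∀ F : Finset Γ, ∀ᶠ n in Filter.atTop, F ⊆ T n := by
    intro F
    have : ∀ᶠ n in Filter.atTop, ∀ s ∈ F, ν s < n :=
      (Filter.eventually_all_finset F).2 fun s _ => Filter.eventually_gt_atTop (ν s)
    filter_upwards [this] with n hn s hs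
    simpa [T] using hn s hs
  obtain ⟨B, ⟨C, hC, hBC⟩, h1, h2, h3, h4⟩ :=
    hgood.exists_scheme T (fun n => 1 / (n + 1 : ℝ)) fun n => by positivity
  obtain ⟨Z, hZ, hrest⟩ := exists_cantor_of_scheme T hT B h1 h2 h3 h4
  obtain ⟨⟨i, rfl⟩, -⟩ := hC
  refine ⟨i, Z, hZ.trans (Set.iUnion_subset fun j => ?_), hrest⟩
  rw [hBC]
  exact Set.subset_iUnion (A i) (e i j)
end

section
/- Let Γ be a countably infinite discrete group acting on a compact metrizable space X by homeomorphisms, and let 𝒜 be a finite family of tuples of subsets of X with positive independence density. Then at least one element of 𝒜 has an infinite independence set. -/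
open scoped Pointwise in
/-- Right translates of independence sets are independence sets. -/
theorem IsIndepSet.of_mul_singleton {Γ : Type*} [Group Γ] {X : Type*} [MulAction Γ X]
    {ι : Type*} {A : ι → Set X} {J : Set Γ} {c : Γ} (h : IsIndepSet A (J * {c})) :
    IsIndepSet A J := by
  classical
  intro F hF hne ω
  obtain ⟨x, hx⟩ := h (F.image (· * c))
    (by
      intro s hs
      simp only [Finset.coe_image, Set.mem_image, Finset.mem_coe] at hs
      obtain ⟨t, ht, rfl⟩ := hs
      exact Set.mul_mem_mul (hF ht) rfl)
    (hne.image _) (fun s => ω (s * c⁻¹))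
  refine ⟨c • x, ?_⟩
  simp only [Set.mem_iInter, Set.mem_preimage] at hx ⊢
  intro s hs
  simpa [mul_smul] using hx (s * c) (Finset.mem_image_of_mem _ hs)

theorem IsIndepSet.mono {Γ : Type*} [Group Γ] {X : Type*} [MulAction Γ X]
    {ι : Type*} {A : ι → Set X} {J K : Set Γ} (h : IsIndepSet A K) (hJK : J ⊆ K) :
    IsIndepSet A J :=
  fun F hF => h F (hF.trans hJK)

/-- Every nonempty finite set has a subset satisfying `Q` of at least a fixed positive
proportion. -/
def HasPosDensity {Γ : Type*} (Q : Finset Γ → Prop) : Prop :=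
  ∃ q : ℝ, 0 < q ∧ ∀ F : Finset Γ, F.Nonempty →
    ∃ J : Finset Γ, J ⊆ F ∧ q * (F.card : ℝ) ≤ (J.card : ℝ) ∧ Q J

open scoped Pointwise in
/-- A finite set `F` contains a proportionally large subset whose left translates by
elements of `G` have no coincidences. -/
theorem exists_subset_card_mul_eq {Γ : Type*} [Group Γ] [DecidableEq Γ] (G F : Finset Γ) :
    ∃ E ⊆ F, (G * E).card = G.card * E.card ∧
      (G.Nonempty → F.card ≤ G.card * G.card * E.card) := by
  classical
  have hne : (F.powerset.filter fun E : Finset Γ =>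
      Set.InjOn (fun p : Γ × Γ => p.1 * p.2) ((G : Set Γ) ×ˢ (E : Set Γ))).Nonempty :=
    ⟨∅, by simp⟩
  obtain ⟨E, hE, hmax⟩ := Finset.exists_max_image _ Finset.card hne
  simp only [Finset.mem_filter, Finset.mem_powerset] at hE hmax
  obtain ⟨hEF, hinj⟩ := hE
  refine ⟨E, hEF, Finset.card_mul_iff.2 hinj, fun hG => ?_⟩
  have hcover : F ⊆ G⁻¹ * G * E := by
    intro f hf
    by_contra hfE
    have key : ∀ a ∈ G, ∀ b ∈ G, ∀ e ∈ E, a * f ≠ b * e := by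
      intro a ha b hb e he hab
      refine hfE ?_
      have : f = a⁻¹ * b * e := by rw [mul_assoc, ← hab]; simp
      rw [this]
      exact Finset.mul_mem_mul (Finset.mul_mem_mul (Finset.inv_mem_inv ha) hb) he
    have hfE' : f ∉ E := by
      intro hf'
      obtain ⟨g, hg⟩ := hG
      exact key g hg g hg f hf' rfl
    have := hmax (insert f E) ⟨Finset.insert_subset hf hEF, by
      rintro ⟨a, x⟩ ⟨ha, hx⟩ ⟨b, y⟩ ⟨hb, hy⟩ hab
      simp only [Finset.coe_insert, Set.mem_insert_iff, Finset.mem_coe] at ha hb hx hy hab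
      rcases hx with rfl | hx <;> rcases hy with rfl | hy
      · simpa using hab
      · exact absurd hab (key a ha b hb y hy)
      · exact absurd hab.symm (key b hb a ha x hx)
      · exact hinj ⟨ha, hx⟩ ⟨hb, hy⟩ hab⟩
    rw [Finset.card_insert_of_notMem hfE'] at this
    omega
  calc F.card ≤ (G⁻¹ * G * E).card := Finset.card_le_card hcover
    _ ≤ (G⁻¹ * G).card * E.card := Finset.card_mul_le
    _ ≤ (G⁻¹.card * G.card) * E.card := Nat.mul_le_mul_right _ Finset.card_mul_le
    _ = G.card * G.card * E.card := by rw [Finset.card_inv]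

open scoped Pointwise in
/-- If `Q` has positive density then so has the property that `Q` holds for the product
with some set of size at least `n` taken from a suitable finite set `G`. -/
theorem HasPosDensity.exists_mul {Γ : Type*} [Group Γ] [Infinite Γ] [DecidableEq Γ]
    {Q : Finset Γ → Prop} (hQ : HasPosDensity Q) (hmono : ∀ J K, J ⊆ K → Q K → Q J)
    (n : ℕ) :
    ∃ G : Finset Γ, HasPosDensity fun J => ∃ P ⊆ G, n ≤ P.card ∧ Q (P * J) := by
  obtain ⟨q, hq, h⟩ := hQ
  obtain ⟨N, hN⟩ := exists_nat_gt (2 * n / q)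
  obtain ⟨G, hG⟩ := Infinite.exists_subset_card_eq Γ N
  have hN0 : (0 : ℝ) < N := lt_of_le_of_lt (by positivity) hN
  have hGne : G.Nonempty := by
    rw [← Finset.card_pos, hG]; exact_mod_cast hN0
  refine ⟨G, q / 2 / (N * N) / 2 ^ N, by positivity, fun F hF => ?_⟩
  obtain ⟨E, hEF, hGE, hFE⟩ := exists_subset_card_mul_eq G F
  have hFE := hFE hGne
  have hE : E.Nonempty := by
    rw [Finset.nonempty_iff_ne_empty]
    rintro rfl
    simp only [Finset.card_empty, mul_zero, nonpos_iff_eq_zero, Finset.card_eq_zero] at hFE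
    exact hF.ne_empty hFE
  obtain ⟨J, hJ, hJcard, hQJ⟩ := h (G * E) (hGne.mul hE)
  let R : Γ → Finset Γ := fun f => G.filter fun g => g * f ∈ J
  let E' : Finset Γ := E.filter fun f => n ≤ (R f).card
  have hJle : J.card ≤ ∑ f ∈ E, (R f).card := by
    have : J ⊆ E.biUnion fun f => (R f).image (· * f) := by
      intro x hx
      obtain ⟨g, hg, f, hf, rfl⟩ := Finset.mem_mul.1 (hJ hx)
      simp only [Finset.mem_biUnion, Finset.mem_image]
      exact ⟨f, hf, g, Finset.mem_filter.2 ⟨hg, hx⟩, rfl⟩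
    exact (Finset.card_le_card this).trans
      (Finset.card_biUnion_le.trans (Finset.sum_le_sum fun f _ => Finset.card_image_le))
  have hsum : ∑ f ∈ E, (R f).card ≤ N * E'.card + n * E.card := by
    calc ∑ f ∈ E, (R f).card
        ≤ ∑ f ∈ E, ((if n ≤ (R f).card then N else 0) + n) := by
          refine Finset.sum_le_sum fun f _ => ?_
          have : (R f).card ≤ N := hG ▸ Finset.card_filter_le _ _
          split_ifs <;> omega
      _ = N * E'.card + n * E.card := by
          rw [Finset.sum_add_distrib, ← Finset.sum_filter, Finset.sum_const, Finset.sum_const]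
          simp only [smul_eq_mul, E']
          ring
  have hE' : q / 2 * E.card ≤ E'.card := by
    have h1 : q * (N * E.card) ≤ N * E'.card + n * E.card := by
      rw [hGE, hG] at hJcard
      push_cast at hJcard
      exact hJcard.trans (by exact_mod_cast hJle.trans hsum)
    have h2 : (n : ℝ) ≤ q / 2 * N := by
      rw [div_lt_iff₀ hq] at hN
      linarith
    have h3 : (n : ℝ) * E.card ≤ q / 2 * N * E.card := by gcongr
    refine le_of_mul_le_mul_left ?_ hN0
    linarith
  have hE'ne : E'.Nonempty := by
    have : (0 : ℝ) < E.card := by exact_mod_cast hE.card_pos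
    rw [← Finset.card_pos]
    have h0 : (0 : ℝ) < E'.card := lt_of_lt_of_le (by positivity) hE'
    exact_mod_cast h0
  obtain ⟨P, hP, hPcard⟩ := Finset.exists_le_card_fiber_of_nsmul_le_card_of_maps_to
    (s := E') (t := G.powerset) (f := R) (b := (E'.card : ℝ) / 2 ^ N)
    (fun f _ => Finset.mem_powerset.2 (Finset.filter_subset _ _)) ⟨∅, by simp⟩
    (by
      rw [Finset.card_powerset, hG, nsmul_eq_mul]
      push_cast
      rw [mul_div_cancel₀]
      positivity)
  refine ⟨E'.filter fun f => R f = P, (Finset.filter_subset _ _).trans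
    ((Finset.filter_subset _ _).trans hEF), ?_, P, Finset.mem_powerset.1 hP, ?_, ?_⟩
  · refine le_trans ?_ hPcard
    have hF' : (F.card : ℝ) ≤ N * N * E.card := by
      rw [hG] at hFE
      exact_mod_cast hFE
    rw [div_mul_eq_mul_div]
    gcongr
    refine le_trans ?_ hE'
    calc q / 2 / (N * N) * F.card ≤ q / 2 / (N * N) * (N * N * E.card) := by gcongr
      _ = q / 2 * E.card := by field_simp
  · have h0 : (0 : ℝ) < (E'.filter fun f => R f = P).card := by
      refine lt_of_lt_of_le ?_ hPcard
      have : (0 : ℝ) < E'.card := by exact_mod_cast hE'ne.card_pos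
      positivity
    obtain ⟨f, hf⟩ := Finset.card_pos.1 (by exact_mod_cast h0)
    obtain ⟨hfE', rfl⟩ := Finset.mem_filter.1 hf
    exact (Finset.mem_filter.1 hfE').2
  · refine hmono _ _ ?_ hQJ
    intro x hx
    obtain ⟨g, hg, f, hf, rfl⟩ := Finset.mem_mul.1 hx
    obtain ⟨-, rfl⟩ := Finset.mem_filter.1 hf
    exact (Finset.mem_filter.1 hg).2

open scoped Pointwise in
/-- A finite family of finite sets `T`, each with a translating element `c`, can be replaced
by a family of larger sets, each containing a member of the first family, so that the
property of `J` that some `T * {c} * J` satisfies `Q` keeps positive density. -/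
theorem HasPosDensity.exists_extension {Γ : Type*} [Group Γ] [Infinite Γ] [DecidableEq Γ]
    {Q : Finset Γ → Prop} (hmono : ∀ J K, J ⊆ K → Q K → Q J)
    (𝒯 : Finset (Finset Γ × Γ)) (hne : ∀ x ∈ 𝒯, x.1.Nonempty)
    (h𝒯 : HasPosDensity fun J => ∃ x ∈ 𝒯, Q (x.1 * {x.2} * J)) (n : ℕ) :
    ∃ 𝒯' : Finset (Finset Γ × Γ),
      (HasPosDensity fun J => ∃ x ∈ 𝒯', Q (x.1 * {x.2} * J)) ∧
      ∀ y ∈ 𝒯', n ≤ y.1.card ∧ ∃ x ∈ 𝒯, x.1 ⊆ y.1 := by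
  obtain ⟨G, q, hq, hG⟩ := h𝒯.exists_mul
    (fun J K hJK ⟨x, hx, hxK⟩ =>
      ⟨x, hx, hmono _ _ (Finset.mul_subset_mul_left hJK) hxK⟩) (n + 1)
  refine ⟨((𝒯 ×ˢ G.powerset ×ˢ G).image fun z =>
      (z.1.1 * {z.1.2} * z.2.1 * {(z.1.2 * z.2.2)⁻¹}, z.1.2 * z.2.2)).filter
      fun y => n ≤ y.1.card ∧ ∃ x ∈ 𝒯, x.1 ⊆ y.1, ⟨q, hq, fun F hF => ?_⟩,
    fun y hy => (Finset.mem_filter.1 hy).2⟩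
  obtain ⟨J, hJF, hJ, P, hPG, hP, x, hx, hQ⟩ := hG F hF
  obtain ⟨p, hp⟩ : P.Nonempty := Finset.card_pos.1 (by omega)
  refine ⟨J, hJF, hJ, (x.1 * {x.2} * P * {(x.2 * p)⁻¹}, x.2 * p), ?_, ?_⟩
  · refine Finset.mem_filter.2 ⟨Finset.mem_image.2 ⟨(x, P, p), ?_, rfl⟩, ?_, x, hx, ?_⟩
    · simp [hx, hPG, hPG hp]
    · have h1 : P.card ≤ (x.1 * {x.2} * P).card :=
        Finset.card_le_card_mul_left ((hne x hx).mul (Finset.singleton_nonempty _))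
      have h2 : (x.1 * {x.2} * P).card ≤ (x.1 * {x.2} * P * {(x.2 * p)⁻¹}).card :=
        Finset.card_le_card_mul_right (Finset.singleton_nonempty _)
      dsimp only
      omega
    · intro t ht
      have : t = t * x.2 * p * (x.2 * p)⁻¹ := by group
      rw [this]
      exact Finset.mul_mem_mul (Finset.mul_mem_mul (Finset.mul_mem_mul ht
        (Finset.mem_singleton_self _)) hp) (Finset.mem_singleton_self _)
  · have : x.1 * {x.2} * P * {(x.2 * p)⁻¹} * {x.2 * p} * J = x.1 * {x.2} * (P * J) := by
      rw [mul_assoc _ {(x.2 * p)⁻¹}, Finset.singleton_mul_singleton, inv_mul_cancel,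
        Finset.singleton_one, mul_one, mul_assoc]
    dsimp only
    rwa [this]

open scoped Pointwise in
/-- Let a countably infinite group `Γ` act by homeomorphisms on a compact metrizable
space `X`. If a finite family `(A i)_{i : ι}` of tuples of subsets of `X` has positive
independence density, then at least one member of the family has an infinite
independence set. -/
theorem pos_indep_density_gives_infinite_indep_set
    {Γ : Type*} [Group Γ] [Countable Γ] [Infinite Γ]
    {X : Type*} [TopologicalSpace X] [CompactSpace X] [TopologicalSpace.MetrizableSpace X]
    [MulAction Γ X] [ContinuousConstSMul Γ X]
    {ι : Type} [Fintype ι] {κ : ι → Type} [∀ i, Fintype (κ i)]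
    (A : ∀ i, κ i → Set X)
    (h : HasPosIndepDensity Γ A) :
    ∃ (i : ι) (H : Set Γ), H.Infinite ∧ IsIndepSet (A i) H := by
  classical
  let Q : Finset Γ → Prop := fun J => ∃ i, IsIndepSet (A i) (J : Set Γ)
  have hmono : ∀ J K, J ⊆ K → Q K → Q J := fun J K hJK ⟨i, hi⟩ =>
    ⟨i, hi.mono (Finset.coe_subset.2 hJK)⟩
  let S := {𝒯 : Finset (Finset Γ × Γ) // (∀ x ∈ 𝒯, x.1.Nonempty) ∧
    HasPosDensity fun J => ∃ x ∈ 𝒯, Q (x.1 * {x.2} * J)}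
  have step : ∀ (n : ℕ) (𝒯 : S), ∃ 𝒯' : S,
      ∀ y ∈ 𝒯'.1, n ≤ y.1.card ∧ ∃ x ∈ 𝒯.1, x.1 ⊆ y.1 := by
    rintro n ⟨𝒯, hne, hd⟩
    obtain ⟨𝒯', hd', h'⟩ := HasPosDensity.exists_extension hmono 𝒯 hne hd n
    refine ⟨⟨𝒯', fun y hy => ?_, hd'⟩, h'⟩
    obtain ⟨-, x, hx, hxy⟩ := h' y hy
    exact (hne x hx).mono hxy
  choose next hnext using step
  let start : S := ⟨{({1}, 1)}, by simp, by
    simpa [HasPosDensity, HasPosIndepDensity, Q] using h⟩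
  let 𝒯 : ℕ → S := fun n => Nat.rec start next n
  have hcard : ∀ n, ∀ y ∈ (𝒯 (n + 1)).1, n ≤ y.1.card := fun n y hy => (hnext n (𝒯 n) y hy).1
  have hchain : ∀ m k, ∀ y ∈ (𝒯 (m + k)).1, ∃ x ∈ (𝒯 m).1, x.1 ⊆ y.1 := by
    intro m k
    induction k with
    | zero => exact fun y hy => ⟨y, hy, subset_rfl⟩
    | succ k ih =>
      intro y hy
      obtain ⟨z, hz, hzy⟩ := (hnext (m + k) (𝒯 (m + k)) y hy).2
      obtain ⟨x, hx, hxz⟩ := ih z hz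
      exact ⟨x, hx, hxz.trans hzy⟩
  have hindep : ∀ n, ∃ y ∈ (𝒯 n).1, ∃ i, IsIndepSet (A i) (y.1 : Set Γ) := by
    intro n
    obtain ⟨q, hq, hd⟩ := (𝒯 n).2.2
    obtain ⟨J, hJ, hJc, y, hy, i, hi⟩ := hd {1} (Finset.singleton_nonempty _)
    have hJ1 : J = {1} := by
      rcases Finset.subset_singleton_iff.1 hJ with rfl | rfl
      · simp at hJc
        linarith
      · rfl
    subst hJ1
    refine ⟨y, hy, i, IsIndepSet.of_mul_singleton (c := y.2) ?_⟩
    simpa using hi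
  choose T hT I hI using hindep
  let U : Ultrafilter ℕ := Filter.hyperfilter ℕ
  have hU : (U : Filter ℕ) ≤ Filter.atTop := by
    rw [← Nat.cofinite_eq_atTop]; exact Filter.hyperfilter_le_cofinite
  obtain ⟨i, hi⟩ : ∃ i, ∀ᶠ n in (U : Filter ℕ), I n = i :=
    Ultrafilter.eventually_exists_iff.1 (Filter.Eventually.of_forall fun n => ⟨I n, rfl⟩)
  refine ⟨i, {s | ∀ᶠ n in (U : Filter ℕ), s ∈ (T n).1}, ?_, ?_⟩
  · have hlarge : ∀ m, ∃ x : Finset Γ, m ≤ x.card ∧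
        (x : Set Γ) ⊆ {s | ∀ᶠ n in (U : Filter ℕ), s ∈ (T n).1} := by
      intro m
      have hev : ∀ᶠ n in (U : Filter ℕ), ∃ x ∈ (𝒯 (m + 1)).1, x.1 ⊆ (T n).1 := by
        filter_upwards [hU (Filter.eventually_ge_atTop (m + 1))] with n hn
        obtain ⟨k, rfl⟩ := Nat.exists_eq_add_of_le hn
        exact hchain (m + 1) k _ (hT _)
      obtain ⟨x, hx, hxe⟩ := (Ultrafilter.eventually_exists_mem_iff
        (Finset.finite_toSet (𝒯 (m + 1)).1)).1 hev
      exact ⟨x.1, hcard m x hx, fun s hs => hxe.mono fun n hn => hn hs⟩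
    intro hfin
    obtain ⟨x, hx, hxs⟩ := hlarge (hfin.toFinset.card + 1)
    have := Finset.card_le_card (show x ⊆ hfin.toFinset from fun s hs => by
      simpa using hxs hs)
    omega
  · intro F hF hne ω
    have hsub : ∀ᶠ n in (U : Filter ℕ), ∀ s ∈ F, s ∈ (T n).1 :=
      (Filter.eventually_all_finset F).2 fun s hs => hF hs
    obtain ⟨n, hn, rfl⟩ := (hsub.and hi).exists
    exact hI n F hn hne ω
end

section
/- Let Γ be a countably infinite discrete group and let a ∈ Γ be an element of infinite order. Let Γ act on (ℝ/ℤ)^Γ by the left shift (sx)_t = x_{s⁻¹t}, and let X_{a−1} = {x ∈ (ℝ/ℤ)^Γ : x_{ta} = x_t for all t ∈ Γ} with the restricted shift action. Then X_{a−1} has no non-diagonal orbit IE-pairs: every orbit IE-pair (x, y) ∈ X_{a−1} × X_{a−1} satisfies x = y. -/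
/-- `J ⊆ Γ` is an independence set for a tuple `A = (A_i)_{i : ι}` of subsets of `X`,
with respect to the action `σ : Γ → X → X`, if for every nonempty finite `F ⊆ J` and
every map `ω : F → ι`, the intersection `⋂_{s ∈ F} (σ s)⁻¹ A_{ω(s)}` is nonempty. -/
def IsIndepSetOf {Γ X ι : Type*} (σ : Γ → X → X) (A : ι → Set X) (J : Set Γ) : Prop :=
  ∀ F : Finset Γ, (F : Set Γ) ⊆ J → F.Nonempty → ∀ ω : Γ → ι,
    (⋂ s ∈ F, σ s ⁻¹' A (ω s)).Nonempty

/-- A finite family `(A i)_{i : ι}` of tuples of subsets of `X` has positive independence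
density with respect to the action `σ : Γ → X → X` if there is some `q > 0` such that
for every nonempty finite `F ⊆ Γ` there are `J ⊆ F` with `|J| ≥ q|F|` and some `i` such
that `J` is an independence set for `A i`. -/
def HasPosIndepDensityOf {Γ X : Type*} (σ : Γ → X → X)
    {ι : Type*} {κ : ι → Type*} (A : ∀ i, κ i → Set X) : Prop :=
  ∃ q : ℝ, 0 < q ∧ ∀ F : Finset Γ, F.Nonempty →
    ∃ J : Finset Γ, J ⊆ F ∧ q * (F.card : ℝ) ≤ (J.card : ℝ) ∧
      ∃ i, IsIndepSetOf σ (A i) (J : Set Γ)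

/-- The closed shift-invariant subgroup `X_{a-1} = {x ∈ (ℝ/ℤ)^Γ : x_{ta} = x_t ∀ t}`. -/
def shiftInvSub {Γ : Type*} [Group Γ] (a : Γ) : Set (Γ → UnitAddCircle) :=
  {x | ∀ t : Γ, x (t * a) = x t}

/-- The left shift action `(sx)_t = x_{s⁻¹t}` restricted to `X_{a-1}`. -/
def subshiftAct {Γ : Type*} [Group Γ] (a : Γ) (s : Γ) (x : shiftInvSub a) :
    shiftInvSub a :=
  ⟨fun t => (x : Γ → UnitAddCircle) (s⁻¹ * t), fun t => by
    show (x : Γ → UnitAddCircle) (s⁻¹ * (t * a)) = (x : Γ → UnitAddCircle) (s⁻¹ * t)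
    rw [← mul_assoc]; exact x.2 (s⁻¹ * t)⟩

/-- Points of `X_{a-1}` are invariant under right translation by powers of `a`. -/
theorem shiftInvSub_apply_mul_pow {Γ : Type*} [Group Γ] {a : Γ} (z : shiftInvSub a)
    (t : Γ) (n : ℕ) : (z : Γ → UnitAddCircle) (t * a ^ n) = (z : Γ → UnitAddCircle) t := by
  induction n with
  | zero => simp
  | succ n ih => rw [pow_succ, ← mul_assoc, z.2, ih]

/-- The powers of `t a t⁻¹` do not change the coordinate at `t`. -/
theorem subshiftAct_conj_pow_apply {Γ : Type*} [Group Γ] {a : Γ} (z : shiftInvSub a)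
    (t : Γ) (n : ℕ) :
    (subshiftAct a ((t * a * t⁻¹) ^ n) z : Γ → UnitAddCircle) t =
      (z : Γ → UnitAddCircle) t := by
  change (z : Γ → UnitAddCircle) (((t * a * t⁻¹) ^ n)⁻¹ * t) = _
  rw [← shiftInvSub_apply_mul_pow z _ n, conj_pow]
  group

/-- Let `Γ` be a countably infinite group and `a ∈ Γ` an element of infinite order. Let
`Γ` act on `(ℝ/ℤ)^Γ` by the left shift `(sx)_t = x_{s⁻¹t}` and restrict the action to
`X_{a-1} = {x : x_{ta} = x_t ∀ t}`. Then `X_{a-1}` has no non-diagonal orbit IE-pairs: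
any pair `(x, y)` such that for every product neighborhood `U₁ × U₂` of `(x, y)` the
pair `(U₁, U₂)` has positive independence density must satisfy `x = y`. -/
theorem no_nondiagonal_orbit_IE_pairs
    {Γ : Type*} [Group Γ] [Countable Γ] [Infinite Γ]
    (a : Γ) (ha : ¬ IsOfFinOrder a)
    (x y : shiftInvSub a)
    (h : ∀ U₁ U₂ : Set (shiftInvSub a), IsOpen U₁ → IsOpen U₂ → x ∈ U₁ → y ∈ U₂ →
      HasPosIndepDensityOf (subshiftAct a) (fun _ : Unit => ![U₁, U₂])) :
    x = y := by
  classical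
  by_contra hxy
  obtain ⟨t, ht⟩ : ∃ t, (x : Γ → UnitAddCircle) t ≠ (y : Γ → UnitAddCircle) t := by
    by_contra! hall
    exact hxy (Subtype.ext (funext hall))
  obtain ⟨V₁, V₂, hV₁, hV₂, hx, hy, hV⟩ := t2_separation ht
  have hcont : Continuous fun z : shiftInvSub a => (z : Γ → UnitAddCircle) t :=
    (continuous_apply t).comp continuous_subtype_val
  obtain ⟨q, hq, hF⟩ := h _ _ (hV₁.preimage hcont) (hV₂.preimage hcont) hx hy
  obtain ⟨N, hN⟩ := exists_nat_gt (1 / q)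
  have hN0 : 0 < N := by
    have : (0 : ℝ) < N := lt_trans (by positivity) hN
    exact_mod_cast this
  have hinj : Function.Injective fun n : ℕ => (t * a * t⁻¹) ^ n := by
    intro m n hmn
    simp only [conj_pow, mul_left_inj, mul_right_inj] at hmn
    exact injective_pow_iff_not_isOfFinOrder.mpr ha hmn
  obtain ⟨J, hJF, hJcard, _, hJ⟩ := hF ((Finset.range N).image fun n => (t * a * t⁻¹) ^ n)
    ((Finset.nonempty_range_iff.mpr hN0.ne').image _)
  have hJ1 : J.card ≤ 1 := by
    rw [Finset.card_le_one]
    intro s hs s' hs'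
    by_contra hne
    obtain ⟨z, hz⟩ := hJ J subset_rfl ⟨s, hs⟩ fun r => if r = s then 0 else 1
    simp only [Set.mem_iInter] at hz
    have h₁ := hz s hs
    have h₂ := hz s' hs'
    obtain ⟨m, -, rfl⟩ := Finset.mem_image.mp (hJF hs)
    obtain ⟨n, -, rfl⟩ := Finset.mem_image.mp (hJF hs')
    simp only [if_true, if_neg (Ne.symm hne), Matrix.cons_val_zero, Matrix.cons_val_one,
      Set.mem_preimage, subshiftAct_conj_pow_apply] at h₁ h₂
    exact Set.disjoint_left.mp hV h₁ h₂
  rw [Finset.card_image_of_injective _ hinj, Finset.card_range] at hJcard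
  have hJ1' : (J.card : ℝ) ≤ 1 := by exact_mod_cast hJ1
  rw [div_lt_iff₀ hq] at hN
  linarith [mul_comm q (N : ℝ)]
end

section
/- Let F₂ be the free group on two generators a and b, acting on (ℝ/ℤ)^{F₂} by the left shift (sx)_t = x_{s⁻¹t}, and let X_{a−1} = {x ∈ (ℝ/ℤ)^{F₂} : x_{ta} = x_t for all t ∈ F₂} with the restricted shift action. Then the naive topological entropy h^nv(F₂↷X_{a−1}) is positive. -/
open scoped ENNReal NNReal

/-- A finite open cover of `X`, encoded as a `Finset` of open sets whose union is `X`. -/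
def IsFinOpenCover {X : Type*} [TopologicalSpace X] (𝒰 : Finset (Set X)) : Prop :=
  (∀ U ∈ 𝒰, IsOpen U) ∧ ⋃₀ (𝒰 : Set (Set X)) = Set.univ

/-- `N(𝒰)`: the minimal cardinality of a subcover of `𝒰`. -/
noncomputable def coverNum {X : Type*} (𝒰 : Finset (Set X)) : ℕ :=
  sInf {n | ∃ 𝒱 : Finset (Set X), 𝒱 ⊆ 𝒰 ∧ ⋃₀ (𝒱 : Set (Set X)) = Set.univ ∧ 𝒱.card = n}

/-- `𝒰^F = ⋁_{s ∈ F} s⁻¹𝒰` for the action `σ : Γ → X → X`: the join of the pullbacks of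
`𝒰` by the maps `σ s`, `s ∈ F`, consisting of all intersections `⋂_{s ∈ F} (σ s)⁻¹ U_s`
over choices `U_s ∈ 𝒰`. -/
noncomputable def jointCoverOf {Γ X : Type*} (σ : Γ → X → X)
    (F : Finset Γ) (𝒰 : Finset (Set X)) : Finset (Set X) := by
  classical
  exact (F.pi fun _ => 𝒰).image fun ω => ⋂ s : Γ, ⋂ h : s ∈ F, σ s ⁻¹' ω s h

/-- The naive topological entropy `sup_𝒰 inf_F (1/|F|) log N(𝒰^F)` of the action
`σ : Γ → X → X`, where `𝒰` ranges over finite open covers of `X` and `F` over nonempty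
finite subsets of `Γ`, as an extended nonnegative real. -/
noncomputable def naiveEntropyOf {Γ X : Type*} [TopologicalSpace X] (σ : Γ → X → X) :
    ℝ≥0∞ :=
  ⨆ 𝒰 : {𝒰 : Finset (Set X) // IsFinOpenCover 𝒰},
    ⨅ F : {F : Finset Γ // F.Nonempty},
      ENNReal.ofReal (Real.log (coverNum (jointCoverOf σ F.1 𝒰.1) : ℝ) / (F.1.card : ℝ))

theorem sUnion_jointCoverOf {Γ X : Type*} (σ : Γ → X → X) (F : Finset Γ)
    {𝒰 : Finset (Set X)} (h𝒰 : ⋃₀ (𝒰 : Set (Set X)) = Set.univ) :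
    ⋃₀ (jointCoverOf σ F 𝒰 : Set (Set X)) = Set.univ := by
  classical
  rw [Set.sUnion_eq_univ_iff] at h𝒰 ⊢
  intro x
  choose f hf hxf using h𝒰
  refine ⟨⋂ s : Γ, ⋂ _ : s ∈ F, σ s ⁻¹' f (σ s x), ?_, ?_⟩
  · simp only [jointCoverOf, Finset.coe_image, Set.mem_image, Finset.mem_coe, Finset.mem_pi]
    exact ⟨fun s _ => f (σ s x), fun s _ => hf _, rfl⟩
  · simp only [Set.mem_iInter, Set.mem_preimage]
    exact fun s _ => hxf _

/-- If the points `p S`, `S ⊆ T`, are pairwise separated by `𝒰` at the times in `T ⊆ F`, then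
`𝒰^F` has no subcover with fewer than `2 ^ |T|` elements. -/
theorem two_pow_card_le_coverNum {Γ X : Type*} (σ : Γ → X → X) {F T : Finset Γ} (hT : T ⊆ F)
    {𝒰 : Finset (Set X)} (h𝒰 : ⋃₀ (𝒰 : Set (Set X)) = Set.univ) (p : Finset Γ → X)
    (hp : ∀ S S' : Finset Γ, ∀ s ∈ T, s ∈ S → s ∉ S' →
      ∀ U ∈ 𝒰, σ s (p S) ∈ U → σ s (p S') ∉ U) :
    2 ^ T.card ≤ coverNum (jointCoverOf σ F 𝒰) := by
  classical
  refine le_csInf ⟨_, _, subset_rfl, sUnion_jointCoverOf σ F h𝒰, rfl⟩ ?_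
  rintro _ ⟨𝒱, h𝒱, hcov, rfl⟩
  rw [Set.sUnion_eq_univ_iff] at hcov
  choose V hV hpV using hcov
  have key : ∀ S ⊆ T, ∀ S', V (p S) = V (p S') → S ⊆ S' := by
    intro S hS S' hVV s hs
    by_contra hs'
    have hmem := h𝒱 (hV (p S))
    simp only [jointCoverOf, Finset.mem_image, Finset.mem_pi] at hmem
    obtain ⟨ω, hω, hωV⟩ := hmem
    have h1 := hpV (p S)
    have h2 := hpV (p S')
    rw [← hVV, ← hωV] at h2
    rw [← hωV] at h1
    simp only [Set.mem_iInter, Set.mem_preimage] at h1 h2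
    have hsF := hT (hS hs)
    exact hp S S' s (hS hs) hs hs' _ (hω s hsF) (h1 s hsF) (h2 s hsF)
  rw [← Finset.card_powerset]
  refine Finset.card_le_card_of_injOn (fun S => V (p S)) (fun S _ => hV _) ?_
  intro S hS S' hS' h
  rw [Finset.mem_coe, Finset.mem_powerset] at hS hS'
  exact (key S hS S' h).antisymm (key S' hS' S h.symm)

/-- The permutation `x ↦ -x⁻¹` of `ℚ`. -/
def negInvPerm : Equiv.Perm ℚ :=
  Function.Involutive.toPerm (fun x => -x⁻¹) fun x => by simp [inv_neg]

/-- The action of `F₂` on `ℚ` in which `a` acts by `x ↦ x + 2` and `b` by `x ↦ -x⁻¹`. -/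
def pingPong : FreeGroup Bool →* Equiv.Perm ℚ :=
  FreeGroup.lift fun i => cond i (Equiv.addRight 2) negInvPerm

theorem pingPong_of_true_zpow (n : ℤ) (x : ℚ) :
    pingPong (FreeGroup.of true ^ n) x = x + 2 * n := by
  have h1 : pingPong (FreeGroup.of true) = Equiv.addRight 2 := by
    rw [pingPong, FreeGroup.lift_apply_of, cond_true]
  rw [map_zpow, h1]
  induction n using Int.induction_on generalizing x with
  | zero => simp
  | succ n ih =>
    rw [zpow_add_one, Equiv.Perm.mul_apply, ih, Equiv.coe_addRight]
    push_cast
    ring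
  | pred n ih =>
    rw [zpow_sub_one, Equiv.Perm.mul_apply, ih, Equiv.Perm.inv_def, Equiv.addRight_symm,
      Equiv.coe_addRight]
    push_cast
    ring

theorem pingPong_of_false (x : ℚ) : pingPong (FreeGroup.of false) x = -x⁻¹ := by
  rw [pingPong, FreeGroup.lift_apply_of, cond_false]
  rfl

theorem eq_zero_of_add_two_mul_mem_Ico {x : ℚ} {n : ℤ} (hx : x ∈ Set.Ico (-1 : ℚ) 1)
    (hn : x + 2 * n ∈ Set.Ico (-1 : ℚ) 1) : n = 0 := by
  obtain ⟨h1, h2⟩ := hx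
  obtain ⟨h3, h4⟩ := hn
  have h5 : n < 1 := by exact_mod_cast (by linarith : (n : ℚ) < 1)
  have h6 : -1 < n := by exact_mod_cast (by linarith : (-1 : ℚ) < n)
  omega

theorem neg_inv_mem_Ico {x : ℚ} (hx : x ∉ Set.Ico (-1 : ℚ) 1) :
    -x⁻¹ ∈ Set.Ico (-1 : ℚ) 1 := by
  rw [Set.mem_Ico, not_and_or, not_le, not_lt] at hx
  rcases hx with hx | hx
  · rw [← inv_neg]
    have h : 1 < -x := by linarith
    exact ⟨by linarith [inv_pos.2 (one_pos.trans h)], inv_lt_one_of_one_lt₀ h⟩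
  · exact ⟨by linarith [inv_le_one_of_one_le₀ hx], by linarith [inv_pos.2 (one_pos.trans_le hx)]⟩

/-- At least half of any finite `F ⊆ F₂` meets each coset of `⟨a⟩` at most once under one of the
maps `s ↦ s⁻¹` and `s ↦ s⁻¹ b`. -/
theorem exists_subset_half_card (F : Finset (FreeGroup Bool)) :
    ∃ c : FreeGroup Bool, (c = 1 ∨ c = FreeGroup.of false) ∧ ∃ T ⊆ F, F.card ≤ 2 * T.card ∧
      ∀ s ∈ T, ∀ t ∈ T, ∀ n : ℤ, s⁻¹ * c = t⁻¹ * c * FreeGroup.of true ^ n → s = t := by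
  classical
  set Q : FreeGroup Bool → Prop := fun s => pingPong s 0 ∈ Set.Ico (-1 : ℚ) 1
  have wander : ∀ (c s t : FreeGroup Bool) (n : ℤ),
      pingPong (c⁻¹ * s) 0 ∈ Set.Ico (-1 : ℚ) 1 → pingPong (c⁻¹ * t) 0 ∈ Set.Ico (-1 : ℚ) 1 →
      s⁻¹ * c = t⁻¹ * c * FreeGroup.of true ^ n → s = t := by
    intro c s t n hs ht h
    have h' : c⁻¹ * t = FreeGroup.of true ^ n * (c⁻¹ * s) := by
      calc c⁻¹ * t = FreeGroup.of true ^ n * (t⁻¹ * c * FreeGroup.of true ^ n)⁻¹ := by group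
        _ = FreeGroup.of true ^ n * (c⁻¹ * s) := by rw [← h]; group
    rw [h', map_mul, Equiv.Perm.mul_apply, pingPong_of_true_zpow] at ht
    rw [eq_zero_of_add_two_mul_mem_Ico hs ht, zpow_zero, one_mul] at h'
    exact (mul_left_cancel h').symm
  have hb : ∀ s, ¬ Q s → pingPong ((FreeGroup.of false)⁻¹ * s) 0 ∈ Set.Ico (-1 : ℚ) 1 := by
    intro s hs
    have : pingPong ((FreeGroup.of false)⁻¹ * s) 0 = -(pingPong s 0)⁻¹ := by
      rw [map_mul, map_inv, Equiv.Perm.mul_apply, Equiv.Perm.inv_eq_iff_eq, pingPong_of_false]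
      simp [inv_neg]
    rw [this]
    exact neg_inv_mem_Ico hs
  have hcard := Finset.card_filter_add_card_filter_not (s := F) Q
  rcases le_total (F.filter fun s => ¬ Q s).card (F.filter Q).card with h | h
  · refine ⟨1, Or.inl rfl, F.filter Q, Finset.filter_subset _ _, by omega, ?_⟩
    intro s hs t ht n
    refine wander 1 s t n ?_ ?_
    · rw [inv_one, one_mul]
      exact (Finset.mem_filter.1 hs).2
    · rw [inv_one, one_mul]
      exact (Finset.mem_filter.1 ht).2
  · refine ⟨_, Or.inr rfl, F.filter fun s => ¬ Q s, Finset.filter_subset _ _, by omega, ?_⟩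
    intro s hs t ht n
    exact wander _ s t n (hb s (Finset.mem_filter.1 hs).2) (hb t (Finset.mem_filter.1 ht).2)

/-- The point of `X_{a-1}` equal to `0` on the cosets `s⁻¹ c ⟨a⟩`, `s ∈ S`, and to `z`
elsewhere. -/
noncomputable def cosetPoint {Γ : Type*} [Group Γ] (a c : Γ) (z : UnitAddCircle)
    (S : Finset Γ) : shiftInvSub a := by
  classical
  exact ⟨fun t => if ∃ s ∈ S, ∃ n : ℤ, t = s⁻¹ * c * a ^ n then 0 else z, fun t => by
    refine if_congr ⟨?_, ?_⟩ rfl rfl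
    · rintro ⟨s, hs, n, h⟩
      exact ⟨s, hs, n - 1, by rw [zpow_sub_one, ← mul_assoc, ← h, mul_inv_cancel_right]⟩
    · rintro ⟨s, hs, n, h⟩
      exact ⟨s, hs, n + 1, by rw [zpow_add_one, ← mul_assoc, ← h]⟩⟩

/-- The points of `X_{a-1}` that avoid the value `z` at `1` and the value `w` at `b`. -/
def avoidSet {Γ : Type*} [Group Γ] (a b : Γ) (q : UnitAddCircle × UnitAddCircle) :
    Set (shiftInvSub a) :=
  {x | (x : Γ → UnitAddCircle) 1 ≠ q.1 ∧ (x : Γ → UnitAddCircle) b ≠ q.2}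

open Classical in
/-- The cover of `X_{a-1}` by the sets avoiding one of the values `0`, `z` at each of `1`, `b`. -/
noncomputable def avoidCover {Γ : Type*} [Group Γ] (a b : Γ) (z : UnitAddCircle) :
    Finset (Set (shiftInvSub a)) :=
  (({0, z} : Finset UnitAddCircle) ×ˢ ({0, z} : Finset UnitAddCircle)).image (avoidSet a b)

theorem isFinOpenCover_avoidCover {Γ : Type*} [Group Γ] (a b : Γ) {z : UnitAddCircle}
    (hz : z ≠ 0) : IsFinOpenCover (avoidCover a b z) := by
  classical
  constructor
  · intro U hU
    obtain ⟨q, -, rfl⟩ := Finset.mem_image.1 hU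
    have hc : ∀ t : Γ, Continuous fun x : shiftInvSub a => (x : Γ → UnitAddCircle) t :=
      fun t => (continuous_apply t).comp continuous_subtype_val
    exact (isOpen_ne.preimage (hc 1)).inter (isOpen_ne.preimage (hc b))
  · rw [Set.sUnion_eq_univ_iff]
    intro x
    have h : ∀ y : UnitAddCircle, ∃ w ∈ ({0, z} : Finset UnitAddCircle), y ≠ w := by
      intro y
      by_cases hy : y = 0
      · exact ⟨z, by simp, by rw [hy]; exact hz.symm⟩
      · exact ⟨0, by simp, hy⟩
    obtain ⟨w, hw, hw'⟩ := h ((x : Γ → UnitAddCircle) 1)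
    obtain ⟨v, hv, hv'⟩ := h ((x : Γ → UnitAddCircle) b)
    exact ⟨avoidSet a b (w, v), Finset.mem_coe.2 (Finset.mem_image_of_mem _
      (Finset.mk_mem_product hw hv)), hw', hv'⟩

theorem notMem_of_mem_avoidCover {Γ : Type*} [Group Γ] {a b c : Γ} {z : UnitAddCircle}
    (hc : c = 1 ∨ c = b) {U : Set (shiftInvSub a)} (hU : U ∈ avoidCover a b z)
    {x y : shiftInvSub a} (hx : (x : Γ → UnitAddCircle) c = 0)
    (hy : (y : Γ → UnitAddCircle) c = z) (hxU : x ∈ U) : y ∉ U := by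
  classical
  obtain ⟨⟨w, v⟩, hq, rfl⟩ := Finset.mem_image.1 hU
  rintro ⟨hy1, hy2⟩
  obtain ⟨hx1, hx2⟩ := hxU
  simp only [Finset.mem_product, Finset.mem_insert, Finset.mem_singleton] at hq
  rcases hc with rfl | rfl
  · rcases hq.1 with h | h
    · exact hx1 (hx.trans h.symm)
    · exact hy1 (hy.trans h.symm)
  · rcases hq.2 with h | h
    · exact hx2 (hx.trans h.symm)
    · exact hy2 (hy.trans h.symm)

/-- Let `F₂ = FreeGroup Bool` be the free group on the two generators
`a = FreeGroup.of true` and `b = FreeGroup.of false`, acting on `(ℝ/ℤ)^{F₂}` by the left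
shift `(sx)_t = x_{s⁻¹t}`, restricted to `X_{a-1} = {x : x_{ta} = x_t ∀ t}`. Then the
naive topological entropy of `F₂ ↷ X_{a-1}` is positive. -/
theorem subshift_positive_naive_entropy :
    0 < naiveEntropyOf (subshiftAct (FreeGroup.of true : FreeGroup Bool)) := by
  classical
  obtain ⟨z, hz⟩ : ∃ z : UnitAddCircle, z ≠ 0 := by
    refine ⟨((1 / 2 : ℝ) : UnitAddCircle), fun h => ?_⟩
    rw [← AddCircle.coe_zero, AddCircle.coe_eq_coe_iff_of_mem_Ico (a := 0)
      (by norm_num) (by norm_num)] at h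
    norm_num at h
  set a : FreeGroup Bool := FreeGroup.of true
  set b : FreeGroup Bool := FreeGroup.of false
  have hcov := isFinOpenCover_avoidCover a b hz
  have hlog : 0 < Real.log 2 / 2 := half_pos (Real.log_pos one_lt_two)
  refine (ENNReal.ofReal_pos.2 hlog).trans_le ?_
  refine le_iSup_of_le ⟨avoidCover a b z, hcov⟩ (le_iInf ?_)
  rintro ⟨F, hF⟩
  refine ENNReal.ofReal_le_ofReal ?_
  obtain ⟨c, hc, T, hTF, hcard, hT⟩ := exists_subset_half_card F
  have hN : 2 ^ T.card ≤ coverNum (jointCoverOf (subshiftAct a) F (avoidCover a b z)) := by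
    refine two_pow_card_le_coverNum (subshiftAct a) hTF hcov.2
      (fun S => cosetPoint a c z (S ∩ T)) ?_
    intro S S' s hsT hs hs' U hU
    refine notMem_of_mem_avoidCover hc hU ?_ ?_
    · exact if_pos ⟨s, Finset.mem_inter.2 ⟨hs, hsT⟩, 0, by simp⟩
    · refine if_neg ?_
      rintro ⟨t, ht, n, h⟩
      rw [Finset.mem_inter] at ht
      exact hs' (hT s hsT t ht.2 n h ▸ ht.1)
  have hF' : (0 : ℝ) < F.card := by exact_mod_cast hF.card_pos
  have hcard' : (F.card : ℝ) ≤ 2 * T.card := by exact_mod_cast hcard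
  rw [le_div_iff₀ hF']
  calc Real.log 2 / 2 * F.card ≤ T.card * Real.log 2 := by nlinarith
    _ = Real.log (2 ^ T.card) := (Real.log_pow _ _).symm
    _ ≤ _ := Real.log_le_log (by positivity) (by exact_mod_cast hN)
end

section
/- Let F₂ be the free group on two generators a and b, acting on (ℝ/ℤ)^{F₂} by the left shift (sx)_t = x_{s⁻¹t}, and let X_{a−1} = {x ∈ (ℝ/ℤ)^{F₂} : x_{ta} = x_t for all t ∈ F₂} with the restricted shift action. Then there is a finite pairwise disjoint closed family 𝒜 of 2-tuples of subsets of X_{a−1} with positive independence density such that no single element A ∈ 𝒜 has positive independence density (as the one-element family {A}). -/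
theorem FreeGroup.toWord_mk_replicate_mul {α : Type*} [DecidableEq α] (p : α × Bool) (n : ℕ)
    (s : FreeGroup α) (hs : ∀ q ∈ s.toWord.head?, q.1 ≠ p.1) :
    (FreeGroup.mk (List.replicate n p) * s).toWord = List.replicate n p ++ s.toWord := by
  have hred : FreeGroup.IsReduced (List.replicate n p ++ s.toWord) := by
    refine List.isChain_append.2 ⟨?_, FreeGroup.isReduced_toWord, ?_⟩
    · exact List.isChain_replicate_of_rel n fun _ => rfl
    · intro x hx y hy hxy
      have hxp : x = p := List.eq_of_mem_replicate (List.mem_of_mem_getLast? hx)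
      exact absurd (hxp ▸ hxy).symm (hs y hy)
  rw [← hred.reduce_eq, ← FreeGroup.toWord_mk, ← FreeGroup.mul_mk, FreeGroup.mk_toWord]

theorem FreeGroup.of_zpow_eq_mk_replicate {α : Type*} (a : α) (z : ℤ) :
    FreeGroup.of a ^ z = FreeGroup.mk (List.replicate z.natAbs (a, decide (0 ≤ z))) := by
  rcases z with n | n
  · simp [FreeGroup.of, FreeGroup.pow_mk]
  · have h : decide (0 ≤ Int.negSucc n) = false := by simp
    rw [zpow_negSucc, FreeGroup.of, FreeGroup.pow_mk, FreeGroup.inv_mk, h]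
    simp [FreeGroup.invRev]

/-- If the reduced word of `s` does not start with `a ^ ±1`, then the reduced word of `a ^ z * s`
is the concatenation of those of `a ^ z` and `s`. -/
theorem FreeGroup.toWord_of_zpow_mul {α : Type*} [DecidableEq α] (a : α) (z : ℤ)
    (s : FreeGroup α) (hs : ∀ q ∈ s.toWord.head?, q.1 ≠ a) :
    (FreeGroup.of a ^ z * s).toWord =
      List.replicate z.natAbs (a, decide (0 ≤ z)) ++ s.toWord := by
  rw [FreeGroup.of_zpow_eq_mk_replicate, FreeGroup.toWord_mk_replicate_mul _ _ _ hs]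

/-- Left multiplication by a nontrivial power of `a`, or else by its conjugate by `b`,
increases the word length. -/
theorem FreeGroup.norm_lt_zpow_mul_or_norm_lt_conj_zpow_mul {α : Type*} [DecidableEq α] {a b : α}
    (hab : a ≠ b) (s : FreeGroup α) :
    (∀ z : ℤ, z ≠ 0 → s.norm < (FreeGroup.of a ^ z * s).norm) ∨
      ∀ z : ℤ, z ≠ 0 →
        s.norm < (FreeGroup.of b * FreeGroup.of a ^ z * (FreeGroup.of b)⁻¹ * s).norm := by
  by_cases hs : ∀ q ∈ s.toWord.head?, q.1 ≠ a
  · left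
    intro z hz
    simp only [FreeGroup.norm, FreeGroup.toWord_of_zpow_mul a z s hs, List.length_append,
      List.length_replicate]
    omega
  · right
    intro z hz
    push Not at hs
    obtain ⟨q, hq, hqa⟩ := hs
    have h₁ := FreeGroup.toWord_of_zpow_mul b (-1) s fun r hr => by
      rw [Option.mem_unique hr hq, hqa]; exact hab
    have h₂ := FreeGroup.toWord_of_zpow_mul a z (FreeGroup.of b ^ (-1 : ℤ) * s) fun r hr => by
      rw [h₁] at hr
      simp only [Int.natAbs_neg, Int.natAbs_one, List.replicate_one, List.cons_append,
        List.head?_cons, Option.mem_some_iff] at hr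
      rw [← hr]; exact hab.symm
    have h₃ := FreeGroup.toWord_of_zpow_mul b 1
        (FreeGroup.of a ^ z * (FreeGroup.of b ^ (-1 : ℤ) * s)) fun r hr => by
      rw [h₂] at hr
      obtain ⟨n, hn⟩ := Nat.exists_eq_succ_of_ne_zero (Int.natAbs_ne_zero.2 hz)
      simp only [hn, List.replicate_succ, List.cons_append, List.head?_cons,
        Option.mem_some_iff] at hr
      rw [← hr]; exact hab
    rw [zpow_one, zpow_neg_one] at h₃
    simp only [mul_assoc, FreeGroup.norm]
    rw [h₃, ← zpow_neg_one, h₂, h₁]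
    simp only [List.length_append, List.length_replicate]
    omega

/-- View `F` as the edges of a bipartite graph with end maps `f` and `g`. If every edge is strictly
`φ`-minimal among the edges at one of its two ends, then the graph is a forest, and so it has at
least as many vertices as edges. -/
theorem Finset.card_le_card_image_add_card_image {α β γ : Type*} [DecidableEq α] [DecidableEq β]
    [DecidableEq γ] (f : α → β) (g : α → γ) (φ : α → ℕ)
    (h : ∀ s, (∀ s', s' ≠ s → f s' = f s → φ s < φ s') ∨
      ∀ s', s' ≠ s → g s' = g s → φ s < φ s') (F : Finset α) :
    F.card ≤ (F.image f).card + (F.image g).card := by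
  induction F using Finset.induction_on_max_value φ with
  | empty => simp
  | insert s F hs hmax ih =>
    rw [Finset.card_insert_of_notMem hs, Finset.image_insert, Finset.image_insert]
    have hf := Finset.card_le_card (Finset.subset_insert (f s) (F.image f))
    have hg := Finset.card_le_card (Finset.subset_insert (g s) (F.image g))
    rcases h s with h | h
    · have hfs : f s ∉ F.image f := fun hmem => by
        obtain ⟨s', hs', he⟩ := Finset.mem_image.1 hmem
        exact (h s' (ne_of_mem_of_not_mem hs' hs) he).not_ge (hmax s' hs')
      rw [Finset.card_insert_of_notMem hfs]
      omega
    · have hgs : g s ∉ F.image g := fun hmem => by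
        obtain ⟨s', hs', he⟩ := Finset.mem_image.1 hmem
        exact (h s' (ne_of_mem_of_not_mem hs' hs) he).not_ge (hmax s' hs')
      rw [Finset.card_insert_of_notMem hgs]
      omega

/-- The points of `X_{a-1}` whose coordinate at `t` is `v`. -/
def coordinateFiber {Γ : Type*} [Group Γ] (a t : Γ) (v : UnitAddCircle) : Set (shiftInvSub a) :=
  {x | (x : Γ → UnitAddCircle) t = v}

theorem isClosed_coordinateFiber {Γ : Type*} [Group Γ] (a t : Γ) (v : UnitAddCircle) :
    IsClosed (coordinateFiber a t v) :=
  isClosed_eq ((continuous_apply t).comp continuous_subtype_val) continuous_const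

theorem disjoint_coordinateFiber {Γ : Type*} [Group Γ] (a t : Γ) {v w : UnitAddCircle}
    (h : v ≠ w) : Disjoint (coordinateFiber a t v) (coordinateFiber a t w) :=
  Set.disjoint_left.2 fun _ hv hw => h (hv.symm.trans hw)

theorem apply_mul_zpow_of_mem_shiftInvSub {Γ : Type*} [Group Γ] {a : Γ} {x : Γ → UnitAddCircle}
    (hx : x ∈ shiftInvSub a) (t : Γ) (z : ℤ) : x (t * a ^ z) = x t := by
  induction z with
  | zero => simp
  | succ n ih => rw [zpow_add_one, ← mul_assoc, hx, ih]
  | pred n ih => rw [← hx, mul_assoc, ← zpow_add_one, sub_add_cancel, ih]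

/-- The coset of `⟨a⟩` on which the coordinate at `t` of `sx` depends. -/
def coordinateCoset {Γ : Type*} [Group Γ] (a t s : Γ) : Γ ⧸ Subgroup.zpowers a :=
  ((s⁻¹ * t : Γ) : Γ ⧸ Subgroup.zpowers a)

theorem coordinateCoset_eq_iff {Γ : Type*} [Group Γ] {a t s s' : Γ} :
    coordinateCoset a t s' = coordinateCoset a t s ↔ ∃ z : ℤ, s' = t * a ^ z * t⁻¹ * s := by
  rw [coordinateCoset, coordinateCoset, QuotientGroup.eq, Subgroup.mem_zpowers_iff]
  refine exists_congr fun z => ⟨fun h => ?_, fun h => ?_⟩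
  · rw [h]; group
  · rw [h]; group

theorem isIndepSetOf_coordinateFiber {Γ ι : Type*} [Group Γ] {a t : Γ} (v : ι → UnitAddCircle)
    {J : Set Γ} (hJ : Set.InjOn (coordinateCoset a t) J) :
    IsIndepSetOf (subshiftAct a) (fun j => coordinateFiber a t (v j)) J := by
  intro F hF _ ω
  refine ⟨⟨fun u => v (ω (Function.invFunOn (coordinateCoset a t) J (u : Γ ⧸ _))), fun u => ?_⟩,
    ?_⟩
  · have h : ((u * a : Γ) : Γ ⧸ Subgroup.zpowers a) = (u : Γ ⧸ _) :=
      QuotientGroup.mk_mul_of_mem u (Subgroup.mem_zpowers a)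
    simp only [h]
  · refine Set.mem_iInter₂.2 fun s hs => ?_
    exact congrArg (fun r => v (ω r)) (hJ.leftInvOn_invFunOn (hF hs))

theorem IsIndepSetOf.injOn_coordinateCoset {Γ ι : Type*} [Group Γ] {a t : Γ}
    {v : ι → UnitAddCircle} {J : Set Γ} {i j : ι} (hv : v i ≠ v j)
    (hJ : IsIndepSetOf (subshiftAct a) (fun j => coordinateFiber a t (v j)) J) :
    Set.InjOn (coordinateCoset a t) J := by
  classical
  intro s hs s' hs' h
  by_contra hne
  obtain ⟨x, hx⟩ := hJ {s, s'} (by simp [Set.insert_subset_iff, hs, hs']) (by simp)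
    fun r => if r = s then i else j
  have hxs := Set.mem_iInter₂.1 hx s (by simp)
  have hxs' := Set.mem_iInter₂.1 hx s' (by simp)
  simp only [if_true, if_neg (Ne.symm hne)] at hxs hxs'
  change (x : Γ → UnitAddCircle) (s⁻¹ * t) = v i at hxs
  change (x : Γ → UnitAddCircle) (s'⁻¹ * t) = v j at hxs'
  obtain ⟨z, hz⟩ := Subgroup.mem_zpowers_iff.1 (QuotientGroup.eq.1 h)
  refine hv (hxs.symm.trans (Eq.trans ?_ hxs'))
  rw [← apply_mul_zpow_of_mem_shiftInvSub x.2 _ z, hz, mul_inv_cancel_left]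

theorem not_hasPosIndepDensityOf_coordinateFiber {Γ ι : Type*} [Group Γ] {a t : Γ}
    (ha : Function.Injective fun n : ℕ => a ^ n) {v : ι → UnitAddCircle} {i j : ι}
    (hv : v i ≠ v j) :
    ¬ HasPosIndepDensityOf (subshiftAct a)
      (fun (_ : Unit) j => coordinateFiber a t (v j)) := by
  classical
  rintro ⟨q, hq, H⟩
  obtain ⟨N, hN⟩ := exists_nat_gt (1 / q)
  rw [div_lt_iff₀ hq] at hN
  have hinj : Function.Injective fun n : ℕ => t * a ^ n * t⁻¹ := fun m n h =>
    ha (mul_left_cancel (mul_right_cancel h))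
  have hN0 : N ≠ 0 := by rintro rfl; norm_num at hN
  obtain ⟨J, hJF, hcard, _, hJ⟩ := H ((Finset.range N).image fun n : ℕ => t * a ^ n * t⁻¹)
    (by simpa using hN0)
  have hJ1 : J.card ≤ 1 := Finset.card_le_one.2 fun s hs s' hs' => by
    refine IsIndepSetOf.injOn_coordinateCoset hv hJ hs hs' ?_
    obtain ⟨m, -, rfl⟩ := Finset.mem_image.1 (hJF hs)
    obtain ⟨n, -, rfl⟩ := Finset.mem_image.1 (hJF hs')
    refine coordinateCoset_eq_iff.2 ⟨(m : ℤ) - n, ?_⟩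
    rw [zpow_sub, zpow_natCast, zpow_natCast]
    group
  rw [Finset.card_image_of_injective _ hinj, Finset.card_range] at hcard
  have : (J.card : ℝ) ≤ 1 := by exact_mod_cast hJ1
  linarith

theorem exists_isIndepSetOf_card_eq {Γ ι : Type*} [Group Γ] [DecidableEq Γ] {a t : Γ}
    [DecidableEq (Γ ⧸ Subgroup.zpowers a)] (v : ι → UnitAddCircle) (F : Finset Γ) :
    ∃ J ⊆ F, J.card = (F.image (coordinateCoset a t)).card ∧
      IsIndepSetOf (subshiftAct a) (fun j => coordinateFiber a t (v j)) (J : Set Γ) := by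
  obtain ⟨J, hJF, hJ, himg⟩ := Finset.exists_subset_injOn_image_eq_of_surjOn
    (f := coordinateCoset a t) (F : Set Γ) (F.image (coordinateCoset a t))
    (by rw [Finset.coe_image]; exact Set.surjOn_image _ _)
  refine ⟨J, Finset.coe_subset.1 hJF, ?_, isIndepSetOf_coordinateFiber v hJ⟩
  rw [← himg, Finset.card_image_of_injOn hJ]

theorem card_le_card_image_coordinateCoset_add
    [DecidableEq (FreeGroup Bool ⧸ Subgroup.zpowers (FreeGroup.of true))]
    (F : Finset (FreeGroup Bool)) :
    F.card ≤ (F.image (coordinateCoset (FreeGroup.of true) 1)).card +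
      (F.image (coordinateCoset (FreeGroup.of true) (FreeGroup.of false))).card := by
  refine F.card_le_card_image_add_card_image _ _ FreeGroup.norm fun s => ?_
  have hz : ∀ {t : FreeGroup Bool} {z : ℤ},
      t * FreeGroup.of true ^ z * t⁻¹ * s ≠ s → z ≠ 0 := by
    rintro t _ h rfl
    simp at h
  refine (FreeGroup.norm_lt_zpow_mul_or_norm_lt_conj_zpow_mul
    (a := true) (b := false) (by decide) s).imp ?_ ?_ <;> intro h s' hne heq <;>
    obtain ⟨z, rfl⟩ := coordinateCoset_eq_iff.1 heq
  · simpa using h z (hz hne)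
  · exact h z (hz hne)

/-- Let `F₂ = FreeGroup Bool` be the free group on the two generators
`a = FreeGroup.of true` and `b = FreeGroup.of false`, acting on `(ℝ/ℤ)^{F₂}` by the left
shift `(sx)_t = x_{s⁻¹t}`, restricted to `X_{a-1} = {x : x_{ta} = x_t ∀ t}`. Then there
is a finite pairwise disjoint closed family `(A i)_{i}` of 2-tuples of subsets of
`X_{a-1}` with positive independence density such that no single member `A i` has
positive independence density as a one-element family. -/
theorem family_pos_density_but_no_member_pos_density :
    ∃ (n : ℕ) (A : Fin n → Fin 2 → Set (shiftInvSub (FreeGroup.of true : FreeGroup Bool))),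
      (∀ i, ∀ j₁ j₂ : Fin 2, j₁ ≠ j₂ → Disjoint (A i j₁) (A i j₂)) ∧
      (∀ i j, IsClosed (A i j)) ∧
      HasPosIndepDensityOf (subshiftAct (FreeGroup.of true : FreeGroup Bool)) A ∧
      ∀ i, ¬ HasPosIndepDensityOf (subshiftAct (FreeGroup.of true : FreeGroup Bool))
        (fun _ : Unit => A i) := by
  classical
  let v : Fin 2 → UnitAddCircle := ![0, ((1 / 2 : ℝ) : UnitAddCircle)]
  let c : Fin 2 → FreeGroup Bool := ![1, FreeGroup.of false]
  have hv01 : v 0 ≠ v 1 := by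
    intro h
    have h2 : ((1 / 2 : ℝ) : UnitAddCircle) = 0 := h.symm
    rw [AddCircle.coe_eq_zero_of_pos_iff 1 one_pos (by norm_num)] at h2
    obtain ⟨n, hn⟩ := h2
    rw [nsmul_one] at hn
    have : (2 * n : ℝ) = 1 := by linarith
    norm_cast at this
    omega
  have hv : Function.Injective v := by
    intro i j h
    fin_cases i <;> fin_cases j
    · rfl
    · exact absurd h hv01
    · exact absurd h.symm hv01
    · rfl
  refine ⟨2, fun i j => coordinateFiber _ (c i) (v j),
    fun i j₁ j₂ h => disjoint_coordinateFiber _ _ (hv.ne h),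
    fun i j => isClosed_coordinateFiber _ _ _, ⟨1 / 2, by norm_num, fun F _ => ?_⟩,
    fun i => not_hasPosIndepDensityOf_coordinateFiber
      (IsMulTorsionFree.pow_right_injective (FreeGroup.of_ne_one _)) hv01⟩
  obtain ⟨i, hi⟩ : ∃ i, F.card ≤ 2 * (F.image (coordinateCoset (FreeGroup.of true) (c i))).card := by
    have h := card_le_card_image_coordinateCoset_add F
    by_contra! hlt
    have h0 : 2 * (F.image (coordinateCoset (FreeGroup.of true) 1)).card < F.card := hlt 0
    have h1 : 2 * (F.image (coordinateCoset (FreeGroup.of true) (FreeGroup.of false))).card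
      < F.card := hlt 1
    omega
  obtain ⟨J, hJF, hcard, hJ⟩ :=
    exists_isIndepSetOf_card_eq (a := FreeGroup.of true) (t := c i) v F
  refine ⟨J, hJF, ?_, i, hJ⟩
  rw [← hcard] at hi
  have : (F.card : ℝ) ≤ 2 * J.card := by exact_mod_cast hi
  linarith
end

section
/- Let Γ be a countably infinite discrete group acting on a compact metrizable space X by homeomorphisms. If X has a non-diagonal orbit IE-pair (an orbit IE-pair (x, y) with x ≠ y), then the naive topological entropy h^nv(Γ↷X) is positive. -/
open scoped ENNReal NNReal

/-- `𝒰^F = ⋁_{s ∈ F} s⁻¹𝒰`: the join of the pullbacks of `𝒰` by the elements of `F`,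
consisting of all intersections `⋂_{s ∈ F} s⁻¹ U_s` over choices `U_s ∈ 𝒰`. -/
noncomputable def jointCover {Γ : Type*} [Group Γ] {X : Type*} [MulAction Γ X]
    (F : Finset Γ) (𝒰 : Finset (Set X)) : Finset (Set X) := by
  classical
  exact (F.pi fun _ => 𝒰).image fun ω => ⋂ s : Γ, ⋂ h : s ∈ F, (fun x : X => s • x) ⁻¹' ω s h

/-- The naive topological entropy
`h^nv(Γ ↷ X) = sup_𝒰 inf_F (1/|F|) log N(𝒰^F)`, where `𝒰` ranges over finite open
covers of `X` and `F` over nonempty finite subsets of `Γ`, as an extended nonnegative real. -/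
noncomputable def naiveEntropy (Γ X : Type*) [Group Γ] [TopologicalSpace X] [MulAction Γ X] :
    ℝ≥0∞ :=
  ⨆ 𝒰 : {𝒰 : Finset (Set X) // IsFinOpenCover 𝒰},
    ⨅ F : {F : Finset Γ // F.Nonempty},
      ENNReal.ofReal (Real.log (coverNum (jointCover F.1 𝒰.1) : ℝ) / (F.1.card : ℝ))


/-- The join of the pullbacks of a cover is again a cover. -/
theorem sUnion_jointCover {Γ : Type*} [Group Γ] {X : Type*} [MulAction Γ X]
    (F : Finset Γ) {𝒰 : Finset (Set X)} (h𝒰 : ⋃₀ (𝒰 : Set (Set X)) = Set.univ) :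
    ⋃₀ (jointCover F 𝒰 : Set (Set X)) = Set.univ := by
  classical
  refine Set.eq_univ_of_forall fun x => ?_
  have hx : ∀ s : Γ, ∃ U ∈ 𝒰, s • x ∈ U := fun s => by
    have : s • x ∈ ⋃₀ (𝒰 : Set (Set X)) := h𝒰 ▸ Set.mem_univ _
    simpa using this
  choose U hU hxU using hx
  refine ⟨⋂ s : Γ, ⋂ _ : s ∈ F, (fun x : X => s • x) ⁻¹' U s, ?_, ?_⟩
  · rw [jointCover, Finset.mem_coe, Finset.mem_image]
    exact ⟨fun s _ => U s, Finset.mem_pi.2 fun s _ => hU s, rfl⟩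
  · exact Set.mem_iInter₂.2 fun s _ => hxU s

/-- The minimal cardinality of a subcover of a cover is attained. -/
theorem exists_subcover_card_eq_coverNum {X : Type*} {𝒰 : Finset (Set X)}
    (h𝒰 : ⋃₀ (𝒰 : Set (Set X)) = Set.univ) :
    ∃ 𝒱 ⊆ 𝒰, ⋃₀ (𝒱 : Set (Set X)) = Set.univ ∧ 𝒱.card = coverNum 𝒰 := by
  have hne : {n | ∃ 𝒱 : Finset (Set X), 𝒱 ⊆ 𝒰 ∧ ⋃₀ (𝒱 : Set (Set X)) = Set.univ ∧
      𝒱.card = n}.Nonempty := ⟨_, 𝒰, subset_rfl, h𝒰, rfl⟩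
  obtain ⟨𝒱, h, hcov, hcard⟩ := Nat.sInf_mem hne
  exact ⟨𝒱, h, hcov, hcard⟩

/-- If every member of a cover `𝒰` misses one of the two sets `A 0`, `A 1`, and `J ⊆ F` is an
independence set for `A`, then every subcover of `𝒰^F` has at least `2 ^ |J|` members. -/
theorem two_pow_card_le_coverNum_jointCover {Γ : Type*} [Group Γ] {X : Type*} [MulAction Γ X]
    {A : Fin 2 → Set X} {𝒰 : Finset (Set X)} (h𝒰 : ⋃₀ (𝒰 : Set (Set X)) = Set.univ)
    (hA : ∀ U ∈ 𝒰, ∃ i, Disjoint U (A i)) {F J : Finset Γ} (hJF : J ⊆ F) (hJ : J.Nonempty)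
    (hind : IsIndepSet A (J : Set Γ)) :
    2 ^ J.card ≤ coverNum (jointCover F 𝒰) := by
  classical
  obtain ⟨𝒱, h𝒱, hcov, hcard⟩ := exists_subcover_card_eq_coverNum (sUnion_jointCover F h𝒰)
  have hpt : ∀ S : Finset Γ, ∃ x : X, ∀ s ∈ J, s • x ∈ A (if s ∈ S then 1 else 0) := fun S => by
    obtain ⟨x, hx⟩ := hind J subset_rfl hJ fun s => if s ∈ S then 1 else 0
    exact ⟨x, fun s hs => Set.mem_iInter₂.1 hx s hs⟩
  choose p hp using hpt
  have hV : ∀ S : Finset Γ, ∃ V ∈ 𝒱, p S ∈ V := fun S => by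
    have : p S ∈ ⋃₀ (𝒱 : Set (Set X)) := hcov ▸ Set.mem_univ _
    simpa using this
  choose V hV hpV using hV
  rw [← hcard, ← Finset.card_powerset]
  refine Finset.card_le_card_of_injOn V (fun S _ => hV S) fun S hS T hT hST => ?_
  rw [Finset.mem_coe, Finset.mem_powerset] at hS hT
  have hmem := h𝒱 (hV S)
  rw [jointCover, Finset.mem_image] at hmem
  obtain ⟨ω, hω, hωV⟩ := hmem
  have hiff : ∀ s ∈ J, (s ∈ S ↔ s ∈ T) := fun s hs => by
    obtain ⟨i, hi⟩ := hA _ (Finset.mem_pi.1 hω s (hJF hs))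
    have key : ∀ R : Finset Γ, V R = V S → i ≠ if s ∈ R then 1 else 0 := by
      rintro R hR rfl
      have hpR := hpV R
      rw [hR, ← hωV] at hpR
      exact Set.disjoint_left.1 hi (Set.mem_iInter₂.1 hpR s (hJF hs)) (hp R s hs)
    have h₁ := key S rfl
    have h₂ := key T hST.symm
    by_cases hsS : s ∈ S <;> by_cases hsT : s ∈ T <;> simp [hsS, hsT] at h₁ h₂ ⊢ <;> omega
  ext s
  exact ⟨fun h => (hiff s (hS h)).1 h, fun h => (hiff s (hT h)).2 h⟩

/-- Let a countably infinite group `Γ` act by homeomorphisms on a compact metrizable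
space `X`. If `X` has a non-diagonal orbit IE-pair, i.e. a pair `(x, y)` with `x ≠ y`
such that for every product neighborhood `U₁ × U₂` of `(x, y)` the pair `(U₁, U₂)` has
positive independence density, then the naive topological entropy of the action is
positive. -/
theorem nondiagonal_orbit_IE_pair_implies_positive_naive_entropy
    {Γ : Type*} [Group Γ] [Countable Γ] [Infinite Γ]
    {X : Type*} [TopologicalSpace X] [CompactSpace X] [TopologicalSpace.MetrizableSpace X]
    [MulAction Γ X] [ContinuousConstSMul Γ X]
    (x y : X) (hxy : x ≠ y)
    (h : ∀ U₁ U₂ : Set X, IsOpen U₁ → IsOpen U₂ → x ∈ U₁ → y ∈ U₂ →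
      HasPosIndepDensity Γ (fun _ : Unit => ![U₁, U₂])) :
    0 < naiveEntropy Γ X := by
  classical
  obtain ⟨U₁, hx, hU₁, U₂, hy, hU₂, hdisj⟩ := exists_open_nhds_disjoint_closure hxy
  obtain ⟨q, hq, hF⟩ := h U₁ U₂ hU₁ hU₂ hx hy
  let 𝒰 : Finset (Set X) := {(closure U₁)ᶜ, (closure U₂)ᶜ}
  have hcov : ⋃₀ (𝒰 : Set (Set X)) = Set.univ := by
    simp only [𝒰, Finset.coe_insert, Finset.coe_singleton, Set.sUnion_pair]
    rw [← Set.compl_inter, hdisj.inter_eq, Set.compl_empty]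
  have h𝒰 : IsFinOpenCover 𝒰 := by
    refine ⟨?_, hcov⟩
    simp [𝒰]
  have hmiss : ∀ U ∈ 𝒰, ∃ i, Disjoint U (![U₁, U₂] i) := by
    have hc : ∀ U : Set X, Disjoint (closure U)ᶜ U := fun U =>
      disjoint_compl_left.mono_right subset_closure
    intro U hU
    simp only [𝒰, Finset.mem_insert, Finset.mem_singleton] at hU
    rcases hU with rfl | rfl
    · exact ⟨0, hc U₁⟩
    · exact ⟨1, hc U₂⟩
  refine lt_of_lt_of_le (ENNReal.ofReal_pos.2 (mul_pos hq (Real.log_pos one_lt_two)))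
    (le_iSup_of_le ⟨𝒰, h𝒰⟩ (le_iInf fun ⟨F, hFne⟩ => ENNReal.ofReal_le_ofReal ?_))
  obtain ⟨J, hJF, hJq, _, hind⟩ := hF F hFne
  have hFpos : (0 : ℝ) < F.card := by exact_mod_cast hFne.card_pos
  have hJ : J.Nonempty := Finset.card_pos.1 (by exact_mod_cast (mul_pos hq hFpos).trans_le hJq)
  have hN : (2 : ℝ) ^ J.card ≤ coverNum (jointCover F 𝒰) := by
    exact_mod_cast two_pow_card_le_coverNum_jointCover hcov hmiss hJF hJ hind
  rw [le_div_iff₀ hFpos]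
  calc q * Real.log 2 * F.card = q * F.card * Real.log 2 := by ring
    _ ≤ J.card * Real.log 2 := by gcongr
    _ = Real.log (2 ^ J.card) := (Real.log_pow _ _).symm
    _ ≤ Real.log (coverNum (jointCover F 𝒰)) := Real.log_le_log (by positivity) hN
end
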